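/- Let Ω ⊆ ℂ^n be a nonempty bounded connected open set with C¹-smooth boundary whose closure Ω̄ is polynomially convex, and let h_1,…,h_N be continuous complex-valued functions on Ω̄ whose restrictions to Ω are pluriharmonic; write h = (h_1,…,h_N). If [z,h]_{∂Ω} = C(∂Ω,ℂ), then [z,h]_{Ω̄} = C(Ω̄,ℂ). -/

import Mathlib

open Metric

noncomputable def polyHull {m : ℕ} (K : Set (Fin m → ℂ)) : Set (Fin m → ℂ) :=
  {z | ∀ p : MvPolynomial (Fin m) ℂ,
    ‖MvPolynomial.eval z p‖ ≤ sSup ((fun w => ‖MvPolynomial.eval w p‖) '' K)}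

def NoAnalyticDisk {m : ℕ} (S : Set (Fin m → ℂ)) : Prop :=
  ∀ φ : ℂ → (Fin m → ℂ), DifferentiableOn ℂ φ (ball (0:ℂ) 1) →
    (∀ z ∈ ball (0:ℂ) 1, φ z ∈ S) →
    ∀ z ∈ ball (0:ℂ) 1, ∀ w ∈ ball (0:ℂ) 1, φ z = φ w

noncomputable def genAlg {X : Type*} [TopologicalSpace X] (S : Set C(X, ℂ)) : Set C(X, ℂ) :=
  closure ((Algebra.adjoin ℂ S : Subalgebra ℂ C(X, ℂ)) : Set C(X, ℂ))

def Pluriharmonic {n : ℕ} (h : (Fin n → ℂ) → ℂ) (Ω : Set (Fin n → ℂ)) : Prop :=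
  ∀ z ∈ Ω, ∃ U, IsOpen U ∧ z ∈ U ∧ U ⊆ Ω ∧
    ∃ F G : (Fin n → ℂ) → ℂ, DifferentiableOn ℂ F U ∧ DifferentiableOn ℂ G U ∧
      ∀ w ∈ U, h w = F w + starRingEnd ℂ (G w)

def C1Boundary {n : ℕ} (Ω : Set (Fin n → ℂ)) : Prop :=
  ∀ p ∈ frontier Ω, ∃ W : Set (Fin n → ℂ), IsOpen W ∧ p ∈ W ∧
    ∃ ρ : (Fin n → ℂ) → ℝ, ContDiffOn ℝ 1 ρ W ∧ (∀ w ∈ W, fderiv ℝ ρ w ≠ 0) ∧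
      Ω ∩ W = {w ∈ W | ρ w < 0} ∧ frontier Ω ∩ W = {w ∈ W | ρ w = 0}

def zhGens {n N : ℕ} (M : Set (Fin n → ℂ)) (h : Fin N → (Fin n → ℂ) → ℂ) :
    Set C(M, ℂ) :=
  {g | (∃ i : Fin n, ∀ z : M, g z = (z : Fin n → ℂ) i) ∨
       (∃ j : Fin N, ∀ z : M, g z = h j (z : Fin n → ℂ))}

def graphSet {n N : ℕ} (h : Fin N → (Fin n → ℂ) → ℂ) (E : Set (Fin n → ℂ)) :
    Set (Fin (n + N) → ℂ) :=
  (fun z => Fin.append z (fun j => h j z)) '' E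

noncomputable def dbar {m : ℕ} (l : Fin m) (f : (Fin m → ℂ) → ℂ) (ζ : Fin m → ℂ) : ℂ :=
  (1/2) * (fderiv ℝ f ζ (Pi.single l 1) + Complex.I * fderiv ℝ f ζ (Pi.single l Complex.I))

section dbar
variable {m : ℕ} {l : Fin m} {f g : (Fin m → ℂ) → ℂ} {ζ : Fin m → ℂ}

lemma dbar_congr (h : f =ᶠ[nhds ζ] g) : dbar l f ζ = dbar l g ζ := by
  simp only [dbar, h.fderiv_eq]

lemma dbar_add (hf : DifferentiableAt ℝ f ζ) (hg : DifferentiableAt ℝ g ζ) :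
    dbar l (fun x => f x + g x) ζ = dbar l f ζ + dbar l g ζ := by
  simp only [dbar, fderiv_fun_add hf hg, _root_.add_apply]; ring

lemma dbar_sub (hf : DifferentiableAt ℝ f ζ) (hg : DifferentiableAt ℝ g ζ) :
    dbar l (fun x => f x - g x) ζ = dbar l f ζ - dbar l g ζ := by
  simp only [dbar, fderiv_fun_sub hf hg, _root_.sub_apply]; ring

lemma dbar_mul (hf : DifferentiableAt ℝ f ζ) (hg : DifferentiableAt ℝ g ζ) :
    dbar l (fun x => f x * g x) ζ = dbar l f ζ * g ζ + f ζ * dbar l g ζ := by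
  simp only [dbar, fderiv_fun_mul hf hg, _root_.add_apply,
    _root_.smul_apply, smul_eq_mul]; ring

lemma dbar_const (c : ℂ) : dbar l (fun _ => c) ζ = 0 := by simp [dbar]

lemma dbar_sum {ι : Type*} (s : Finset ι) (F : ι → (Fin m → ℂ) → ℂ)
    (hF : ∀ i ∈ s, DifferentiableAt ℝ (F i) ζ) :
    dbar l (fun x => ∑ i ∈ s, F i x) ζ = ∑ i ∈ s, dbar l (F i) ζ := by
  simp only [dbar, fderiv_fun_sum hF, _root_.sum_apply, Finset.mul_sum,
    ← Finset.sum_add_distrib]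

lemma dbar_holo (hf : DifferentiableAt ℂ f ζ) : dbar l f ζ = 0 := by
  have h : fderiv ℝ f ζ = (fderiv ℂ f ζ).restrictScalars ℝ := hf.fderiv_restrictScalars ℝ
  have e : (Pi.single l Complex.I : Fin m → ℂ) = Complex.I • Pi.single l (1:ℂ) := by
    rw [← Pi.single_smul]; simp
  simp only [dbar, h, ContinuousLinearMap.coe_restrictScalars', e, map_smul, smul_eq_mul]
  rw [← mul_assoc, Complex.I_mul_I]; ring

lemma dbar_inv (hf : DifferentiableAt ℝ f ζ) (h0 : f ζ ≠ 0) :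
    dbar l (fun x => (f x)⁻¹) ζ = - dbar l f ζ / (f ζ)^2 := by
  have hi : DifferentiableAt ℝ (fun x => (f x)⁻¹) ζ := hf.inv h0
  have h1 : dbar l (fun x => f x * (f x)⁻¹) ζ = 0 := by
    rw [dbar_congr (g := fun _ => (1:ℂ)), dbar_const]
    filter_upwards [hf.continuousAt.eventually_ne h0] with x hx
    exact mul_inv_cancel₀ hx
  rw [dbar_mul hf hi] at h1
  field_simp at h1 ⊢
  linear_combination h1

lemma dbar_div (hf : DifferentiableAt ℝ f ζ) (hg : DifferentiableAt ℝ g ζ) (h0 : g ζ ≠ 0) :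
    dbar l (fun x => f x / g x) ζ = dbar l f ζ / g ζ - f ζ * dbar l g ζ / (g ζ)^2 := by
  simp only [div_eq_mul_inv]
  rw [dbar_mul (g := fun x => (g x)⁻¹) hf (hg.inv h0), dbar_inv hg h0]
  field_simp; ring

lemma dbar_prod {ι : Type*} [DecidableEq ι] (s : Finset ι) (F : ι → (Fin m → ℂ) → ℂ)
    (hF : ∀ i ∈ s, DifferentiableAt ℝ (F i) ζ) :
    dbar l (fun x => ∏ i ∈ s, F i x) ζ = ∑ i ∈ s, (∏ j ∈ s.erase i, F j ζ) * dbar l (F i) ζ := by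
  simp only [dbar]
  rw [(HasFDerivAt.finsetProd (fun i hi => (hF i hi).hasFDerivAt)).fderiv]
  simp only [_root_.sum_apply, Finset.mul_sum,
    ← Finset.sum_add_distrib, _root_.smul_apply, smul_eq_mul]
  refine Finset.sum_congr rfl fun i _ => ?_
  ring

lemma contDiff_dbar {k n : ℕ∞} (hf : ContDiff ℝ n f) (h : k + 1 ≤ n) : ContDiff ℝ k (dbar l f) := by
  have : ContDiff ℝ k (fderiv ℝ f) := hf.fderiv_right (by exact_mod_cast h)
  unfold dbar
  fun_prop

lemma dbar_comm (hf : ContDiff ℝ 2 f) (k l : Fin m) :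
    dbar k (dbar l f) ζ = dbar l (dbar k f) ζ := by
  have hs : IsSymmSndFDerivAt ℝ f ζ := hf.contDiffAt.isSymmSndFDerivAt (by simp)
  have hd : Differentiable ℝ (fderiv ℝ f) :=
    (hf.fderiv_right (m := 1) (by norm_num)).differentiable (by norm_num)
  have key : ∀ l : Fin m, ∀ v, fderiv ℝ (dbar l f) ζ v =
      (1/2) * (fderiv ℝ (fderiv ℝ f) ζ v (Pi.single l 1) +
        Complex.I * fderiv ℝ (fderiv ℝ f) ζ v (Pi.single l Complex.I)) := by
    intro l v
    have h1 : ∀ w, HasFDerivAt (fun x => fderiv ℝ f x w) ((fderiv ℝ (fderiv ℝ f) ζ).flip w) ζ := by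
      intro w
      have := (hd ζ).hasFDerivAt.clm_apply (hasFDerivAt_const w ζ)
      simpa using this
    have h2 := (((h1 (Pi.single l 1)).add ((h1 (Pi.single l Complex.I)).const_mul Complex.I)).const_mul (1/2 : ℂ))
    have h3 := h2.fderiv
    have h4 : (dbar l f) = fun y => (1/2 : ℂ) * ((fun x => fderiv ℝ f x (Pi.single l 1)) + fun x => Complex.I * fderiv ℝ f x (Pi.single l Complex.I)) y := by
      ext y; simp [dbar]
    rw [h4, h3]; simp; ring
  rw [dbar, dbar, key, key, key, key]
  rw [hs.eq (Pi.single k 1) (Pi.single l 1), hs.eq (Pi.single k 1) (Pi.single l Complex.I),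
    hs.eq (Pi.single k Complex.I) (Pi.single l Complex.I), hs.eq (Pi.single k Complex.I) (Pi.single l 1)]
  ring

lemma dbar_zero_of_notMem_tsupport (h : ζ ∉ tsupport f) : dbar l f ζ = 0 := by
  rw [dbar_congr (g := fun _ => (0:ℂ)), dbar_const]
  filter_upwards [(isClosed_tsupport f).isOpen_compl.mem_nhds h] with x hx
  exact image_eq_zero_of_notMem_tsupport hx

lemma hasCompactSupport_dbar (h : HasCompactSupport f) : HasCompactSupport (dbar l f) :=
  HasCompactSupport.intro h fun _ hx => dbar_zero_of_notMem_tsupport hx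

open MeasureTheory in
lemma dbar_parts (hf : ContDiff ℝ 1 f) (hg : ContDiff ℝ 1 g) (hc : HasCompactSupport f) :
    ∫ x, dbar l f x * g x = - ∫ x, f x * dbar l g x := by
  have cf := hf.continuous
  have cg := hg.continuous
  have cf' : ∀ v, Continuous (fun x => fderiv ℝ f x v) := fun v =>
    (hf.continuous_fderiv (by norm_num)).clm_apply continuous_const
  have cg' : ∀ v, Continuous (fun x => fderiv ℝ g x v) := fun v =>
    (hg.continuous_fderiv (by norm_num)).clm_apply continuous_const
  have i1 : ∀ v, Integrable (fun x => fderiv ℝ f x v * g x) := fun v =>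
    ((cf' v).mul cg).integrable_of_hasCompactSupport ((hc.fderiv_apply (𝕜 := ℝ) v).mul_right)
  have i2 : ∀ v, Integrable (fun x => f x * fderiv ℝ g x v) := fun v =>
    (cf.mul (cg' v)).integrable_of_hasCompactSupport hc.mul_right
  have i3 : Integrable (fun x => f x * g x) :=
    (cf.mul cg).integrable_of_hasCompactSupport hc.mul_right
  have key : ∀ v, ∫ x, f x * fderiv ℝ g x v = - ∫ x, fderiv ℝ f x v * g x := fun v =>
    integral_mul_fderiv_eq_neg_fderiv_mul_of_integrable (i1 v) (i2 v) i3
      (fun x _ => hf.differentiable (by norm_num) x) (fun x _ => hg.differentiable (by norm_num) x)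
  have e1 : ∀ x, dbar l f x * g x = (1/2 : ℂ) * (fderiv ℝ f x (Pi.single l 1) * g x +
    Complex.I * (fderiv ℝ f x (Pi.single l Complex.I) * g x)) := fun x => by simp only [dbar]; ring
  have e2 : ∀ x, f x * dbar l g x = (1/2 : ℂ) * (f x * fderiv ℝ g x (Pi.single l 1) +
    Complex.I * (f x * fderiv ℝ g x (Pi.single l Complex.I))) := fun x => by simp only [dbar]; ring
  simp only [e1, e2]
  rw [integral_const_mul, integral_const_mul, integral_add (i1 _) ((i1 _).const_mul _),
    integral_add (i2 _) ((i2 _).const_mul _), integral_const_mul, integral_const_mul, key, key]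
  ring

open MeasureTheory in
lemma piola (b : Fin m → (Fin m → ℂ) → ℂ) (i : Fin m) (hb : ∀ j, j ≠ i → ContDiff ℝ 2 (b j))
    (hi : ContDiff ℝ 1 (b i)) (hc : HasCompactSupport (b i)) :
    ∫ x, Matrix.det (Matrix.of fun j l => dbar l (b j) x) = 0 := by
  classical
  have hb1 : ∀ j l, j ≠ i → ContDiff ℝ 1 (dbar l (b j)) := fun j l hj =>
    contDiff_dbar (k := 1) (n := 2) (hb j hj) (by norm_num)
  have e : ∀ x, Matrix.det (Matrix.of fun j l => dbar l (b j) x) =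
      ∑ σ : Equiv.Perm (Fin m), (Equiv.Perm.sign σ : ℂ) *
        (dbar (σ i) (b i) x * ∏ j ∈ Finset.univ.erase i, dbar (σ j) (b j) x) := by
    intro x
    rw [← Matrix.det_transpose, Matrix.det_apply']
    refine Finset.sum_congr rfl fun σ _ => ?_
    rw [Finset.mul_prod_erase Finset.univ (fun j => dbar (σ j) (b j) x) (Finset.mem_univ i)]
    rfl
  have hP : ∀ σ : Equiv.Perm (Fin m), ContDiff ℝ 1 (fun x => ∏ j ∈ Finset.univ.erase i, dbar (σ j) (b j) x) := by
    intro σ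
    exact contDiff_prod fun j hj => hb1 j _ (Finset.ne_of_mem_erase hj)
  have cd : ∀ l, Continuous (dbar l (b i)) := fun l => (contDiff_dbar (k := 0) (n := 1) hi (by norm_num)).continuous
  have hint : ∀ σ : Equiv.Perm (Fin m), ∫ x, (dbar (σ i) (b i) x * ∏ j ∈ Finset.univ.erase i, dbar (σ j) (b j) x)
      = - ∑ k ∈ Finset.univ.erase i, ∫ x, b i x * ((∏ j ∈ (Finset.univ.erase i).erase k, dbar (σ j) (b j) x) *
          dbar (σ i) (dbar (σ k) (b k)) x) := by
    intro σ
    rw [dbar_parts hi (hP σ) hc, ← integral_finsetSum]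
    · congr 1
      refine integral_congr_ae (Filter.Eventually.of_forall fun x => ?_)
      simp only
      rw [dbar_prod, Finset.mul_sum]
      intro j hj
      exact (hb1 j _ (Finset.ne_of_mem_erase hj)).differentiable (by norm_num) x
    · intro k hk
      refine Continuous.integrable_of_hasCompactSupport ?_ hc.mul_right
      refine hi.continuous.mul (Continuous.mul ?_ ?_)
      · exact continuous_finsetProd _ fun j hj => (hb1 j _ (Finset.ne_of_mem_erase (Finset.mem_of_mem_erase hj))).continuous
      · exact (contDiff_dbar (k := 0) (n := 1) (hb1 k _ (Finset.ne_of_mem_erase hk)) (by norm_num)).continuous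
  simp only [e]
  rw [integral_finsetSum]
  · simp only [integral_const_mul, hint, mul_neg, Finset.mul_sum, Finset.sum_neg_distrib]
    rw [Finset.sum_comm, neg_eq_zero]
    refine Finset.sum_eq_zero fun k hk => ?_
    have hki : k ≠ i := Finset.ne_of_mem_erase hk
    refine self_eq_neg.1 ?_
    rw [← Finset.sum_neg_distrib]
    refine Fintype.sum_equiv (Equiv.mulRight (Equiv.swap i k)) _ _ fun σ => ?_
    simp only [Equiv.coe_mulRight, Equiv.Perm.sign_mul, Equiv.Perm.sign_swap hki.symm, Equiv.Perm.mul_apply,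
      Equiv.swap_apply_left, Equiv.swap_apply_right]
    push_cast
    rw [mul_neg, mul_one, neg_mul, neg_neg]
    congr 1
    refine integral_congr_ae (Filter.Eventually.of_forall fun x => ?_)
    simp only
    rw [dbar_comm (hb k hki)]
    congr 2
    refine Finset.prod_congr rfl fun j hj => ?_
    simp only [Finset.mem_erase] at hj
    rw [Equiv.swap_apply_of_ne_of_ne hj.2.1 hj.1]
  · intro σ _
    refine Integrable.const_mul ?_ _
    exact Continuous.integrable_of_hasCompactSupport ((cd _).mul (hP σ).continuous) (hasCompactSupport_dbar hc).mul_right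

end dbar

lemma inv_mem_of_re {X : Type*} [TopologicalSpace X] [CompactSpace X]
    (A : Subalgebra ℂ C(X, ℂ)) (hA : IsClosed (A : Set C(X, ℂ))) (g k : C(X, ℂ)) (hg : g ∈ A)
    {ε : ℝ} (hε : 0 < ε) (hre : ∀ x, ε ≤ (g x).re) (hk : ∀ x, g x * k x = 1) : k ∈ A := by
  have : CompleteSpace A := hA.completeSpace_coe
  set R : ℝ := (‖g‖ ^ 2 + 1) / ε with hR
  have hR0 : 0 < R := by positivity
  let a : A := ⟨1 - (R⁻¹ : ℂ) • g, A.sub_mem A.one_mem (A.smul_mem hg _)⟩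
  have ha : ‖a‖ < 1 := by
    change ‖1 - (R⁻¹ : ℂ) • g‖ < 1
    rw [ContinuousMap.norm_lt_iff _ one_pos]
    intro x
    have h1 : ‖g x‖ ≤ ‖g‖ := g.norm_coe_le_norm x
    have h2 : ‖g x‖^2 = (g x).re^2 + (g x).im^2 := by
      rw [← Complex.normSq_eq_norm_sq, Complex.normSq_apply]; ring
    have h3 : ‖g x‖^2 ≤ ‖g‖^2 := by gcongr
    have h5 : ‖(1 - (R⁻¹ : ℂ) • g) x‖ ^ 2 < 1 := by
      have : (1 - (R⁻¹ : ℂ) • g) x = 1 - ((R⁻¹ : ℝ) : ℂ) * g x := by simp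
      rw [this, ← Complex.normSq_eq_norm_sq, Complex.normSq_apply]
      simp only [Complex.sub_re, Complex.one_re, Complex.re_ofReal_mul, Complex.sub_im, Complex.one_im, Complex.im_ofReal_mul]
      have h6 : R * ε = ‖g‖^2 + 1 := by rw [hR]; field_simp
      have h7 : (R⁻¹ * ((g x).re^2 + (g x).im^2)) < 2 * (g x).re := by
        rw [inv_mul_lt_iff₀ hR0]
        nlinarith [hre x, sq_nonneg ‖g‖]
      have : 0 < R⁻¹ := by positivity
      nlinarith
    nlinarith [norm_nonneg ((1 - (R⁻¹ : ℂ) • g) x)]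
  have hu := isUnit_one_sub_of_norm_lt_one ha
  obtain ⟨b, hb⟩ := hu.exists_right_inv
  have hb' : ∀ x, R⁻¹ * g x * (b : C(X, ℂ)) x = 1 := by
    intro x
    have := congrArg (fun t : A => (t : C(X, ℂ)) x) hb
    rw [mul_assoc]
    simpa [a] using this
  have : k = (R⁻¹ : ℂ) • (b : C(X, ℂ)) := by
    ext x
    have h1 := hb' x
    have h2 := hk x
    have h3 : g x ≠ 0 := left_ne_zero_of_mul_eq_one h2
    simp only [ContinuousMap.smul_apply, smul_eq_mul]
    apply mul_left_cancel₀ h3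
    rw [h2, ← h1]; push_cast; ring
  rw [this]
  exact A.smul_mem b.2 _

open MeasureTheory in
lemma integral_mem_closed {X : Type*} [TopologicalSpace X] [CompactSpace X] {m : ℕ}
    (A : Subalgebra ℂ C(X, ℂ)) (hA : IsClosed (A : Set C(X, ℂ)))
    (G : (Fin m → ℂ) × X → ℂ) (hG : Continuous G) (K : Set (Fin m → ℂ)) (hK : IsCompact K)
    (hsupp : ∀ ζ ∉ K, ∀ x, G (ζ, x) = 0) (hmem : ∀ ζ, ∀ g : C(X, ℂ), (∀ x, g x = G (ζ, x)) → g ∈ A) :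
    ∃ k ∈ A, ∀ x, k x = ∫ ζ, G (ζ, x) := by
  let Φ : C((Fin m → ℂ), C(X, ℂ)) := ContinuousMap.curry ⟨G, hG⟩
  have hΦ : ∀ ζ x, Φ ζ x = G (ζ, x) := fun ζ x => rfl
  have hcs : HasCompactSupport Φ := HasCompactSupport.intro hK fun ζ hζ => by
    ext x; rw [hΦ, hsupp ζ hζ]; rfl
  have hint : Integrable Φ := Φ.continuous.integrable_of_hasCompactSupport hcs
  refine ⟨∫ ζ, Φ ζ, ?_, ?_⟩
  · let M : Submodule ℂ C(X, ℂ) := Subalgebra.toSubmodule A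
    have : IsClosed (M : Set C(X, ℂ)) := hA
    have h0 : M.mkQL (∫ ζ, Φ ζ) = 0 := by
      rw [← ContinuousLinearMap.integral_comp_comm _ hint]
      have : ∀ ζ, M.mkQL (Φ ζ) = 0 := fun ζ => by
        simpa [M] using hmem ζ (Φ ζ) (hΦ ζ)
      simp [this]
    simpa [M] using h0
  · intro x
    have := (ContinuousMap.evalCLM ℂ x).integral_comp_comm hint
    simp only [ContinuousMap.evalCLM_apply] at this
    rw [← this]; rfl

def coordC {m : ℕ} (T : Set (Fin m → ℂ)) (i : Fin m) : C(T, ℂ) :=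
  ⟨fun z => z.1 i, (continuous_apply i).comp continuous_subtype_val⟩

noncomputable def PT {m : ℕ} (T : Set (Fin m → ℂ)) [CompactSpace T] : Subalgebra ℂ C(T, ℂ) :=
  (MvPolynomial.aeval (R := ℂ) (fun i => coordC T i)).range.topologicalClosure

lemma PT_isClosed {m : ℕ} (T : Set (Fin m → ℂ)) [CompactSpace T] : IsClosed (PT T : Set C(T, ℂ)) :=
  Subalgebra.isClosed_topologicalClosure _

lemma aeval_coord {m : ℕ} (T : Set (Fin m → ℂ)) (p : MvPolynomial (Fin m) ℂ) (z : T) :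
    (MvPolynomial.aeval (R := ℂ) (fun i => coordC T i) p) z =
      MvPolynomial.eval z.1 p := by
  induction p using MvPolynomial.induction_on with
  | C a => simp
  | add p q hp hq => simp [hp, hq]
  | mul_X p n hp =>
    rw [map_mul, MvPolynomial.aeval_X, map_mul, ContinuousMap.mul_apply, hp, MvPolynomial.eval_X]; rfl

lemma poly_mem_PT {m : ℕ} {T : Set (Fin m → ℂ)} [CompactSpace T] (p : MvPolynomial (Fin m) ℂ) (g : C(T, ℂ))
    (hg : ∀ z, g z = MvPolynomial.eval z.1 p) : g ∈ PT T := by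
  apply Subalgebra.le_topologicalClosure
  refine ⟨p, ?_⟩
  ext z
  rw [hg]; exact aeval_coord T p z

lemma mem_PT_approx {m : ℕ} {T : Set (Fin m → ℂ)} [CompactSpace T] {g : C(T, ℂ)} (hg : g ∈ PT T) {η : ℝ} (hη : 0 < η) :
    ∃ p : MvPolynomial (Fin m) ℂ, ∀ z : T, ‖g z - MvPolynomial.eval z.1 p‖ ≤ η := by
  have : g ∈ closure _ := hg
  rw [Metric.mem_closure_iff] at this
  obtain ⟨_, ⟨p, rfl⟩, hp⟩ := this η hη
  refine ⟨p, fun z => ?_⟩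
  rw [← aeval_coord T p z]
  have h1 := ContinuousMap.dist_apply_le_dist (f := g) (g := MvPolynomial.aeval (R := ℂ) (fun i => coordC T i) p) z
  rw [dist_eq_norm] at h1
  exact h1.trans hp.le

lemma continuous_eval' {m : ℕ} (p : MvPolynomial (Fin m) ℂ) : Continuous fun z : Fin m → ℂ => MvPolynomial.eval z p :=
  MvPolynomial.continuous_eval p

lemma contDiff_eval {m : ℕ} (p : MvPolynomial (Fin m) ℂ) : ContDiff ℂ ⊤ fun z : Fin m → ℂ => MvPolynomial.eval z p := by
  induction p using MvPolynomial.induction_on with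
  | C a => simpa using contDiff_const
  | add p q hp hq => simpa using hp.add hq
  | mul_X p n hp => simpa using hp.mul (contDiff_apply ℂ ℂ n)

lemma hefer {m : ℕ} (p : MvPolynomial (Fin m) ℂ) : ∃ q : Fin m → (Fin m → ℂ) × (Fin m → ℂ) → ℂ,
    (∀ i, ContDiff ℂ ⊤ (q i)) ∧ (∀ i ζ, ∃ r : MvPolynomial (Fin m) ℂ, ∀ z, q i (ζ, z) = MvPolynomial.eval z r) ∧
    ∀ ζ z, MvPolynomial.eval ζ p - MvPolynomial.eval z p = ∑ i, (ζ i - z i) * q i (ζ, z) := by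
  classical
  induction p using MvPolynomial.induction_on with
  | C a => exact ⟨fun _ _ => 0, fun i => contDiff_const, fun i ζ => ⟨0, by simp⟩, by simp⟩
  | add p q hp hq =>
    obtain ⟨a, a1, a2, a3⟩ := hp
    obtain ⟨b, b1, b2, b3⟩ := hq
    refine ⟨fun i x => a i x + b i x, fun i => (a1 i).add (b1 i), fun i ζ => ?_, fun ζ z => ?_⟩
    · obtain ⟨r, hr⟩ := a2 i ζ
      obtain ⟨s, hs⟩ := b2 i ζ
      exact ⟨r + s, fun z => by simp [hr, hs]⟩
    · simp only [map_add, mul_add, Finset.sum_add_distrib, ← a3, ← b3]; ring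
  | mul_X p n hp =>
    obtain ⟨a, a1, a2, a3⟩ := hp
    refine ⟨fun i x => x.1 n * a i x + (if i = n then 1 else 0) * MvPolynomial.eval x.2 p, fun i => ?_, fun i ζ => ?_, fun ζ z => ?_⟩
    · refine ContDiff.add (ContDiff.mul ?_ (a1 i)) (contDiff_const.mul ((contDiff_eval p).comp contDiff_snd))
      exact (contDiff_apply ℂ ℂ n).comp contDiff_fst
    · obtain ⟨r, hr⟩ := a2 i ζ
      refine ⟨MvPolynomial.C (ζ n) * r + MvPolynomial.C (if i = n then 1 else 0) * p, fun z => by simp only [hr]; split_ifs <;> simp⟩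
    · simp only [map_mul, MvPolynomial.eval_X, mul_add, Finset.sum_add_distrib]
      have : ∑ i, (ζ i - z i) * (ζ n * a i (ζ, z)) = ζ n * ∑ i, (ζ i - z i) * a i (ζ, z) := by
        rw [Finset.mul_sum]; exact Finset.sum_congr rfl fun i _ => by ring
      rw [this, ← a3]
      simp only [ite_mul, one_mul, zero_mul, mul_ite, mul_zero, Finset.sum_ite_eq', Finset.mem_univ, if_true]
      ring

lemma sep_poly {m : ℕ} {T : Set (Fin m → ℂ)} (hT : IsCompact T) (hne : T.Nonempty) (hull : polyHull T = T)
    {ζ : Fin m → ℂ} (hζ : ζ ∉ T) : ∃ p : MvPolynomial (Fin m) ℂ,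
      (∀ z ∈ T, ‖MvPolynomial.eval z p‖ ≤ 1/2) ∧ 2 < ‖MvPolynomial.eval ζ p‖ := by
  rw [← hull] at hζ
  simp only [polyHull, Set.mem_ofPred_eq, not_forall, not_le] at hζ
  obtain ⟨p, hp⟩ := hζ
  set M := sSup ((fun w => ‖MvPolynomial.eval w p‖) '' T) with hM
  have hbd : BddAbove ((fun w => ‖MvPolynomial.eval w p‖) '' T) :=
    (hT.image (MvPolynomial.continuous_eval p).norm).bddAbove
  have hle : ∀ z ∈ T, ‖MvPolynomial.eval z p‖ ≤ M := fun z hz => le_csSup hbd ⟨z, hz, rfl⟩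
  have hM0 : 0 ≤ M := by
    obtain ⟨z, hz⟩ := hne
    exact (norm_nonneg _).trans (hle z hz)
  obtain ⟨c, hc1, hc2⟩ := exists_between hp
  have hc : 0 < c := hM0.trans_lt hc1
  have ha : M / c < 1 := (div_lt_one hc).2 hc1
  have hb : 1 < ‖MvPolynomial.eval ζ p‖ / c := (one_lt_div hc).2 hc2
  obtain ⟨e1, h1⟩ := exists_pow_lt_of_lt_one (show (0:ℝ) < 1/2 by norm_num) ha
  obtain ⟨e2, h2⟩ := pow_unbounded_of_one_lt 2 hb
  have hnorm : ∀ z, ‖MvPolynomial.eval z ((MvPolynomial.C ((c:ℂ)⁻¹) * p) ^ (e1 + e2))‖ =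
      (‖MvPolynomial.eval z p‖ / c) ^ (e1 + e2) := by
    intro z
    simp only [map_pow, map_mul, MvPolynomial.eval_C, norm_pow, norm_mul, norm_inv, Complex.norm_real,
      Real.norm_of_nonneg hc.le]
    rw [inv_mul_eq_div]
  refine ⟨(MvPolynomial.C ((c:ℂ)⁻¹) * p) ^ (e1 + e2), fun z hz => ?_, ?_⟩
  · rw [hnorm]
    calc (‖MvPolynomial.eval z p‖ / c) ^ (e1 + e2) ≤ (M / c) ^ (e1 + e2) := by
          gcongr; exact hle z hz
      _ ≤ (M / c) ^ e1 := pow_le_pow_of_le_one (by positivity) ha.le (by omega)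
      _ ≤ 1/2 := h1.le
  · rw [hnorm]
    exact h2.trans_le (pow_le_pow_right₀ hb.le (by omega))

lemma sep_family {m : ℕ} {T : Set (Fin m → ℂ)} (hT : IsCompact T) (hne : T.Nonempty) (hull : polyHull T = T)
    {N₁ : Set (Fin m → ℂ)} (hN : IsOpen N₁) (hTN : T ⊆ N₁) :
    ∃ s : Finset (MvPolynomial (Fin m) ℂ), (∀ p ∈ s, ∀ z ∈ T, ‖MvPolynomial.eval z p‖ ≤ 1/2) ∧
      ∀ ζ ∉ N₁, ∃ p ∈ s, 2 < ‖MvPolynomial.eval ζ p‖ := by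
  classical
  obtain ⟨R, hR1, hR⟩ : ∃ R : ℝ, 1 ≤ R ∧ ∀ z ∈ T, ‖z‖ ≤ R := by
    obtain ⟨R, hR⟩ := hT.isBounded.exists_norm_le
    exact ⟨max R 1, le_max_right _ _, fun z hz => (hR z hz).trans (le_max_left _ _)⟩
  obtain ⟨K, hKe⟩ : ∃ K, K = closedBall (0 : Fin m → ℂ) (4*R) \ N₁ := ⟨_, rfl⟩
  have hK : IsCompact K := hKe ▸ (isCompact_closedBall _ _).diff hN
  have hp : ∀ ζ : K, ∃ p : MvPolynomial (Fin m) ℂ,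
      (∀ z ∈ T, ‖MvPolynomial.eval z p‖ ≤ 1/2) ∧ 2 < ‖MvPolynomial.eval ζ.1 p‖ := by
    intro ζ
    refine sep_poly hT hne hull fun h => ?_
    have h3 : ζ.1 ∈ closedBall (0 : Fin m → ℂ) (4*R) \ N₁ := hKe.subset ζ.2
    exact h3.2 (hTN h)
  choose P hP1 hP2 using hp
  obtain ⟨t, ht⟩ := hK.elim_finite_subcover (fun ζ : K => {x | 2 < ‖MvPolynomial.eval x (P ζ)‖})
    (fun ζ => isOpen_lt continuous_const (MvPolynomial.continuous_eval _).norm)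
    (fun ζ hζ => by
      rw [Set.mem_iUnion]
      exact ⟨⟨ζ, hζ⟩, hP2 ⟨ζ, hζ⟩⟩)
  obtain ⟨Y, hY⟩ : ∃ Y : Fin m → MvPolynomial (Fin m) ℂ, ∀ i z, ‖MvPolynomial.eval z (Y i)‖ = (2*R)⁻¹ * ‖z i‖ := by
    refine ⟨fun i => MvPolynomial.C (((2*R : ℝ):ℂ)⁻¹) * MvPolynomial.X i, fun i z => ?_⟩
    rw [map_mul, MvPolynomial.eval_C, MvPolynomial.eval_X, norm_mul, norm_inv, Complex.norm_real, Real.norm_of_nonneg (by positivity)]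
  refine ⟨t.image P ∪ Finset.univ.image Y, ?_, ?_⟩
  · intro p hp z hz
    rcases Finset.mem_union.1 hp with h | h
    · obtain ⟨ζ, _, rfl⟩ := Finset.mem_image.1 h
      exact hP1 ζ z hz
    · obtain ⟨i, _, rfl⟩ := Finset.mem_image.1 h
      have := (norm_le_pi_norm z i).trans (hR z hz)
      rw [hY, inv_mul_le_iff₀ (by positivity)]
      linarith
  · intro ζ hζ
    by_cases h : ζ ∈ closedBall (0 : Fin m → ℂ) (4*R)
    · have := ht (hKe.superset ⟨h, hζ⟩)
      simp only [Set.mem_iUnion] at this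
      obtain ⟨ξ, hξ, h2⟩ := this
      exact ⟨P ξ, Finset.mem_union_left _ (Finset.mem_image_of_mem _ hξ), h2⟩
    · have h' : ¬ ‖ζ‖ ≤ 4 * R := by simpa using h
      rw [pi_norm_le_iff_of_nonneg (by positivity)] at h'
      push Not at h'
      obtain ⟨i, hi⟩ := h'
      refine ⟨_, Finset.mem_union_right _ (Finset.mem_image_of_mem _ (Finset.mem_univ i)), ?_⟩
      rw [hY, lt_inv_mul_iff₀ (by positivity)]
      linarith

lemma lemA {m : ℕ} {T : Set (Fin m → ℂ)} (hT : IsCompact T) (hne : T.Nonempty) (hull : polyHull T = T)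
    {N₁ : Set (Fin m → ℂ)} (hN : IsOpen N₁) (hTN : T ⊆ N₁) :
    ∃ (s : Finset (MvPolynomial (Fin m) ℂ)), ∀ z ∈ T, ∀ ζ ∉ N₁,
      1 ≤ (∑ p ∈ s, starRingEnd ℂ (MvPolynomial.eval ζ p) * (MvPolynomial.eval ζ p - MvPolynomial.eval z p)).re := by
  classical
  obtain ⟨s, hs1, hs2⟩ := sep_family hT hne hull hN hTN
  obtain ⟨e, he⟩ : ∃ e : ℕ, (s.card : ℝ) ≤ 4 ^ e := by
    obtain ⟨e, he⟩ := pow_unbounded_of_one_lt (s.card : ℝ) (show (1:ℝ) < 4 by norm_num)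
    exact ⟨e, he.le⟩
  refine ⟨s.image (fun p => p ^ (e+1)), fun z hz ζ hζ => ?_⟩
  set η : ℝ := (1/2)^(e+1) with hη
  have hη0 : 0 < η := by positivity
  have hη1 : η ≤ 1 := pow_le_one₀ (by norm_num) (by norm_num)
  have hcard : ((s.image (fun p => p ^ (e+1))).card : ℝ) * η^2 ≤ 1 := by
    have : ((s.image (fun p => p ^ (e+1))).card : ℝ) ≤ 4 ^ e := le_trans (by exact_mod_cast Finset.card_image_le) he
    calc _ ≤ 4^e * η^2 := by gcongr
      _ ≤ 4^(e+1) * η^2 := by gcongr <;> norm_num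
      _ = 1 := by rw [hη, ← pow_mul, mul_comm (e+1) 2, pow_mul, ← mul_pow]; norm_num
  set S := s.image (fun p => p ^ (e+1))
  have hterm : ∀ p ∈ S, ‖MvPolynomial.eval ζ p‖ * (‖MvPolynomial.eval ζ p‖ - η) ≤
      (starRingEnd ℂ (MvPolynomial.eval ζ p) * (MvPolynomial.eval ζ p - MvPolynomial.eval z p)).re := by
    intro p hp
    obtain ⟨q, hq, rfl⟩ := Finset.mem_image.1 hp
    have hb : ‖MvPolynomial.eval z (q^(e+1))‖ ≤ η := by
      rw [map_pow, norm_pow]; exact pow_le_pow_left₀ (norm_nonneg _) (hs1 q hq z hz) _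
    rw [mul_sub, mul_sub, Complex.sub_re]
    have h1 : (starRingEnd ℂ (MvPolynomial.eval ζ (q^(e+1))) * MvPolynomial.eval ζ (q^(e+1))).re = ‖MvPolynomial.eval ζ (q^(e+1))‖ * ‖MvPolynomial.eval ζ (q^(e+1))‖ := by
      rw [mul_comm, Complex.mul_conj, Complex.normSq_eq_norm_sq, sq, Complex.ofReal_re]
    have h2 : (starRingEnd ℂ (MvPolynomial.eval ζ (q^(e+1))) * MvPolynomial.eval z (q^(e+1))).re ≤ ‖MvPolynomial.eval ζ (q^(e+1))‖ * η := by
      refine (Complex.re_le_norm _).trans ?_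
      rw [norm_mul, RCLike.norm_conj]; gcongr
    linarith
  obtain ⟨p, hp, hp2⟩ := hs2 ζ hζ
  have hpS : p^(e+1) ∈ S := Finset.mem_image_of_mem _ hp
  have h2 : 2 ≤ ‖MvPolynomial.eval ζ (p^(e+1))‖ := by
    rw [map_pow, norm_pow]
    calc (2:ℝ) ≤ ‖MvPolynomial.eval ζ p‖ := hp2.le
      _ ≤ _ := le_self_pow₀ (by linarith) (by omega)
  rw [Complex.re_sum]
  refine le_trans ?_ (Finset.sum_le_sum hterm)
  rw [← Finset.add_sum_erase S _ hpS]
  have h3 : ∑ p ∈ S.erase (p^(e+1)), (-(η^2)/4 : ℝ) ≤ ∑ p ∈ S.erase (p^(e+1)), ‖MvPolynomial.eval ζ p‖ * (‖MvPolynomial.eval ζ p‖ - η) := by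
    refine Finset.sum_le_sum fun q _ => ?_
    nlinarith [sq_nonneg (‖MvPolynomial.eval ζ q‖ - η/2)]
  have h4 : -(1/4 : ℝ) ≤ ∑ p ∈ S.erase (p^(e+1)), (-(η^2)/4 : ℝ) := by
    rw [Finset.sum_const, nsmul_eq_mul]
    have : ((S.erase (p^(e+1))).card : ℝ) ≤ S.card := by exact_mod_cast Finset.card_le_card (Finset.erase_subset _ _)
    nlinarith [sq_nonneg η]
  nlinarith

lemma smooth_urysohn {m : ℕ} {s t : Set (Fin m → ℂ)} (hs : IsClosed s) (ht : IsClosed t) (hd : Disjoint s t) :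
    ∃ f : (Fin m → ℂ) → ℝ, ContDiff ℝ 2 f ∧ (∀ᶠ x in nhdsSet s, f x = 0) ∧ (∀ᶠ x in nhdsSet t, f x = 1) ∧
      ∀ x, 0 ≤ f x ∧ f x ≤ 1 := by
  obtain ⟨f, h1, h2, h3⟩ := exists_contMDiffMap_zero_one_nhds_of_isClosed (modelWithCornersSelf ℝ (Fin m → ℂ)) (n := 2) hs ht hd
  exact ⟨f, f.contMDiff.contDiff, h1, h2, fun x => ⟨(h3 x).1, (h3 x).2⟩⟩

structure OWData {m : ℕ} (T N₀ : Set (Fin m → ℂ)) where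
  χ : (Fin m → ℂ) → ℝ
  Q : Fin m → (Fin m → ℂ) × (Fin m → ℂ) → ℂ
  r : ℝ
  hr : 0 < r
  χ0 : ∀ ζ, 0 ≤ χ ζ
  χ1 : ∀ ζ, χ ζ ≤ 1
  χs : ContDiff ℝ 2 χ
  χnear : ∀ z ∈ T, ∀ ζ, ‖ζ - z‖ < r → χ ζ = 0
  χfar : ∀ ζ ∉ N₀, χ ζ = 1
  Qs : ∀ j, ContDiff ℝ 2 (Q j)
  Qp : ∀ ζ j, ∃ p : MvPolynomial (Fin m) ℂ, ∀ z, Q j (ζ, z) = MvPolynomial.eval z p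
  Qd : ∀ ζ j l, ∃ p : MvPolynomial (Fin m) ℂ, ∀ z, dbar l (fun x => Q j (x, z)) ζ = MvPolynomial.eval z p
  Qre : ∀ z ∈ T, ∀ ζ, χ ζ ≠ 0 → 1 ≤ (∑ i, (ζ i - z i) * Q i (ζ, z)).re

lemma exists_OWData {m : ℕ} {T : Set (Fin m → ℂ)} (hT : IsCompact T) (hne : T.Nonempty) (hull : polyHull T = T)
    {N₀ : Set (Fin m → ℂ)} (hN : IsOpen N₀) (hTN : T ⊆ N₀) : Nonempty (OWData T N₀) := by
  classical
  obtain ⟨δ, hδ, hδN⟩ := hT.exists_thickening_subset_open hN hTN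
  obtain ⟨χ, χs, χa, χb, χc⟩ := smooth_urysohn (s := cthickening (δ/2) T) (t := (thickening δ T)ᶜ)
    isClosed_cthickening isOpen_thickening.isClosed_compl (by
      rw [Set.disjoint_compl_right_iff_subset]
      exact cthickening_subset_thickening' hδ (by linarith) T)
  have χ0 : ∀ x ∈ cthickening (δ/2) T, χ x = 0 := fun x hx => Filter.Eventually.self_of_nhdsSet χa x hx
  have χ1 : ∀ x ∈ (thickening δ T)ᶜ, χ x = 1 := fun x hx => Filter.Eventually.self_of_nhdsSet χb x hx
  obtain ⟨s, hs⟩ := lemA hT hne hull (isOpen_thickening (δ := δ/2) (E := T)) (self_subset_thickening (by linarith) T)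
  choose q q1 q2 q3 using fun p : MvPolynomial (Fin m) ℂ => hefer p
  have dconj : ∀ p : MvPolynomial (Fin m) ℂ, ContDiff ℝ 2 (fun x : Fin m → ℂ => starRingEnd ℂ (MvPolynomial.eval x p)) := by
    intro p
    have h1 : ContDiff ℝ 2 (fun x : Fin m → ℂ => (MvPolynomial.eval x p)) := ((contDiff_eval p).restrict_scalars ℝ).of_le le_top
    exact Complex.conjCLE.contDiff.comp h1
  have dq : ∀ p i, ContDiff ℝ 2 (q p i) := fun p i => ((q1 p i).restrict_scalars ℝ).of_le le_top
  have hr2 : 0 < δ/2 := by positivity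
  refine ⟨⟨χ, fun j x => ∑ p ∈ s, starRingEnd ℂ (MvPolynomial.eval x.1 p) * q p j x, δ/2, hr2,
    fun x => (χc x).1, fun x => (χc x).2, χs, ?_, ?_, ?_, ?_, ?_, ?_⟩⟩
  · intro z hz ζ h
    apply χ0
    apply thickening_subset_cthickening
    rw [mem_thickening_iff]
    exact ⟨z, hz, by rwa [dist_eq_norm]⟩
  · intro ζ h
    exact χ1 _ fun h' => h (hδN h')
  · intro j
    refine ContDiff.sum fun p _ => ContDiff.mul ?_ (dq p j)
    exact (dconj p).comp contDiff_fst
  · intro ζ j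
    choose r hr using fun p : MvPolynomial (Fin m) ℂ => q2 p j ζ
    refine ⟨∑ p ∈ s, MvPolynomial.C (starRingEnd ℂ (MvPolynomial.eval ζ p)) * r p, fun z => ?_⟩
    simp [hr]
  · intro ζ j l
    choose r hr using fun p : MvPolynomial (Fin m) ℂ => q2 p j ζ
    refine ⟨∑ p ∈ s, MvPolynomial.C (dbar l (fun x => starRingEnd ℂ (MvPolynomial.eval x p)) ζ) * r p, fun z => ?_⟩
    have d1 : ∀ p, DifferentiableAt ℝ (fun x : Fin m → ℂ => starRingEnd ℂ (MvPolynomial.eval x p)) ζ := fun p =>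
      (dconj p).differentiable (by norm_num) ζ
    have d2 : ∀ p, DifferentiableAt ℂ (fun x : Fin m → ℂ => q p j (x, z)) ζ := fun p =>
      ((q1 p j).differentiable (by norm_num) (ζ, z)).comp ζ (by fun_prop)
    rw [dbar_sum]
    · simp only [map_sum, map_mul, MvPolynomial.eval_C]
      refine Finset.sum_congr rfl fun p _ => ?_
      rw [dbar_mul (d1 p) ((d2 p).restrictScalars ℝ), dbar_holo (d2 p), hr]
      simp
    · intro p _
      exact (d1 p).mul ((d2 p).restrictScalars ℝ)
  · intro z hz ζ h
    have := hs z hz ζ (fun h' => h (χ0 _ (thickening_subset_cthickening _ _ h')))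
    refine this.trans (le_of_eq ?_)
    congr 1
    simp only [q3, Finset.mul_sum]
    rw [Finset.sum_comm]
    exact Finset.sum_congr rfl fun i _ => Finset.sum_congr rfl fun p _ => by ring

lemma det_quot {m : ℕ} (S : Fin m → (Fin m → ℂ) → ℂ) (z ζ : Fin m → ℂ) (ε : ℂ)
    (hS : ∀ j, DifferentiableAt ℝ (S j) ζ) (hD : (∑ i, (ζ i - z i) * S i ζ) + ε ≠ 0) :
    Matrix.det (Matrix.of fun j l => dbar l (fun x => S j x / ((∑ i, (x i - z i) * S i x) + ε)) ζ) =
      ε * Matrix.det (Matrix.of fun j l => dbar l (S j) ζ) / ((∑ i, (ζ i - z i) * S i ζ) + ε) ^ (m+1) := by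
  have dx : ∀ i, DifferentiableAt ℂ (fun x : Fin m → ℂ => x i - z i) ζ := fun i => by fun_prop
  have dm : ∀ i, DifferentiableAt ℝ (fun x : Fin m → ℂ => (x i - z i) * S i x) ζ := fun i =>
    ((dx i).restrictScalars ℝ).mul (hS i)
  have dD0 : DifferentiableAt ℝ (fun x => (∑ i, (x i - z i) * S i x)) ζ := DifferentiableAt.fun_sum fun i _ => dm i
  have dD : DifferentiableAt ℝ (fun x => (∑ i, (x i - z i) * S i x) + ε) ζ := dD0.add_const _
  have hdD : ∀ l, dbar l (fun x => (∑ i, (x i - z i) * S i x) + ε) ζ = ∑ i, (ζ i - z i) * dbar l (S i) ζ := by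
    intro l
    rw [dbar_add dD0 (differentiableAt_const _), dbar_const, add_zero, dbar_sum _ _ (fun i _ => dm i)]
    refine Finset.sum_congr rfl fun i _ => ?_
    rw [dbar_mul ((dx i).restrictScalars ℝ) (hS i), dbar_holo (dx i)]; ring
  set D := (∑ i, (ζ i - z i) * S i ζ) + ε with hDdef
  have key : (Matrix.of fun j l => dbar l (fun x => S j x / ((∑ i, (x i - z i) * S i x) + ε)) ζ) =
      D⁻¹ • ((1 + Matrix.replicateCol Unit (fun j => - S j ζ / D) * Matrix.replicateRow Unit (fun i => ζ i - z i)) *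
        (Matrix.of fun j l => dbar l (S j) ζ)) := by
    ext j l
    rw [Matrix.of_apply, dbar_div (hS j) dD hD, hdD, ← hDdef]
    rw [Matrix.smul_apply, add_mul, one_mul, Matrix.add_apply, Matrix.mul_assoc, Matrix.mul_apply]
    simp only [Matrix.mul_apply, Finset.univ_unique, Finset.sum_singleton, Matrix.replicateCol_apply, Matrix.replicateRow_apply, Matrix.of_apply, smul_eq_mul]
    field_simp
    ring
  rw [key, Matrix.det_smul, Matrix.det_mul, Matrix.det_one_add_replicateCol_mul_replicateRow]
  have : (fun i => ζ i - z i) ⬝ᵥ (fun j => - S j ζ / D) = - (D - ε) / D := by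
    have : D - ε = ∑ i, (ζ i - z i) * S i ζ := by rw [hDdef]; ring
    rw [this, dotProduct, neg_div, Finset.sum_div, ← Finset.sum_neg_distrib]
    refine Finset.sum_congr rfl fun i _ => by ring
  rw [this, Fintype.card_fin, inv_pow]
  field_simp
  ring

lemma det_le_rows {m : ℕ} (A : Matrix (Fin m) (Fin m) ℂ) (c : Fin m → ℝ) (h : ∀ j l, ‖A j l‖ ≤ c j) :
    ‖A.det‖ ≤ m.factorial * ∏ j, c j := by
  rw [← Matrix.det_transpose, Matrix.det_apply]
  refine (norm_sum_le _ _).trans ?_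
  have : ∀ σ : Equiv.Perm (Fin m), ‖Equiv.Perm.sign σ • ∏ i, A.transpose (σ i) i‖ ≤ ∏ j, c j := by
    intro σ
    have h1 : ‖Equiv.Perm.sign σ • ∏ i, A.transpose (σ i) i‖ = ‖∏ i, A.transpose (σ i) i‖ := by
      rcases Int.units_eq_one_or (Equiv.Perm.sign σ) with h | h <;> simp [h]
    rw [h1, norm_prod]
    exact Finset.prod_le_prod (fun _ _ => norm_nonneg _) fun i _ => h i (σ i)
  refine (Finset.sum_le_sum fun σ _ => this σ).trans ?_
  rw [Finset.sum_const, Finset.card_univ, Fintype.card_perm, Fintype.card_fin, nsmul_eq_mul]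

lemma det_telescope {m : ℕ} (A B : Matrix (Fin m) (Fin m) ℂ) :
    A.det - B.det = ∑ i, Matrix.det (Matrix.of fun j => if j < i then A j else if j = i then A j - B j else B j) := by
  have := (Matrix.detRowAlternating (n := Fin m) (R := ℂ)).toMultilinearMap.map_piecewise_sub_map_piecewise A B A Finset.univ
  have h1 : ∀ C : Matrix (Fin m) (Fin m) ℂ, Finset.univ.piecewise C A = C := fun C =>
    funext fun i => Finset.piecewise_eq_of_mem _ _ _ (Finset.mem_univ i)
  rw [h1, h1] at this
  simp only [Finset.mem_univ, if_true] at this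
  exact this

open MeasureTheory in
/-- integrated telescoping -/
lemma tele_bound {m : ℕ} (u v : Fin m → (Fin m → ℂ) → ℂ) (f : (Fin m → ℂ) → ℂ)
    (hu : ∀ j, ContDiff ℝ 2 (u j)) (hv : ∀ j, ContDiff ℝ 2 (v j)) (hf : ContDiff ℝ 1 f) (hc : HasCompactSupport f)
    (g : (Fin m → ℂ) → ℝ) (hg : Integrable g)
    (hb : ∀ i x, ‖(u i x - v i x) * Matrix.det (Matrix.of fun j l => if j < i then dbar l (u j) x else if j = i then dbar l f x else dbar l (v j) x)‖ ≤ g x) :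
    ‖(∫ x, f x * Matrix.det (Matrix.of fun j l => dbar l (u j) x)) - ∫ x, f x * Matrix.det (Matrix.of fun j l => dbar l (v j) x)‖ ≤ m * ∫ x, g x := by
  have cu : ∀ j l, Continuous (dbar l (u j)) := fun j l => (contDiff_dbar (k := 1) (n := 2) (hu j) (by norm_num)).continuous
  have cv : ∀ j l, Continuous (dbar l (v j)) := fun j l => (contDiff_dbar (k := 1) (n := 2) (hv j) (by norm_num)).continuous
  have cf : ∀ l, Continuous (dbar l f) := fun l => (contDiff_dbar (k := 0) (n := 1) hf (by norm_num)).continuous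
  have cdet : ∀ A : Matrix (Fin m) (Fin m) ((Fin m → ℂ) → ℂ), (∀ i j, Continuous (A i j)) → Continuous fun x => Matrix.det (Matrix.of fun j l => A j l x) := by
    intro A hA
    refine Continuous.matrix_det ?_
    exact continuous_matrix fun i j => hA i j
  have iu : Integrable fun x => f x * Matrix.det (Matrix.of fun j l => dbar l (u j) x) :=
    (hf.continuous.mul (cdet (fun j l => dbar l (u j)) cu)).integrable_of_hasCompactSupport hc.mul_right
  have iv : Integrable fun x => f x * Matrix.det (Matrix.of fun j l => dbar l (v j) x) :=
    (hf.continuous.mul (cdet (fun j l => dbar l (v j)) cv)).integrable_of_hasCompactSupport hc.mul_right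
  let W : Fin m → Fin m → (Fin m → ℂ) → ℂ := fun i j => if j < i then u j else if j = i then fun x => u j x - v j x else v j
  have hW : ∀ i j, ContDiff ℝ 2 (W i j) := by
    intro i j
    simp only [W]
    split_ifs
    · exact hu j
    · exact (hu j).sub (hv j)
    · exact hv j
  have cW : ∀ i j l, Continuous (dbar l (W i j)) := fun i j l => (contDiff_dbar (k := 1) (n := 2) (hW i j) (by norm_num)).continuous
  let V : Fin m → Fin m → (Fin m → ℂ) → ℂ := fun i j => if j < i then u j else if j = i then f else v j
  have cV : ∀ i j l, Continuous (dbar l (V i j)) := by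
    intro i j l
    simp only [V]
    split_ifs
    · exact cu j l
    · exact cf l
    · exact cv j l
  have e1 : ∀ x, f x * Matrix.det (Matrix.of fun j l => dbar l (u j) x) - f x * Matrix.det (Matrix.of fun j l => dbar l (v j) x) =
      ∑ i, f x * Matrix.det (Matrix.of fun j l => dbar l (W i j) x) := by
    intro x
    rw [← mul_sub, det_telescope, Finset.mul_sum]
    refine Finset.sum_congr rfl fun i _ => ?_
    congr 2
    ext j l
    simp only [W, Matrix.of_apply]
    split_ifs
    · rfl
    · rw [dbar_sub ((hu j).differentiable (by norm_num) x) ((hv j).differentiable (by norm_num) x)]; rfl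
    · rfl
  rw [← integral_sub iu iv]
  simp only [e1]
  have hcV : ∀ i, Continuous fun x => (u i x - v i x) * Matrix.det (Matrix.of fun j l => dbar l (V i j) x) := fun i =>
    ((hu i).continuous.sub (hv i).continuous).mul (cdet (fun j l => dbar l (V i j)) (cV i))
  have hVs : ∀ i, Integrable fun x => (u i x - v i x) * Matrix.det (Matrix.of fun j l => dbar l (V i j) x) := by
    intro i
    refine (hcV i).integrable_of_hasCompactSupport (HasCompactSupport.intro hc fun x hx => ?_)
    rw [Matrix.det_eq_zero_of_row_eq_zero i, mul_zero]
    intro l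
    simp [V, dbar_zero_of_notMem_tsupport hx]
  have iW : ∀ i, Integrable fun x => f x * Matrix.det (Matrix.of fun j l => dbar l (W i j) x) := fun i =>
    (hf.continuous.mul (cdet (fun j l => dbar l (W i j)) (cW i))).integrable_of_hasCompactSupport hc.mul_right
  have key : ∀ i, ∫ x, f x * Matrix.det (Matrix.of fun j l => dbar l (W i j) x) = - ∫ x, (u i x - v i x) * Matrix.det (Matrix.of fun j l => dbar l (V i j) x) := by
    intro i
    rw [eq_neg_iff_add_eq_zero, ← integral_add (iW i) (hVs i)]
    have hfu : ContDiff ℝ 1 (fun x => f x * (u i x - v i x)) := hf.mul (((hu i).sub (hv i)).of_le (by norm_num))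
    have := piola (fun j => Function.update (W i) i (fun x => f x * (u i x - v i x)) j) i
      (fun j hj => by simpa [Function.update_of_ne hj] using hW i j) (by simpa using hfu)
      (by rw [Function.update_self]; exact hc.mul_right)
    rw [← this]
    refine integral_congr_ae (Filter.Eventually.of_forall fun x => ?_)
    simp only
    have h1 : (Matrix.of fun j l => dbar l (W i j) x) = Matrix.updateRow (Matrix.of fun j l => dbar l (W i j) x) i (fun l => dbar l (W i i) x) := by
      ext j l
      by_cases h : j = i
      · subst h; simp
      · simp [Matrix.updateRow_ne h]
    have h2 : (Matrix.of fun j l => dbar l (V i j) x) = Matrix.updateRow (Matrix.of fun j l => dbar l (W i j) x) i (fun l => dbar l f x) := by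
      ext j l
      by_cases h : j = i
      · subst h; simp [V]
      · simp [Matrix.updateRow_ne h, V, W, h]
    rw [h1, h2, ← Matrix.det_updateRow_smul, ← Matrix.det_updateRow_smul, ← Matrix.det_updateRow_add]
    congr 1
    ext j l
    by_cases h : j = i
    · subst h
      simp only [Matrix.updateRow_self, Matrix.of_apply, Function.update_self, Pi.add_apply, Pi.smul_apply, smul_eq_mul]
      rw [dbar_mul (hf.differentiable (by norm_num) x) (((hu j).sub (hv j)).differentiable (by norm_num) x)]
      have : W j j = fun x => u j x - v j x := by simp [W]
      rw [this]; ring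
    · simp [Matrix.updateRow_ne h, Function.update_of_ne h]
  rw [integral_finsetSum _ (fun i _ => iW i)]
  simp only [key]
  refine (norm_sum_le _ _).trans ?_
  have : ∀ i : Fin m, ‖- ∫ x, (u i x - v i x) * Matrix.det (Matrix.of fun j l => dbar l (V i j) x)‖ ≤ ∫ x, g x := by
    intro i
    rw [norm_neg]
    refine norm_integral_le_of_norm_le hg (Filter.Eventually.of_forall fun x => ?_)
    refine le_trans (le_of_eq ?_) (hb i x)
    congr 3
    ext j l
    simp only [V, Matrix.of_apply]
    split_ifs <;> rfl
  refine (Finset.sum_le_sum fun i _ => this i).trans ?_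
  simp

lemma dbar_joint {m : ℕ} {F : (Fin m → ℂ) × (Fin m → ℂ) → ℂ} (hF : ContDiff ℝ 2 F) (l : Fin m) :
    Continuous (fun x : (Fin m → ℂ) × (Fin m → ℂ) => dbar l (fun ζ => F (ζ, x.2)) x.1) := by
  have h : ∀ x : (Fin m → ℂ) × (Fin m → ℂ), ∀ v, fderiv ℝ (fun ζ => F (ζ, x.2)) x.1 v = fderiv ℝ F x (v, 0) := by
    intro x v
    have h1 : HasFDerivAt F (fderiv ℝ F x) (x.1, x.2) := (hF.differentiable (by norm_num) x).hasFDerivAt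
    have h2 := HasFDerivAt.comp (g := F) (f := fun e => (e, x.2)) x.1 h1 (hasFDerivAt_prodMk_left (𝕜 := ℝ) x.1 x.2)
    have h3 : (F ∘ fun e => (e, x.2)) = fun ζ => F (ζ, x.2) := rfl
    rw [h3] at h2
    rw [h2.fderiv]; simp
  simp only [dbar, h]
  have := hF.continuous_fderiv (by norm_num)
  fun_prop

lemma dbar_lin {m : ℕ} (S : Fin m → (Fin m → ℂ) → ℂ) (a : (Fin m → ℂ) → ℂ) (z ζ : Fin m → ℂ) (l : Fin m)
    (hS : ∀ j, DifferentiableAt ℝ (S j) ζ) (ha : DifferentiableAt ℝ a ζ) :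
    dbar l (fun x => (∑ i, (x i - z i) * S i x) + a x) ζ = (∑ i, (ζ i - z i) * dbar l (S i) ζ) + dbar l a ζ := by
  have dx : ∀ i, DifferentiableAt ℂ (fun x : Fin m → ℂ => x i - z i) ζ := fun i => by fun_prop
  have dm : ∀ i, DifferentiableAt ℝ (fun x : Fin m → ℂ => (x i - z i) * S i x) ζ := fun i =>
    ((dx i).restrictScalars ℝ).mul (hS i)
  have dD0 : DifferentiableAt ℝ (fun x => (∑ i, (x i - z i) * S i x)) ζ := DifferentiableAt.fun_sum fun i _ => dm i
  rw [dbar_add dD0 ha, dbar_sum _ _ (fun i _ => dm i)]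
  congr 1
  refine Finset.sum_congr rfl fun i _ => ?_
  rw [dbar_mul ((dx i).restrictScalars ℝ) (hS i), dbar_holo (dx i)]; ring

namespace OWData
variable {m : ℕ} {T N₀ : Set (Fin m → ℂ)} (d : OWData T N₀)

noncomputable def N (j : Fin m) (x : (Fin m → ℂ) × (Fin m → ℂ)) : ℂ := (d.χ x.1 : ℂ) * d.Q j x
noncomputable def S (j : Fin m) (x : (Fin m → ℂ) × (Fin m → ℂ)) : ℂ :=
  (1 - d.χ x.1 : ℂ) * starRingEnd ℂ (x.1 j - x.2 j) + d.N j x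
noncomputable def D (ε : ℝ) (x : (Fin m → ℂ) × (Fin m → ℂ)) : ℂ := (∑ i, (x.1 i - x.2 i) * d.S i x) + (ε : ℂ)
noncomputable def E (ε : ℝ) (x : (Fin m → ℂ) × (Fin m → ℂ)) : ℂ := (∑ i, (x.1 i - x.2 i) * d.N i x) + ((1 - d.χ x.1 : ℂ) + ε)
noncomputable def u (ε : ℝ) (z : Fin m → ℂ) (j : Fin m) (ζ : Fin m → ℂ) : ℂ := d.S j (ζ, z) / d.D ε (ζ, z)
noncomputable def v (ε : ℝ) (z : Fin m → ℂ) (j : Fin m) (ζ : Fin m → ℂ) : ℂ := d.N j (ζ, z) / d.E ε (ζ, z)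

lemma cχ : ContDiff ℝ 2 (fun x : Fin m → ℂ => (d.χ x : ℂ)) := Complex.ofRealCLM.contDiff.comp d.χs

lemma cN (j : Fin m) : ContDiff ℝ 2 (d.N j) := (d.cχ.comp contDiff_fst).mul (d.Qs j)

lemma cS (j : Fin m) : ContDiff ℝ 2 (d.S j) := by
  have h1 : ContDiff ℝ 2 (fun x : (Fin m → ℂ) × (Fin m → ℂ) => starRingEnd ℂ (x.1 j - x.2 j)) :=
    Complex.conjCLE.contDiff.comp (by fun_prop)
  exact ((contDiff_const.sub (d.cχ.comp contDiff_fst)).mul h1).add (d.cN j)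

lemma cD (ε : ℝ) : ContDiff ℝ 2 (d.D ε) := by
  refine ContDiff.add (ContDiff.sum fun i _ => ContDiff.mul (by fun_prop) (d.cS i)) contDiff_const

lemma cE (ε : ℝ) : ContDiff ℝ 2 (d.E ε) := by
  refine ContDiff.add (ContDiff.sum fun i _ => ContDiff.mul (by fun_prop) (d.cN i)) ?_
  exact (contDiff_const.sub (d.cχ.comp contDiff_fst)).add contDiff_const

lemma sec {F : (Fin m → ℂ) × (Fin m → ℂ) → ℂ} (hF : ContDiff ℝ 2 F) (z : Fin m → ℂ) :
    ContDiff ℝ 2 (fun ζ => F (ζ, z)) := hF.comp (by fun_prop)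

variable {d}

lemma re_N {z : Fin m → ℂ} (hz : z ∈ T) (ζ : Fin m → ℂ) :
    d.χ ζ ≤ (∑ i, (ζ i - z i) * d.N i (ζ, z)).re := by
  have : (∑ i, (ζ i - z i) * d.N i (ζ, z)) = (d.χ ζ : ℂ) * ∑ i, (ζ i - z i) * d.Q i (ζ, z) := by
    rw [Finset.mul_sum]
    exact Finset.sum_congr rfl fun i _ => by simp only [N]; ring
  rw [this, Complex.re_ofReal_mul]
  by_cases h : d.χ ζ = 0
  · simp [h]
  · nlinarith [d.Qre z hz ζ h, d.χ0 ζ]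

lemma re_E {z : Fin m → ℂ} (hz : z ∈ T) (ζ : Fin m → ℂ) {ε : ℝ} (hε : 0 < ε) : 1 ≤ (d.E ε (ζ, z)).re := by
  have := d.re_N hz ζ
  simp only [E, Complex.add_re, Complex.sub_re, Complex.one_re, Complex.ofReal_re]
  linarith

lemma sumS (ζ z : Fin m → ℂ) : ∑ i, (ζ i - z i) * d.S i (ζ, z) =
    (((1 - d.χ ζ) * ∑ i, ‖ζ i - z i‖^2 : ℝ) : ℂ) + ∑ i, (ζ i - z i) * d.N i (ζ, z) := by
  push_cast
  rw [Finset.mul_sum, ← Finset.sum_add_distrib]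
  refine Finset.sum_congr rfl fun i _ => ?_
  have : ((‖ζ i - z i‖ : ℂ))^2 = (ζ i - z i) * starRingEnd ℂ (ζ i - z i) := by
    rw [Complex.mul_conj, Complex.normSq_eq_norm_sq]; push_cast; rfl
  rw [this]; simp only [S]; ring

lemma norm_sq_le_sum (x : Fin m → ℂ) : ‖x‖^2 ≤ ∑ i, ‖x i‖^2 := by
  have h0 : 0 ≤ ∑ i, ‖x i‖^2 := Finset.sum_nonneg fun i _ => by positivity
  have : ‖x‖ ≤ Real.sqrt (∑ i, ‖x i‖^2) := by
    rw [pi_norm_le_iff_of_nonneg (Real.sqrt_nonneg _)]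
    intro i
    apply Real.le_sqrt_of_sq_le
    exact Finset.single_le_sum (f := fun i => ‖x i‖^2) (fun i _ => by positivity) (Finset.mem_univ i)
  calc ‖x‖^2 ≤ Real.sqrt (∑ i, ‖x i‖^2) ^2 := by gcongr
    _ = _ := Real.sq_sqrt h0

lemma re_D {z : Fin m → ℂ} (hz : z ∈ T) (ζ : Fin m → ℂ) (ε : ℝ) :
    (1 - d.χ ζ) * ‖ζ - z‖^2 + d.χ ζ + ε ≤ (d.D ε (ζ, z)).re := by
  have h1 := d.re_N hz ζ
  have h2 : ‖ζ - z‖^2 ≤ ∑ i, ‖ζ i - z i‖^2 := norm_sq_le_sum (ζ - z)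
  have h3 := d.χ1 ζ
  simp only [D, sumS, Complex.add_re, Complex.ofReal_re]
  nlinarith

lemma re_D_pos {z : Fin m → ℂ} (hz : z ∈ T) (ζ : Fin m → ℂ) {ε : ℝ} : ε ≤ (d.D ε (ζ, z)).re := by
  have h1 := d.re_D hz ζ ε
  have h2 := d.χ0 ζ
  have h3 := d.χ1 ζ
  nlinarith [sq_nonneg ‖ζ - z‖]

lemma D_ne {z : Fin m → ℂ} (hz : z ∈ T) (ζ : Fin m → ℂ) {ε : ℝ} (hε : 0 < ε) : d.D ε (ζ, z) ≠ 0 := by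
  intro h
  have := d.re_D_pos hz ζ (ε := ε)
  rw [h] at this; simp at this; linarith

lemma E_ne {z : Fin m → ℂ} (hz : z ∈ T) (ζ : Fin m → ℂ) {ε : ℝ} (hε : 0 < ε) : d.E ε (ζ, z) ≠ 0 := by
  intro h
  have := d.re_E hz ζ hε
  rw [h] at this; simp at this; linarith

lemma norm_D_ge {z : Fin m → ℂ} (hz : z ∈ T) (ζ : Fin m → ℂ) {ε R : ℝ} (hε : 0 < ε) (hR : ‖ζ - z‖ ≤ R) :
    ‖ζ - z‖^2 / (1 + R^2) ≤ ‖d.D ε (ζ, z)‖ := by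
  refine le_trans ?_ (Complex.re_le_norm _)
  refine le_trans ?_ (d.re_D hz ζ ε)
  have h2 := d.χ0 ζ
  have h3 := d.χ1 ζ
  have h4 : ‖ζ - z‖^2 ≤ R^2 := by gcongr
  rw [div_le_iff₀ (by positivity)]
  nlinarith [sq_nonneg ‖ζ - z‖, mul_nonneg h2 (sub_nonneg.2 h4), mul_nonneg (sub_nonneg.2 h3) (mul_nonneg (sq_nonneg R) (sq_nonneg ‖ζ - z‖)), mul_nonneg h2 (sq_nonneg R)]

lemma cu {z : Fin m → ℂ} (hz : z ∈ T) {ε : ℝ} (hε : 0 < ε) (j : Fin m) : ContDiff ℝ 2 (d.u ε z j) := by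
  have : ContDiff ℝ 2 (fun ζ => d.S j (ζ, z) * (d.D ε (ζ, z))⁻¹) :=
    (sec (d.cS j) z).mul ((sec (d.cD ε) z).inv fun ζ => D_ne hz ζ hε)
  exact this

lemma cv {z : Fin m → ℂ} (hz : z ∈ T) {ε : ℝ} (hε : 0 < ε) (j : Fin m) : ContDiff ℝ 2 (d.v ε z j) := by
  have : ContDiff ℝ 2 (fun ζ => d.N j (ζ, z) * (d.E ε (ζ, z))⁻¹) :=
    (sec (d.cN j) z).mul ((sec (d.cE ε) z).inv fun ζ => E_ne hz ζ hε)
  exact this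

lemma dbar_D (ε : ℝ) (ζ z : Fin m → ℂ) (l : Fin m) :
    dbar l (fun x => d.D ε (x, z)) ζ = ∑ i, (ζ i - z i) * dbar l (fun x => d.S i (x, z)) ζ := by
  have := dbar_lin (fun i x => d.S i (x, z)) (fun _ => (ε : ℂ)) z ζ l
    (fun j => (sec (d.cS j) z).differentiable (by norm_num) ζ) (differentiableAt_const _)
  rw [dbar_const, add_zero] at this
  exact this

lemma dbar_E (ε : ℝ) (ζ z : Fin m → ℂ) (l : Fin m) :
    dbar l (fun x => d.E ε (x, z)) ζ = (∑ i, (ζ i - z i) * dbar l (fun x => d.N i (x, z)) ζ) - dbar l (fun x => (d.χ x : ℂ)) ζ := by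
  have hχ : DifferentiableAt ℝ (fun x => (d.χ x : ℂ)) ζ := d.cχ.differentiable (by norm_num) ζ
  have := dbar_lin (fun i x => d.N i (x, z)) (fun x => (1 - (d.χ x : ℂ)) + (ε : ℂ)) z ζ l
    (fun j => (sec (d.cN j) z).differentiable (by norm_num) ζ) (((differentiableAt_const _).sub hχ).add_const _)
  rw [dbar_add (f := fun x => 1 - (d.χ x:ℂ)) (g := fun _ => (ε:ℂ)) ((differentiableAt_const _).sub hχ) (differentiableAt_const _), dbar_sub (f := fun _ => (1:ℂ)) (differentiableAt_const _) hχ, dbar_const, dbar_const] at this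
  refine Eq.trans this (by ring)

lemma dbar_u {z : Fin m → ℂ} (hz : z ∈ T) {ε : ℝ} (hε : 0 < ε) (j l : Fin m) (ζ : Fin m → ℂ) :
    dbar l (d.u ε z j) ζ = dbar l (fun x => d.S j (x, z)) ζ / d.D ε (ζ, z) -
      d.S j (ζ, z) * (∑ i, (ζ i - z i) * dbar l (fun x => d.S i (x, z)) ζ) / (d.D ε (ζ, z))^2 := by
  rw [← dbar_D]
  exact dbar_div ((sec (d.cS j) z).differentiable (by norm_num) ζ) ((sec (d.cD ε) z).differentiable (by norm_num) ζ) (D_ne hz ζ hε)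

lemma dbar_v {z : Fin m → ℂ} (hz : z ∈ T) {ε : ℝ} (hε : 0 < ε) (j l : Fin m) (ζ : Fin m → ℂ) :
    dbar l (d.v ε z j) ζ = dbar l (fun x => d.N j (x, z)) ζ / d.E ε (ζ, z) -
      d.N j (ζ, z) * ((∑ i, (ζ i - z i) * dbar l (fun x => d.N i (x, z)) ζ) - dbar l (fun x => (d.χ x : ℂ)) ζ) / (d.E ε (ζ, z))^2 := by
  rw [← dbar_E]
  exact dbar_div ((sec (d.cN j) z).differentiable (by norm_num) ζ) ((sec (d.cE ε) z).differentiable (by norm_num) ζ) (E_ne hz ζ hε)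

lemma bdd_of_cont (hT : IsCompact T) {K : Set (Fin m → ℂ)} (hK : IsCompact K) {F : (Fin m → ℂ) × (Fin m → ℂ) → ℂ} (hF : Continuous F) :
    ∃ M : ℝ, 1 ≤ M ∧ ∀ ζ ∈ K, ∀ z ∈ T, ‖F (ζ, z)‖ ≤ M := by
  obtain ⟨M, hM⟩ := (hK.prod hT).exists_bound_of_continuousOn hF.continuousOn
  exact ⟨max M 1, le_max_right _ _, fun ζ hζ z hz => (hM (ζ, z) ⟨hζ, hz⟩).trans (le_max_left _ _)⟩

lemma bdd_fam {ι : Type*} [Fintype ι] (hT : IsCompact T) {K : Set (Fin m → ℂ)} (hK : IsCompact K) {F : ι → (Fin m → ℂ) × (Fin m → ℂ) → ℂ} (hF : ∀ i, Continuous (F i)) :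
    ∃ M : ℝ, 1 ≤ M ∧ ∀ i, ∀ ζ ∈ K, ∀ z ∈ T, ‖F i (ζ, z)‖ ≤ M := by
  choose M h1 h2 using fun i => bdd_of_cont hT hK (hF i)
  have h0 : ∀ i, 0 ≤ M i := fun i => by linarith [h1 i]
  have h3 : 0 ≤ ∑ i, M i := Finset.sum_nonneg fun i _ => h0 i
  refine ⟨1 + ∑ i, M i, by linarith, fun i ζ hζ z hz => (h2 i ζ hζ z hz).trans ?_⟩
  have := Finset.single_le_sum (f := M) (fun i _ => h0 i) (Finset.mem_univ i)
  linarith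

end OWData

namespace OWData
variable {m : ℕ} {T N₀ : Set (Fin m → ℂ)} {d : OWData T N₀}

lemma N_near {z : Fin m → ℂ} (hz : z ∈ T) {ζ : Fin m → ℂ} (h : ‖ζ - z‖ < d.r) (j : Fin m) : d.N j (ζ, z) = 0 := by
  simp [N, d.χnear z hz ζ h]

lemma uv_far {z ζ : Fin m → ℂ} (h : ζ ∉ N₀) (ε : ℝ) (j : Fin m) : d.u ε z j ζ = d.v ε z j ζ := by
  have h1 := d.χfar ζ h
  have h2 : ∀ j, d.S j (ζ, z) = d.N j (ζ, z) := fun j => by simp [S, h1]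
  simp [u, v, h2, D, E, h1]

lemma u_self {z : Fin m → ℂ} (hz : z ∈ T) (ε : ℝ) (j : Fin m) : d.u ε z j z = 0 := by
  have : d.N j (z, z) = 0 := N_near hz (by simpa using d.hr) j
  simp [u, S, this]

lemma v_self {z : Fin m → ℂ} (hz : z ∈ T) (ε : ℝ) (j : Fin m) : d.v ε z j z = 0 := by
  have : d.N j (z, z) = 0 := N_near hz (by simpa using d.hr) j
  simp [v, this]

variable (d) in
lemma bounds (hT : IsCompact T) {K : Set (Fin m → ℂ)} (hK : IsCompact K) :
    ∃ C : ℝ, 1 ≤ C ∧ ∀ ε : ℝ, 0 < ε → ∀ z ∈ T, ∀ ζ ∈ K,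
      (∀ j, ‖d.u ε z j ζ‖ * ‖ζ - z‖ ≤ C) ∧ (∀ j, ‖d.v ε z j ζ‖ * ‖ζ - z‖ ≤ C) ∧
      (∀ j l, ‖dbar l (d.u ε z j) ζ‖ * ‖ζ - z‖^2 ≤ C) ∧ (∀ j l, ‖dbar l (d.v ε z j) ζ‖ * ‖ζ - z‖^2 ≤ C) := by
  obtain ⟨M, hM1, hM⟩ := bdd_fam hT hK (fun j => (d.cN j).continuous)
  obtain ⟨M', hM'1, hM'⟩ := bdd_fam hT hK (fun jl : Fin m × Fin m => dbar_joint (d.cS jl.1) jl.2)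
  obtain ⟨M'', hM''1, hM''⟩ := bdd_fam hT hK (fun jl : Fin m × Fin m => dbar_joint (d.cN jl.1) jl.2)
  obtain ⟨L, hL1, hL⟩ := bdd_fam hT hK (fun l : Fin m => (dbar_joint (d.cχ.comp contDiff_fst) l))
  obtain ⟨R, hR1, hR⟩ := bdd_fam (ι := Fin m) hT hK (fun i => (show Continuous fun x : (Fin m → ℂ) × (Fin m → ℂ) => x.1 i - x.2 i by fun_prop))
  set M1 := 1 + M / d.r with hM1d
  have hr := d.hr
  have hM1p : 0 ≤ M1 := by positivity
  set B := 1 + R^2 with hB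
  set V := M'' + M * (m * R * M'' + L) with hV
  refine ⟨1 + M1 * B + M * R + (M' * B + M1 * m * M' * B^2) + V * R^2, ?_, ?_⟩
  · have : 0 ≤ V := by positivity
    have : 0 ≤ M1 * B + M * R + (M' * B + M1 * m * M' * B^2) + V * R^2 := by positivity
    linarith
  intro ε hε z hz ζ hζ
  have hV0 : 0 ≤ V := by positivity
  have t1 : 0 ≤ M1 * B := by positivity
  have t2 : 0 ≤ M * R := by positivity
  have t3 : 0 ≤ M' * B + M1 * m * M' * B^2 := by positivity
  have t4 : 0 ≤ V * R^2 := by positivity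
  set a := ‖ζ - z‖ with ha
  have ha0 : 0 ≤ a := norm_nonneg _
  have haR : a ≤ R := (pi_norm_le_iff_of_nonneg (by linarith)).2 fun i => hR i ζ hζ z hz
  have hx : ∀ i, ‖ζ i - z i‖ ≤ a := fun i => norm_le_pi_norm (ζ - z) i
  have hD : 0 < ‖d.D ε (ζ, z)‖ := norm_pos_iff.2 (D_ne hz ζ hε)
  have hDB : a^2 / ‖d.D ε (ζ, z)‖ ≤ B := by
    have := norm_D_ge (d := d) hz ζ hε haR
    rw [div_le_iff₀ (by positivity)] at this ⊢
    linarith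
  have hDB0 : 0 ≤ a^2 / ‖d.D ε (ζ, z)‖ := by positivity
  have hE : 1 ≤ ‖d.E ε (ζ, z)‖ := (re_E hz ζ hε).trans (Complex.re_le_norm _)
  have hS : ∀ j, ‖d.S j (ζ, z)‖ ≤ M1 * a := by
    intro j
    have h1 : ‖d.N j (ζ, z)‖ ≤ M / d.r * a := by
      by_cases h : a < d.r
      · rw [N_near hz h]; simp; positivity
      · calc _ ≤ M := hM j ζ hζ z hz
          _ = M / d.r * d.r := by field_simp
          _ ≤ _ := by gcongr; exact not_lt.1 h
    have h2 : ‖(1 - d.χ ζ : ℂ)‖ ≤ 1 := by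
      rw [← Complex.ofReal_one, ← Complex.ofReal_sub, Complex.norm_real, Real.norm_eq_abs, abs_le]
      constructor <;> linarith [d.χ0 ζ, d.χ1 ζ]
    calc _ ≤ ‖(1 - d.χ ζ : ℂ)‖ * ‖ζ j - z j‖ + ‖d.N j (ζ, z)‖ := by
          refine (norm_add_le _ _).trans ?_
          rw [norm_mul, RCLike.norm_conj]
      _ ≤ 1 * a + M / d.r * a := by gcongr; exact hx j
      _ = _ := by rw [hM1d]; ring
  refine ⟨fun j => ?_, fun j => ?_, fun j l => ?_, fun j l => ?_⟩
  · have : ‖d.u ε z j ζ‖ * a ≤ M1 * B := by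
      rw [u, norm_div]
      calc _ ≤ M1 * a / ‖d.D ε (ζ, z)‖ * a := by gcongr; exact hS j
        _ = M1 * (a^2 / ‖d.D ε (ζ, z)‖) := by ring
        _ ≤ _ := by gcongr
    linarith
  · have : ‖d.v ε z j ζ‖ * a ≤ M * R := by
      rw [v, norm_div]
      calc _ ≤ M / 1 * R := by gcongr; exact hM j ζ hζ z hz
        _ = _ := by ring
    linarith
  · have : ‖dbar l (d.u ε z j) ζ‖ * a^2 ≤ M' * B + M1 * m * M' * B^2 := by
      rw [dbar_u hz hε]
      have hs : ‖∑ i, (ζ i - z i) * dbar l (fun x => d.S i (x, z)) ζ‖ ≤ m * (a * M') := by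
        refine (norm_sum_le _ _).trans ((Finset.sum_le_card_nsmul _ _ (a * M') fun i _ => ?_).trans (by simp))
        rw [norm_mul]; gcongr
        · exact hx i
        · exact hM' (i, l) ζ hζ z hz
      calc _ ≤ (‖dbar l (fun x => d.S j (x, z)) ζ‖ / ‖d.D ε (ζ, z)‖ + ‖d.S j (ζ, z)‖ * ‖∑ i, (ζ i - z i) * dbar l (fun x => d.S i (x, z)) ζ‖ / ‖d.D ε (ζ, z)‖^2) * a^2 := by
            gcongr
            refine (norm_sub_le _ _).trans ?_
            rw [norm_div, norm_div, norm_mul, norm_pow]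
        _ ≤ (M' / ‖d.D ε (ζ, z)‖ + (M1 * a) * (m * (a * M')) / ‖d.D ε (ζ, z)‖^2) * a^2 := by
            gcongr
            · exact hM' (j, l) ζ hζ z hz
            · exact hS j
        _ = M' * (a^2 / ‖d.D ε (ζ, z)‖) + M1 * m * M' * (a^2 / ‖d.D ε (ζ, z)‖)^2 := by field_simp
        _ ≤ _ := by gcongr
    linarith
  · have : ‖dbar l (d.v ε z j) ζ‖ * a^2 ≤ V * R^2 := by
      rw [dbar_v hz hε]
      have hs : ‖(∑ i, (ζ i - z i) * dbar l (fun x => d.N i (x, z)) ζ) - dbar l (fun x => (d.χ x : ℂ)) ζ‖ ≤ m * (R * M'') + L := by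
        refine (norm_sub_le _ _).trans (add_le_add ?_ (hL l ζ hζ z hz))
        refine (norm_sum_le _ _).trans ((Finset.sum_le_card_nsmul _ _ (R * M'') fun i _ => ?_).trans (by simp))
        rw [norm_mul]; gcongr
        · exact (hx i).trans haR
        · exact hM'' (i, l) ζ hζ z hz
      gcongr
      calc _ ≤ (‖dbar l (fun x => d.N j (x, z)) ζ‖ / ‖d.E ε (ζ, z)‖ + ‖d.N j (ζ, z)‖ * ‖(∑ i, (ζ i - z i) * dbar l (fun x => d.N i (x, z)) ζ) - dbar l (fun x => (d.χ x : ℂ)) ζ‖ / ‖d.E ε (ζ, z)‖^2) := by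
            refine (norm_sub_le _ _).trans ?_
            rw [norm_div, norm_div, norm_mul, norm_pow]
        _ ≤ (M'' / 1 + M * (m * (R * M'') + L) / 1^2) := by
            gcongr
            · exact hM'' (j, l) ζ hζ z hz
            · exact hM j ζ hζ z hz
        _ = _ := by rw [hV]; ring
    linarith

end OWData

lemma finrank_cn (m : ℕ) : Module.finrank ℝ (Fin m → ℂ) = 2 * m := by
  rw [Module.finrank_pi_fintype]; simp [Complex.finrank_real_complex]; ring

open MeasureTheory in
lemma integrable_ker {m : ℕ} (hm : 1 ≤ m) (R : ℝ) :
    IntegrableOn (fun x : Fin m → ℂ => (‖x‖^(2*m-1))⁻¹) (ball 0 R) := by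
  have : NeZero m := ⟨by omega⟩
  have : Nontrivial (Fin m → ℂ) := inferInstance
  rw [integrableOn_fun_norm_addHaar (μ := volume) (f := fun y => (y^(2*m-1))⁻¹), finrank_cn]
  have : IntegrableOn (fun _ : ℝ => (1:ℝ)) (Set.Ioo 0 R) := by simp
  refine this.congr_fun (fun y hy => ?_) measurableSet_Ioo
  have : y ≠ 0 := hy.1.ne'
  simp [this]

namespace OWData
variable {m : ℕ} {T N₀ : Set (Fin m → ℂ)} {d : OWData T N₀}

open MeasureTheory in
variable (d) in
lemma tele (hT : IsCompact T) (hm : 1 ≤ m) (hN : Bornology.IsBounded N₀) :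
    ∃ C : ℝ, 0 ≤ C ∧ ∀ f : (Fin m → ℂ) → ℂ, ContDiff ℝ 1 f → HasCompactSupport f → ∀ b : ℝ, 0 ≤ b →
      (∀ ζ ∈ N₀, ∀ l, ‖dbar l f ζ‖ ≤ b) → ∀ ε : ℝ, 0 < ε → ∀ z ∈ T,
      ‖(∫ x, f x * Matrix.det (Matrix.of fun j l => dbar l (d.u ε z j) x)) - ∫ x, f x * Matrix.det (Matrix.of fun j l => dbar l (d.v ε z j) x)‖ ≤ C * b := by
  obtain ⟨C, hC1, hC⟩ := d.bounds hT (K := closure N₀) hN.isCompact_closure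
  obtain ⟨R₁, hR₁⟩ := hN.subset_ball 0
  obtain ⟨R₂, hR₂⟩ := hT.isBounded.subset_ball 0
  set R := R₁ + R₂ with hR
  set k : (Fin m → ℂ) → ℝ := (ball 0 R).indicator (fun x => (‖x‖^(2*m-1))⁻¹) with hk
  have hki : Integrable k := (integrable_indicator_iff measurableSet_ball).2 (integrable_ker hm R)
  have hk0 : ∀ x, 0 ≤ k x := fun x => Set.indicator_nonneg (fun x _ => by positivity) x
  set c : ℝ := 2 * C * (m.factorial * C^(m-1)) with hc
  have hc0 : 0 ≤ c := by positivity
  refine ⟨m * (c * ∫ x, k x), mul_nonneg (Nat.cast_nonneg m) (mul_nonneg hc0 (integral_nonneg (f := k) hk0)), ?_⟩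
  intro f hf hfc b hb hfb ε hε z hz
  have h := tele_bound (d.u ε z) (d.v ε z) f (cu hz hε) (cv hz hε) hf hfc (fun x => c * b * k (x - z)) ((hki.comp_sub_right z).const_mul _) ?_
  · refine h.trans (le_of_eq ?_)
    rw [integral_const_mul, integral_sub_right_eq_self k z]; ring
  intro i x
  by_cases hx : x ∈ N₀
  swap
  · rw [uv_far hx]; simp; have := hk0 (x - z); positivity
  by_cases hxz : x = z
  · subst hxz
    rw [u_self hz, v_self hz]; simp; have := hk0 0; positivity
  have ha : 0 < ‖x - z‖ := norm_pos_iff.2 (sub_ne_zero.2 hxz)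
  obtain ⟨h1, h2, h3, h4⟩ := hC ε hε z hz x (subset_closure hx)
  have hkx : k (x - z) = (‖x - z‖^(2*m-1))⁻¹ := by
    rw [hk, Set.indicator_of_mem]
    have e1 := mem_ball_zero_iff.1 (hR₁ hx)
    have e2 := mem_ball_zero_iff.1 (hR₂ hz)
    rw [mem_ball_zero_iff]
    linarith [norm_sub_le x z]
  have hu : ‖d.u ε z i x - d.v ε z i x‖ ≤ 2 * C / ‖x - z‖ := by
    refine (norm_sub_le _ _).trans ?_
    rw [le_div_iff₀ ha]; nlinarith [h1 i, h2 i]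
  have hdet := det_le_rows (Matrix.of fun j l => if j < i then dbar l (d.u ε z j) x else if j = i then dbar l f x else dbar l (d.v ε z j) x)
    (fun j => if j = i then b else C / ‖x - z‖^2) (by
      intro j l
      rw [Matrix.of_apply]
      by_cases hji : j = i
      · subst hji; simp [hfb x hx]
      · rw [if_neg hji, if_neg hji, le_div_iff₀ (by positivity)]
        split_ifs
        · exact h3 j l
        · exact h4 j l)
  have hprod : ∏ j, (if j = i then b else C / ‖x - z‖^2) = b * (C / ‖x - z‖^2)^(m-1) := by
    rw [Finset.prod_eq_mul_prod_sdiff_singleton_of_mem (Finset.mem_univ i), if_pos rfl]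
    congr 1
    rw [Finset.prod_congr rfl (g := fun _ => C / ‖x - z‖^2), Finset.prod_const, Finset.card_sdiff]
    · simp
    · intro j hj; simp at hj; simp [hj]
  rw [hprod] at hdet
  rw [norm_mul]
  calc _ ≤ (2 * C / ‖x - z‖) * (m.factorial * (b * (C / ‖x - z‖^2)^(m-1))) := by gcongr
    _ = c * b * k (x - z) := by
      rw [hkx, hc]
      have : ‖x - z‖^(2*m-1) = ‖x - z‖ * (‖x - z‖^2)^(m-1) := by
        rw [← pow_mul, ← pow_succ']; congr 1; omega
      rw [this, div_pow]; field_simp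

open MeasureTheory in
lemma v_mem [CompactSpace T] {ε : ℝ} (hε : 0 < ε) {f : (Fin m → ℂ) → ℂ} (hf : Continuous f) (hfc : HasCompactSupport f) :
    ∃ k ∈ PT T, ∀ z : T, k z = ∫ x, f x * Matrix.det (Matrix.of fun j l => dbar l (d.v ε z.1 j) x) := by
  set W : Fin m → Fin m → (Fin m → ℂ) × T → ℂ := fun j l y => dbar l (fun x => d.N j (x, y.2.1)) y.1 * (d.E ε (y.1, y.2.1))⁻¹ -
      d.N j (y.1, y.2.1) * ((∑ i, (y.1 i - y.2.1 i) * dbar l (fun x => d.N i (x, y.2.1)) y.1) - dbar l (fun x => (d.χ x : ℂ)) y.1) * ((d.E ε (y.1, y.2.1))⁻¹)^2 with hW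
  have hvW : ∀ (ζ : Fin m → ℂ) (z : T), (Matrix.of fun j l => dbar l (d.v ε z.1 j) ζ) = Matrix.of fun j l => W j l (ζ, z) := by
    intro ζ z; ext j l
    simp only [Matrix.of_apply, hW]; rw [dbar_v z.2 hε]; field_simp
  have ι : Continuous (fun y : (Fin m → ℂ) × T => (y.1, y.2.1)) := by fun_prop
  have cx : ∀ i, Continuous (fun y : (Fin m → ℂ) × T => y.1 i - y.2.1 i) := fun i =>
    ((continuous_apply i).comp continuous_fst).sub ((continuous_apply i).comp (continuous_subtype_val.comp continuous_snd))
  have cN : ∀ j, Continuous (fun y : (Fin m → ℂ) × T => d.N j (y.1, y.2.1)) := fun j => (d.cN j).continuous.comp ι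
  have cdN : ∀ j l, Continuous (fun y : (Fin m → ℂ) × T => dbar l (fun x => d.N j (x, y.2.1)) y.1) := fun j l => (dbar_joint (d.cN j) l).comp ι
  have cχ : ∀ l, Continuous (fun y : (Fin m → ℂ) × T => dbar l (fun x => (d.χ x : ℂ)) y.1) := fun l =>
    (contDiff_dbar (k := 1) (n := 2) d.cχ (by norm_num)).continuous.comp continuous_fst
  have cE : Continuous (fun y : (Fin m → ℂ) × T => (d.E ε (y.1, y.2.1))⁻¹) := ((d.cE ε).continuous.comp ι).inv₀ fun y => E_ne y.2.2 _ hε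
  have cW : ∀ j l, Continuous (W j l) := by
    intro j l
    have h1 := cN j
    have h2 := cdN
    have h3 := cχ l
    refine ((cdN j l).mul cE).sub (((cN j).mul (Continuous.sub (continuous_finsetSum _ fun i _ => Continuous.mul (cx i) (cdN i l)) h3)).mul (cE.pow 2))
  have key := integral_mem_closed (PT T) (PT_isClosed T) (fun y => f y.1 * Matrix.det (Matrix.of fun j l => W j l y))
    ((hf.comp continuous_fst).mul (Continuous.matrix_det (continuous_matrix fun j l => cW j l))) (tsupport f) hfc
    (fun ζ hζ x => by simp [image_eq_zero_of_notMem_tsupport hζ]) ?_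
  · obtain ⟨k, hk, h⟩ := key
    refine ⟨k, hk, fun z => ?_⟩
    rw [h]; simp only [hvW]
  intro ζ g hg
  -- the section functions
  let sc : ((Fin m → ℂ) × T → ℂ) → Prop := fun F => ∃ g ∈ PT T, ∀ z, g z = F (ζ, z)
  have mN : ∀ j, ∃ g ∈ PT T, ∀ z : T, g z = d.N j (ζ, z.1) := by
    intro j
    obtain ⟨p, hp⟩ := d.Qp ζ j
    refine ⟨⟨fun z => d.N j (ζ, z.1), (cN j).comp (g := fun y : (Fin m → ℂ) × T => d.N j (y.1, y.2.1)) (f := fun z => (ζ, z)) (by fun_prop)⟩, poly_mem_PT (MvPolynomial.C (d.χ ζ : ℂ) * p) _ ?_, fun z => rfl⟩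
    intro z; simp [N, hp]
  have mdN : ∀ j l, ∃ g ∈ PT T, ∀ z : T, g z = dbar l (fun x => d.N j (x, z.1)) ζ := by
    intro j l
    obtain ⟨p, hp⟩ := d.Qp ζ j
    obtain ⟨q, hq⟩ := d.Qd ζ j l
    refine ⟨⟨fun z => dbar l (fun x => d.N j (x, z.1)) ζ, (cdN j l).comp (g := fun y : (Fin m → ℂ) × T => dbar l (fun x => d.N j (x, y.2.1)) y.1) (f := fun z => (ζ, z)) (by fun_prop)⟩,
      poly_mem_PT (MvPolynomial.C (dbar l (fun x => (d.χ x : ℂ)) ζ) * p + MvPolynomial.C (d.χ ζ : ℂ) * q) _ ?_, fun z => rfl⟩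
    intro z
    have : dbar l (fun x => d.N j (x, z.1)) ζ = _ := dbar_mul (d.cχ.differentiable (by norm_num) ζ) ((sec (d.Qs j) z.1).differentiable (by norm_num) ζ)
    simp [this, hp, hq]
  choose gN hgN hgN' using mN
  choose gdN hgdN hgdN' using mdN
  have hc : ∀ i, coordC T i ∈ PT T := fun i => poly_mem_PT (MvPolynomial.X i) _ fun z => by simp [coordC]
  have hcst : ∀ c : ℂ, algebraMap ℂ C(T, ℂ) c ∈ PT T := fun c => (PT T).algebraMap_mem c
  set gE : C(T, ℂ) := (∑ i, (algebraMap ℂ C(T, ℂ) (ζ i) - coordC T i) * gN i) + algebraMap ℂ C(T, ℂ) (1 - d.χ ζ + ε) with hgE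
  have hgE1 : gE ∈ PT T := (PT T).add_mem (sum_mem fun i _ => (PT T).mul_mem ((PT T).sub_mem (hcst _) (hc i)) (hgN i)) (hcst _)
  have hgE2 : ∀ z, gE z = d.E ε (ζ, z.1) := by
    intro z
    simp [hgE, E, hgN', coordC]
  let gI : C(T, ℂ) := ⟨fun z => (d.E ε (ζ, z.1))⁻¹, cE.comp (g := fun y : (Fin m → ℂ) × T => (d.E ε (y.1, y.2.1))⁻¹) (f := fun z => (ζ, z)) (by fun_prop)⟩
  have hgI : gI ∈ PT T := inv_mem_of_re (PT T) (PT_isClosed T) gE gI hgE1 one_pos (fun z => by rw [hgE2]; exact re_E z.2 ζ hε)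
    (fun z => by rw [hgE2]; exact mul_inv_cancel₀ (E_ne z.2 ζ hε))
  let M : Matrix (Fin m) (Fin m) C(T, ℂ) := Matrix.of fun j l => gdN j l * gI - gN j * ((∑ i, (algebraMap ℂ C(T, ℂ) (ζ i) - coordC T i) * gdN i l) - algebraMap ℂ C(T, ℂ) (dbar l (fun x => (d.χ x : ℂ)) ζ)) * gI^2
  have hM : ∀ j l, M j l ∈ PT T := fun j l => (PT T).sub_mem ((PT T).mul_mem (hgdN j l) hgI)
    ((PT T).mul_mem ((PT T).mul_mem (hgN j) ((PT T).sub_mem (sum_mem fun i _ => (PT T).mul_mem ((PT T).sub_mem (hcst _) (hc i)) (hgdN i l)) (hcst _))) ((PT T).pow_mem hgI 2))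
  have hdet : M.det ∈ PT T := by
    rw [Matrix.det_apply]
    refine sum_mem fun σ _ => ?_
    rw [Units.smul_def]
    exact zsmul_mem (prod_mem fun i _ => hM _ _) _
  have hMz : ∀ z j l, M j l z = W j l (ζ, z) := by
    intro z j l
    simp [M, W, hgN', hgdN', coordC, gI]
  have : g = algebraMap ℂ C(T, ℂ) (f ζ) * M.det := by
    ext z
    rw [hg, ContinuousMap.mul_apply, Matrix.det_apply, Matrix.det_apply]
    simp [Units.smul_def, ContinuousMap.sum_apply, ContinuousMap.prod_apply, hMz]
  rw [this]
  exact (PT T).mul_mem (hcst _) hdet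

end OWData

section
noncomputable def kap (m : ℕ) (ε : ℝ) (x : Fin m → ℂ) : ℝ := ε / ((∑ i, ‖x i‖^2) + ε)^(m+1)

lemma kap_den {m : ℕ} {ε : ℝ} (hε : 0 < ε) (x : Fin m → ℂ) : 0 < (∑ i, ‖x i‖^2) + ε := by
  have : 0 ≤ ∑ i, ‖x i‖^2 := Finset.sum_nonneg fun i _ => by positivity
  linarith

lemma kap_cont {m : ℕ} {ε : ℝ} (hε : 0 < ε) : Continuous (kap m ε) := by
  unfold kap
  refine Continuous.div (by fun_prop) (by fun_prop) fun x => ?_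
  have := kap_den hε x
  positivity

lemma kap_nonneg {m : ℕ} {ε : ℝ} (hε : 0 < ε) (x : Fin m → ℂ) : 0 ≤ kap m ε x := by
  have := kap_den hε x
  unfold kap; positivity

open MeasureTheory

noncomputable def kc0 (m : ℕ) : ℝ := ((m+1:ℝ)^(m+1))⁻¹ * volume.real (ball (0 : Fin m → ℂ) 1)

lemma kc0_pos (m : ℕ) : 0 < kc0 m := by
  have : 0 < volume.real (ball (0 : Fin m → ℂ) 1) := by
    rw [measureReal_def]
    exact ENNReal.toReal_pos (measure_ball_pos _ _ one_pos).ne' measure_ball_lt_top.ne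
  unfold kc0; positivity

lemma kap_int {m : ℕ} {ε : ℝ} (hε : 0 < ε) (z : Fin m → ℂ) (δ : ℝ) : IntegrableOn (kap m ε) (ball z δ) :=
  ((kap_cont hε).continuousOn.integrableOn_compact (isCompact_closedBall z δ)).mono_set ball_subset_closedBall

lemma kap_lower {m : ℕ} {ε δ : ℝ} (hε : 0 < ε) (hδ : 0 < δ) (h : ε ≤ δ^2) : kc0 m ≤ ∫ x in ball (0 : Fin m → ℂ) δ, kap m ε x := by
  have hs : 0 < Real.sqrt ε := Real.sqrt_pos.2 hε
  have hsδ : Real.sqrt ε ≤ δ := Real.sqrt_le_iff.2 ⟨hδ.le, h⟩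
  have h1 : ∫ x in ball (0 : Fin m → ℂ) (Real.sqrt ε), kap m ε x ≤ ∫ x in ball (0 : Fin m → ℂ) δ, kap m ε x :=
    setIntegral_mono_set (kap_int hε 0 δ) (Filter.Eventually.of_forall fun x => kap_nonneg hε x) (Filter.Eventually.of_forall (ball_subset_ball hsδ))
  refine le_trans ?_ h1
  have h2 : ∀ x ∈ ball (0 : Fin m → ℂ) (Real.sqrt ε), ((m+1:ℝ)^(m+1))⁻¹ * (ε^m)⁻¹ ≤ kap m ε x := by
    intro x hx
    have hx' : ‖x‖ < Real.sqrt ε := by simpa using hx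
    have h3 : ∑ i, ‖x i‖^2 ≤ m * ε := by
      refine (Finset.sum_le_card_nsmul _ _ ε fun i _ => ?_).trans (by simp)
      calc ‖x i‖^2 ≤ (Real.sqrt ε)^2 := by gcongr; exact (norm_le_pi_norm x i).trans hx'.le
        _ = ε := Real.sq_sqrt hε.le
    have h4 := kap_den hε x
    unfold kap
    rw [le_div_iff₀ (by positivity)]
    calc _ ≤ ((m+1:ℝ)^(m+1))⁻¹ * (ε^m)⁻¹ * (m * ε + ε)^(m+1) := by gcongr
      _ = ((m+1:ℝ)^(m+1))⁻¹ * (ε^m)⁻¹ * ((m+1)^(m+1) * (ε^m * ε)) := by rw [← pow_succ, ← mul_pow]; ring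
      _ = ε := by field_simp
  have h3 := setIntegral_mono_on (f := fun _ => ((m+1:ℝ)^(m+1))⁻¹ * (ε^m)⁻¹) (integrableOn_const measure_ball_lt_top.ne) (kap_int hε 0 (Real.sqrt ε)) measurableSet_ball h2
  refine le_trans (le_of_eq ?_) h3
  rw [setIntegral_const, measureReal_def, Measure.addHaar_ball_of_pos _ _ hs, finrank_cn, pow_mul, Real.sq_sqrt hε.le, ENNReal.toReal_mul, ENNReal.toReal_ofReal (by positivity)]
  simp only [kc0, smul_eq_mul, measureReal_def]
  field_simp

namespace OWData
variable {m : ℕ} {T N₀ : Set (Fin m → ℂ)} {d : OWData T N₀}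

lemma det_u {z : Fin m → ℂ} (hz : z ∈ T) {ε : ℝ} (hε : 0 < ε) (ζ : Fin m → ℂ) :
    Matrix.det (Matrix.of fun j l => dbar l (d.u ε z j) ζ) = ε * Matrix.det (Matrix.of fun j l => dbar l (fun x => d.S j (x, z)) ζ) / (d.D ε (ζ, z))^(m+1) :=
  det_quot (fun j x => d.S j (x, z)) z ζ ε (fun j => (sec (d.cS j) z).differentiable (by norm_num) ζ) (D_ne hz ζ hε)

lemma dbar_conj (l j : Fin m) (c : ℂ) (ζ : Fin m → ℂ) : dbar l (fun x : Fin m → ℂ => starRingEnd ℂ (x j - c)) ζ = if j = l then 1 else 0 := by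
  let L : (Fin m → ℂ) →L[ℝ] ℂ := (Complex.conjCLE : ℂ →L[ℝ] ℂ).comp (ContinuousLinearMap.proj j)
  have : HasFDerivAt (fun x : Fin m → ℂ => starRingEnd ℂ (x j - c)) L ζ := by
    have h := (L.hasFDerivAt (x := ζ)).sub_const (starRingEnd ℂ c)
    refine h.congr_of_eventuallyEq (Filter.Eventually.of_forall fun x => ?_)
    simp [L]
  rw [dbar, this.fderiv]
  by_cases h : j = l
  · subst h; simp [L]; norm_num
  · simp [L, h]

lemma det_near {z : Fin m → ℂ} (hz : z ∈ T) {ε : ℝ} (hε : 0 < ε) {ζ : Fin m → ℂ} (h : ‖ζ - z‖ < d.r) :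
    Matrix.det (Matrix.of fun j l => dbar l (d.u ε z j) ζ) = (kap m ε (ζ - z) : ℂ) := by
  rw [det_u hz hε]
  have hS : ∀ j l, dbar l (fun x => d.S j (x, z)) ζ = if j = l then 1 else 0 := by
    intro j l
    rw [← dbar_conj l j (z j) ζ]
    apply dbar_congr
    have : {x : Fin m → ℂ | ‖x - z‖ < d.r} ∈ nhds ζ := (isOpen_lt (by fun_prop) continuous_const).mem_nhds h
    filter_upwards [this] with x hx
    simp [S, N_near hz hx, d.χnear z hz x hx]
  have hm : (Matrix.of fun j l => dbar l (fun x => d.S j (x, z)) ζ) = 1 := by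
    ext j l; simp [hS, Matrix.one_apply]
  have hD : d.D ε (ζ, z) = (((∑ i, ‖ζ i - z i‖^2) + ε : ℝ) : ℂ) := by
    rw [D, sumS]; simp [N_near hz h, d.χnear z hz ζ h]
  rw [hm, hD, kap]; simp

open MeasureTheory in
variable (d) in
lemma repro (hT : IsCompact T) {f : (Fin m → ℂ) → ℂ} (hf : Continuous f) (hfc : HasCompactSupport f) {η : ℝ} (hη : 0 < η) :
    ∃ ε > 0, ∃ c : ℝ, kc0 m ≤ c ∧ ∀ z ∈ T, ‖(∫ x, f x * Matrix.det (Matrix.of fun j l => dbar l (d.u ε z j) x)) - c * f z‖ ≤ η * c := by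
  have huc := hf.uniformContinuous_of_tendsto_cocompact hfc.is_zero_at_infty
  obtain ⟨δ₀, hδ₀, hδf⟩ := Metric.uniformContinuous_iff.1 huc (η/2) (by positivity)
  set δ := min δ₀ d.r with hδd
  have hδ : 0 < δ := lt_min hδ₀ d.hr
  obtain ⟨M', hM'1, hM'⟩ := bdd_fam hT hfc (fun jl : Fin m × Fin m => dbar_joint (d.cS jl.1) jl.2)
  obtain ⟨R, hR1, hR⟩ := bdd_fam (ι := Fin m) hT hfc (fun i => (show Continuous fun x : (Fin m → ℂ) × (Fin m → ℂ) => x.1 i - x.2 i by fun_prop))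
  obtain ⟨F0, hF0⟩ := hfc.exists_bound_of_continuous hf
  have hF00 : 0 ≤ F0 := (norm_nonneg _).trans (hF0 0)
  set Q : ℝ := F0 * (m.factorial * M'^m) / (δ^2/(1+R^2))^(m+1) with hQ
  have hQ0 : 0 ≤ Q := by positivity
  set V : ℝ := volume.real (tsupport f) with hV
  have hV0 : 0 ≤ V := measureReal_nonneg
  have hk := kc0_pos m
  set ε := min (δ^2) (η * kc0 m / (2 * (Q * V + 1))) with hεd
  have hε : 0 < ε := lt_min (by positivity) (by positivity)
  set c := ∫ x in ball (0 : Fin m → ℂ) δ, kap m ε x with hc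
  have hcl : kc0 m ≤ c := kap_lower hε hδ (min_le_left _ _)
  refine ⟨ε, hε, c, hcl, fun z hz => ?_⟩
  set P : (Fin m → ℂ) → ℂ := fun x => Matrix.det (Matrix.of fun j l => dbar l (d.u ε z j) x) with hP
  have hPc : Continuous P := Continuous.matrix_det (continuous_matrix fun j l =>
    (contDiff_dbar (k := 1) (n := 2) (cu hz hε j) (by norm_num)).continuous)
  have hfP : Integrable (fun x => f x * P x) := (hf.mul hPc).integrable_of_hasCompactSupport hfc.mul_right
  have hsplit := integral_add_compl (measurableSet_ball (x := z) (ε := δ)) hfP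
  have hkz : ∀ g : (Fin m → ℂ) → ℝ, ∫ x in ball z δ, g (x - z) = ∫ x in ball (0 : Fin m → ℂ) δ, g x := by
    intro g
    rw [← integral_indicator measurableSet_ball, ← integral_indicator measurableSet_ball, ← integral_sub_right_eq_self ((ball 0 δ).indicator g) z]
    congr 1; ext x
    simp only [Set.indicator, mem_ball, dist_eq_norm, sub_zero]
  have hkint : IntegrableOn (fun x => kap m ε (x - z)) (ball z δ) :=
    (((kap_cont hε).comp (continuous_id.sub continuous_const)).continuousOn.integrableOn_compact (isCompact_closedBall z δ)).mono_set ball_subset_closedBall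
  have hkintC : IntegrableOn (fun x => (kap m ε (x - z) : ℂ)) (ball z δ) := hkint.ofReal
  have hcz : (c : ℂ) * f z = ∫ x in ball z δ, f z * (kap m ε (x - z) : ℂ) := by
    rw [integral_const_mul, integral_complex_ofReal, hkz]; ring
  have h1 : ‖(∫ x in ball z δ, f x * P x) - c * f z‖ ≤ η/2 * c := by
    rw [hcz, ← integral_sub hfP.integrableOn (hkintC.const_mul _)]
    have hb : ∀ x ∈ ball z δ, ‖f x * P x - f z * (kap m ε (x - z) : ℂ)‖ ≤ η/2 * kap m ε (x - z) := by
      intro x hx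
      rw [mem_ball] at hx
      have hxr : ‖x - z‖ < d.r := by rw [← dist_eq_norm]; exact hx.trans_le (min_le_right _ _)
      rw [hP]; dsimp only
      rw [det_near hz hε hxr, ← sub_mul, norm_mul, Complex.norm_real, Real.norm_eq_abs, abs_of_nonneg (kap_nonneg hε _)]
      have := hδf (hx.trans_le (min_le_left _ _))
      rw [dist_eq_norm] at this
      have := kap_nonneg (m := m) hε (x - z)
      gcongr
    refine (norm_integral_le_integral_norm _).trans ?_
    rw [hc, ← hkz, ← integral_const_mul]
    refine setIntegral_mono_on ?_ (hkint.const_mul _) measurableSet_ball hb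
    exact (hfP.integrableOn.sub (hkintC.const_mul _)).norm
  have h2 : ‖∫ x in (ball z δ)ᶜ, f x * P x‖ ≤ ε * Q * V := by
    have hb : ∀ x, ‖(ball z δ)ᶜ.indicator (fun x => f x * P x) x‖ ≤ (tsupport f).indicator (fun _ => ε * Q) x := by
      intro x
      by_cases hx : x ∈ tsupport f
      swap
      · rw [Set.indicator_of_notMem hx, norm_indicator_eq_indicator_norm]
        simp [Set.indicator, image_eq_zero_of_notMem_tsupport hx]
      rw [Set.indicator_of_mem hx]
      by_cases hxb : x ∈ (ball z δ)ᶜ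
      swap
      · rw [Set.indicator_of_notMem hxb]; simp; positivity
      rw [Set.indicator_of_mem hxb]
      have hxd : δ ≤ ‖x - z‖ := by simpa [dist_eq_norm] using hxb
      have hxR : ‖x - z‖ ≤ R := (pi_norm_le_iff_of_nonneg (by linarith)).2 fun i => hR i x hx z hz
      have hD := norm_D_ge (d := d) hz x hε hxR
      have hD' : δ^2/(1+R^2) ≤ ‖d.D ε (x, z)‖ := le_trans (by gcongr) hD
      have hdet := det_le_rows (Matrix.of fun j l => dbar l (fun x => d.S j (x, z)) x) (fun _ => M') (fun j l => hM' (j, l) x hx z hz)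
      rw [hP]; dsimp only
      rw [det_u hz hε, norm_mul, norm_div, norm_mul, norm_pow, Complex.norm_real, Real.norm_eq_abs, abs_of_pos hε]
      simp only [Finset.prod_const, Finset.card_univ, Fintype.card_fin] at hdet
      calc _ ≤ F0 * (ε * (m.factorial * M'^m) / (δ^2/(1+R^2))^(m+1)) := by
            gcongr; exact hF0 x
        _ = _ := by rw [hQ]; ring
    rw [← integral_indicator measurableSet_ball.compl]
    have hts : MeasurableSet (tsupport f) := (isClosed_tsupport f).measurableSet
    refine (norm_integral_le_of_norm_le ((integrable_indicator_iff hts).2 (integrableOn_const (IsCompact.measure_lt_top hfc).ne)) (Filter.Eventually.of_forall hb)).trans ?_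
    rw [integral_indicator hts, setIntegral_const, smul_eq_mul, mul_comm]
  have h3 : ε * Q * V ≤ η/2 * c := by
    have : ε ≤ η * kc0 m / (2 * (Q * V + 1)) := min_le_right _ _
    rw [le_div_iff₀ (by positivity)] at this
    nlinarith
  have : (∫ x, f x * P x) - c * f z = ((∫ x in ball z δ, f x * P x) - c * f z) + ∫ x in (ball z δ)ᶜ, f x * P x := by
    rw [← hsplit]; ring
  rw [this]
  refine (norm_add_le _ _).trans ?_
  linarith

end OWData

theorem OW {m : ℕ} (hm : 1 ≤ m) {T : Set (Fin m → ℂ)} (hT : IsCompact T) (hne : T.Nonempty) (hull : polyHull T = T)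
    {N₀ : Set (Fin m → ℂ)} (hN : IsOpen N₀) (hNb : Bornology.IsBounded N₀) (hTN : T ⊆ N₀) :
    ∃ C : ℝ, 0 ≤ C ∧ ∀ f : (Fin m → ℂ) → ℂ, ContDiff ℝ 1 f → HasCompactSupport f → ∀ b : ℝ, 0 ≤ b →
      (∀ ζ ∈ N₀, ∀ l, ‖dbar l f ζ‖ ≤ b) → ∀ η > 0, ∃ p : MvPolynomial (Fin m) ℂ, ∀ z ∈ T, ‖f z - MvPolynomial.eval z p‖ ≤ C * b + η := by
  obtain ⟨d⟩ := exists_OWData hT hne hull hN hTN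
  obtain ⟨C, hC0, hC⟩ := d.tele hT hm hNb
  have hk := kc0_pos m
  refine ⟨C / kc0 m, by positivity, fun f hf hfc b hb hfb η hη => ?_⟩
  obtain ⟨ε, hε, c, hc, h1⟩ := d.repro hT hf.continuous hfc (η := η/2) (by positivity)
  have : CompactSpace T := isCompact_iff_compactSpace.1 hT
  obtain ⟨k, hk1, hk2⟩ := OWData.v_mem (d := d) hε hf.continuous hfc
  have hc0 : 0 < c := hk.trans_le hc
  have hk3 : (algebraMap ℂ C(T, ℂ) (c⁻¹ : ℂ)) * k ∈ PT T := (PT T).mul_mem ((PT T).algebraMap_mem _) hk1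
  obtain ⟨p, hp⟩ := mem_PT_approx hk3 (η := η/2) (by positivity)
  refine ⟨p, fun z hz => ?_⟩
  have h2 := hp ⟨z, hz⟩
  have h3 := hC f hf hfc b hb hfb ε hε z hz
  have h4 := h1 z hz
  simp only [ContinuousMap.mul_apply, hk2] at h2
  have h2' : (algebraMap ℂ C(T, ℂ) (c⁻¹ : ℂ)) ⟨z, hz⟩ = (c:ℂ)⁻¹ := rfl
  rw [h2'] at h2
  set I := ∫ x, f x * Matrix.det (Matrix.of fun j l => dbar l (d.u ε z j) x)
  set J := ∫ x, f x * Matrix.det (Matrix.of fun j l => dbar l (d.v ε z j) x)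
  have h5 : f z - (c:ℂ)⁻¹ * J = (c:ℂ)⁻¹ * ((I - J) - (I - c * f z)) := by
    have : (c:ℂ) ≠ 0 := by exact_mod_cast hc0.ne'
    field_simp; ring
  have h6 : ‖f z - (c:ℂ)⁻¹ * J‖ ≤ C / kc0 m * b + η/2 := by
    rw [h5, norm_mul, norm_inv, Complex.norm_real, Real.norm_eq_abs, abs_of_pos hc0]
    calc _ ≤ c⁻¹ * (C * b + η/2 * c) := by gcongr; exact (norm_sub_le _ _).trans (add_le_add h3 h4)
      _ = C / c * b + η/2 := by field_simp
      _ ≤ _ := by gcongr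
  calc _ = ‖(f z - (c:ℂ)⁻¹ * J) + ((c:ℂ)⁻¹ * J - MvPolynomial.eval z p)‖ := by congr 1; ring
    _ ≤ _ := (norm_add_le _ _).trans (by linarith)
end

section holo
variable {E : Type*} [NormedAddCommGroup E] [NormedSpace ℂ E] [FiniteDimensional ℂ E]

lemma holo_line {F : E → ℂ} {O : Set E} (hO : IsOpen O) (hF : DifferentiableOn ℂ F O) (x v : E) (l : ℂ) (hx : x + l • v ∈ O) :
    HasDerivAt (fun l : ℂ => F (x + l • v)) (fderiv ℂ F (x + l • v) v) l := by
  have h1 := (hF.differentiableAt (hO.mem_nhds hx)).hasFDerivAt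
  have h2 : HasDerivAt (fun l : ℂ => x + l • v) v l := by
    simpa using ((hasDerivAt_id l).smul_const v).const_add x
  exact h1.comp_hasDerivAt l h2

lemma holo_fderiv_cont {F : E → ℂ} {O : Set E} (hO : IsOpen O) (hF : DifferentiableOn ℂ F O) : ContinuousOn (fderiv ℂ F) O := by
  have : ProperSpace E := FiniteDimensional.proper ℂ E
  intro x₀ hx₀
  refine ContinuousAt.continuousWithinAt ?_
  obtain ⟨ρ₀, hρ₀, hb₀⟩ := Metric.isOpen_iff.1 hO x₀ hx₀
  set ρ := ρ₀ / 3 with hρd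
  have hρ : 0 < ρ := by positivity
  have hb : closedBall x₀ (2*ρ) ⊆ O := (closedBall_subset_ball (by linarith)).trans hb₀
  have huc := (isCompact_closedBall x₀ (2*ρ)).uniformContinuousOn_of_continuous (hF.continuousOn.mono hb)
  rw [Metric.continuousAt_iff]
  intro ε hε
  obtain ⟨δ, hδ, h⟩ := Metric.uniformContinuousOn_iff.1 huc (ε/2*ρ) (by positivity)
  refine ⟨min δ ρ, lt_min hδ hρ, fun {x} hx => ?_⟩
  have hxρ : dist x x₀ < ρ := hx.trans_le (min_le_right _ _)
  rw [dist_eq_norm]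
  have key : ‖fderiv ℂ F x - fderiv ℂ F x₀‖ ≤ ε/2 := by
    refine ContinuousLinearMap.opNorm_le_of_unit_norm (by positivity) fun v hv => ?_
    have hm : ∀ y, dist y x₀ < ρ → ∀ l ∈ closedBall (0:ℂ) ρ, y + l • v ∈ closedBall x₀ (2*ρ) := by
      intro y hy l hl
      rw [mem_closedBall, dist_eq_norm]
      rw [dist_eq_norm] at hy
      have : y + l • v - x₀ = (y - x₀) + l • v := by abel
      rw [this]
      refine (norm_add_le _ _).trans ?_
      rw [norm_smul, hv, mul_one]
      have := mem_closedBall_zero_iff.1 hl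
      linarith
    have hd : ∀ l ∈ closedBall (0:ℂ) ρ, HasDerivAt (fun l : ℂ => F (x + l • v) - F (x₀ + l • v)) (fderiv ℂ F (x + l • v) v - fderiv ℂ F (x₀ + l • v) v) l := fun l hl =>
      (holo_line hO hF x v l (hb (hm x hxρ l hl))).sub (holo_line hO hF x₀ v l (hb (hm x₀ (by simpa using hρ) l hl)))
    have hdc : DiffContOnCl ℂ (fun l : ℂ => F (x + l • v) - F (x₀ + l • v)) (ball 0 ρ) := by
      refine DifferentiableOn.diffContOnCl ?_
      rw [closure_ball _ hρ.ne']
      exact fun l hl => (hd l hl).differentiableAt.differentiableWithinAt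
    have := Complex.norm_deriv_le_of_forall_mem_sphere_norm_le hρ hdc (C := ε/2*ρ) (fun l hl => by
      have hl' := sphere_subset_closedBall hl
      rw [← dist_eq_norm]
      refine (h _ (hm x hxρ l hl') _ (hm x₀ (by simpa using hρ) l hl') ?_).le
      rw [dist_add_right]; exact hx.trans_le (min_le_left _ _))
    rw [(hd 0 (by simpa using hρ.le)).deriv] at this
    simp only [zero_smul, add_zero] at this
    rw [_root_.sub_apply]
    refine this.trans (le_of_eq ?_)
    field_simp
  linarith

lemma holo_contDiff {F : E → ℂ} {O : Set E} (hO : IsOpen O) (hF : DifferentiableOn ℂ F O) : ContDiffOn ℂ 1 F O :=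
  (contDiffOn_succ_iff_fderiv_of_isOpen (n := 0) hO).2 ⟨hF, by simp, contDiffOn_zero.2 (holo_fderiv_cont hO hF)⟩

lemma holo_fderiv {F : E → ℂ} {O : Set E} (hO : IsOpen O) (hF : DifferentiableOn ℂ F O) (v : E) :
    DifferentiableOn ℂ (fun x => fderiv ℂ F x v) O := by
  have : ProperSpace E := FiniteDimensional.proper ℂ E
  intro x₀ hx₀
  refine DifferentiableAt.differentiableWithinAt ?_
  obtain ⟨ρ₀, hρ₀, hb₀⟩ := Metric.isOpen_iff.1 hO x₀ hx₀
  set ρ := ρ₀ / 3 with hρd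
  have hρ : 0 < ρ := by positivity
  have hb : closedBall x₀ (2*ρ) ⊆ O := (closedBall_subset_ball (by linarith)).trans hb₀
  set s := ρ / (‖v‖ + 1) with hs
  have hs0 : 0 < s := by positivity
  have hsv : s * ‖v‖ ≤ ρ := by
    rw [hs, div_mul_eq_mul_div, div_le_iff₀ (by positivity)]; nlinarith [norm_nonneg v]
  have hm : ∀ y ∈ ball x₀ ρ, ∀ l ∈ closedBall (0:ℂ) s, y + l • v ∈ closedBall x₀ (2*ρ) := by
    intro y hy l hl
    rw [mem_closedBall, dist_eq_norm]
    rw [mem_ball, dist_eq_norm] at hy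
    have : y + l • v - x₀ = (y - x₀) + l • v := by abel
    rw [this]
    refine (norm_add_le _ _).trans ?_
    rw [norm_smul]
    have := mem_closedBall_zero_iff.1 hl
    nlinarith [norm_nonneg v]
  obtain ⟨M, hM⟩ := (isCompact_closedBall x₀ (2*ρ)).exists_bound_of_continuousOn ((holo_fderiv_cont hO hF).mono hb)
  have hcm : ∀ θ, circleMap 0 s θ ∈ closedBall (0:ℂ) s := fun θ => sphere_subset_closedBall (circleMap_mem_sphere 0 hs0.le θ)
  let w : ℝ → ℂ := fun θ => deriv (circleMap 0 s) θ * ((circleMap 0 s θ) ^ 2)⁻¹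
  have hw : Continuous w := by
    have h1 : Continuous (deriv (circleMap 0 s)) := by
      have : deriv (circleMap 0 s) = fun θ => circleMap 0 s θ * Complex.I := by ext θ; simp [deriv_circleMap]
      rw [this]; exact (continuous_circleMap 0 s).mul continuous_const
    refine h1.mul (((continuous_circleMap 0 s).pow 2).inv₀ fun θ => pow_ne_zero 2 ?_)
    exact circleMap_ne_center hs0.ne'
  have hcauchy : ∀ x ∈ ball x₀ ρ, fderiv ℂ F x v = (2 * Real.pi * Complex.I : ℂ)⁻¹ * ∫ θ in (0:ℝ)..(2*Real.pi), w θ * F (x + circleMap 0 s θ • v) := by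
    intro x hx
    have hU : IsOpen {l : ℂ | x + l • v ∈ O} := hO.preimage (by fun_prop)
    have h := Complex.two_pi_I_inv_smul_circleIntegral_sub_sq_inv_smul_of_differentiable (c := 0) (R := s) (w₀ := 0) hU (fun l hl => hb (hm x hx l hl))
      (f := fun l : ℂ => F (x + l • v)) (fun l hl => (holo_line hO hF x v l hl).differentiableAt.differentiableWithinAt) (by simpa using hs0)
    have hd := (holo_line hO hF x v 0 (hb (hm x hx 0 (by simpa using hs0.le)))).deriv
    rw [hd] at h
    simp only [zero_smul, add_zero, sub_zero, smul_eq_mul] at h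
    rw [← h, circleIntegral]
    congr 1
    refine intervalIntegral.integral_congr fun θ _ => ?_
    simp only [smul_eq_mul, w]; ring
  have hpath : ∀ x ∈ ball x₀ ρ, Continuous (fun θ => F (x + circleMap 0 s θ • v)) := fun x hx =>
    (hF.continuousOn.mono hb).comp_continuous (by fun_prop) (fun θ => hm x hx _ (hcm θ))
  have hpath' : ∀ x ∈ ball x₀ ρ, Continuous (fun θ => fderiv ℂ F (x + circleMap 0 s θ • v)) := fun x hx =>
    ((holo_fderiv_cont hO hF).mono hb).comp_continuous (by fun_prop) (fun θ => hm x hx _ (hcm θ))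
  have hx₀' : x₀ ∈ ball x₀ ρ := mem_ball_self hρ
  have hI := intervalIntegral.hasFDerivAt_integral_of_dominated_of_fderiv_le (𝕜 := ℂ) (μ := MeasureTheory.volume) (a := 0) (b := 2 * Real.pi)
    (F := fun x θ => w θ * F (x + circleMap 0 s θ • v)) (F' := fun x θ => w θ • fderiv ℂ F (x + circleMap 0 s θ • v)) (x₀ := x₀)
    (bound := fun θ => ‖w θ‖ * M) (ball_mem_nhds x₀ hρ) ?_ ?_ ?_ ?_ ?_ ?_
  · refine DifferentiableAt.congr_of_eventuallyEq (hI.differentiableAt.const_mul ((2 * Real.pi * Complex.I : ℂ)⁻¹)) ?_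
    filter_upwards [ball_mem_nhds x₀ hρ] with x hx using hcauchy x hx
  · filter_upwards [ball_mem_nhds x₀ hρ] with x hx
    exact (hw.mul (hpath x hx)).aestronglyMeasurable
  · exact (hw.mul (hpath x₀ hx₀')).intervalIntegrable _ _
  · exact (hw.smul (hpath' x₀ hx₀')).aestronglyMeasurable
  · refine Filter.Eventually.of_forall fun θ _ x hx => ?_
    rw [norm_smul]; gcongr; exact hM _ (hm x hx _ (hcm θ))
  · exact (hw.norm.mul continuous_const).intervalIntegrable _ _
  · refine Filter.Eventually.of_forall fun θ _ x hx => ?_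
    have h1 := (hF.differentiableAt (hO.mem_nhds (hb (hm x hx _ (hcm θ))))).hasFDerivAt
    have h2 : HasFDerivAt (fun x => x + circleMap 0 s θ • v) (ContinuousLinearMap.id ℂ E) x := (hasFDerivAt_id x).add_const _
    exact (h1.comp x h2).const_mul (w θ)

end holo

lemma OWL {m : ℕ} (hm : 1 ≤ m) {T : Set (Fin m → ℂ)} (hT : IsCompact T) (hne : T.Nonempty) (hull : polyHull T = T)
    {O K₀ K₁ D : Set (Fin m → ℂ)} (hO : IsOpen O) (hK₀ : IsClosed K₀) (hK₁ : IsClosed K₁) (hd : Disjoint K₀ K₁) (hD : IsOpen D)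
    (hTO : T \ K₀ ⊆ O) (hTD : T ⊆ K₀ ∪ K₁ ∪ D) :
    ∃ χ : (Fin m → ℂ) → ℝ, (∀ x, 0 ≤ χ x ∧ χ x ≤ 1) ∧ (∀ x ∈ K₀, χ x = 0) ∧ (∀ x ∈ K₁, χ x = 1) ∧ ∃ C : ℝ, 0 ≤ C ∧
      ∀ F : (Fin m → ℂ) → ℂ, DifferentiableOn ℂ F O → ∀ b : ℝ, 0 ≤ b → (∀ z ∈ D ∩ O, ‖F z‖ ≤ b) → ∀ η > 0,
        ∃ p : MvPolynomial (Fin m) ℂ, ∀ z ∈ T, ‖χ z * F z - MvPolynomial.eval z p‖ ≤ C * b + η := by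
  obtain ⟨χ, χs, χ0, χ1, χb⟩ := smooth_urysohn hK₀ hK₁ hd
  rw [eventually_nhdsSet_iff_forall] at χ0 χ1
  have hχ0 : ∀ x ∈ K₀, x ∈ interior {x | χ x = 0} := fun x hx => mem_interior_iff_mem_nhds.2 (χ0 x hx)
  have hχ1 : ∀ x ∈ K₁, x ∈ interior {x | χ x = 1} := fun x hx => mem_interior_iff_mem_nhds.2 (χ1 x hx)
  obtain ⟨R, hR⟩ := hT.isBounded.subset_ball (0 : Fin m → ℂ)
  set T' := T \ interior {x | χ x = 0} with hT'
  have hT'c : IsClosed T' := hT.isClosed.sdiff isOpen_interior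
  have hT'O : T' ⊆ O := fun x hx => hTO ⟨hx.1, fun h => hx.2 (hχ0 x h)⟩
  obtain ⟨θ, θs, θ0, θ1, θb⟩ := smooth_urysohn (s := (O ∩ ball 0 R)ᶜ) (t := T') (hO.inter isOpen_ball).isClosed_compl hT'c
    (Set.disjoint_left.2 fun x hx hx' => hx ⟨hT'O hx', hR hx'.1⟩)
  rw [eventually_nhdsSet_iff_forall] at θ0 θ1
  set N₀ : Set (Fin m → ℂ) := ball 0 R ∩ (interior {x | χ x = 0} ∪ (interior {x | θ x = 1} ∩ O ∩ (interior {x | χ x = 1} ∪ D))) with hN₀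
  have hN : IsOpen N₀ := isOpen_ball.inter (isOpen_interior.union ((isOpen_interior.inter hO).inter (isOpen_interior.union hD)))
  have hTN : T ⊆ N₀ := by
    intro x hx
    refine ⟨hR hx, ?_⟩
    by_cases h : x ∈ interior {x | χ x = 0}
    · exact Or.inl h
    · refine Or.inr ⟨⟨mem_interior_iff_mem_nhds.2 (θ1 x ⟨hx, h⟩), hT'O ⟨hx, h⟩⟩, ?_⟩
      rcases hTD hx with (h' | h') | h'
      · exact absurd (hχ0 x h') h
      · exact Or.inl (hχ1 x h')
      · exact Or.inr h'
  obtain ⟨C, hC, hOW⟩ := OW hm hT hne hull hN (isBounded_ball.subset Set.inter_subset_left) hTN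
  have χs' : ContDiff ℝ 2 (fun x => (χ x : ℂ)) := Complex.ofRealCLM.contDiff.comp χs
  have θs' : ContDiff ℝ 2 (fun x => (θ x : ℂ)) := Complex.ofRealCLM.contDiff.comp θs
  have hM : ∃ M : ℝ, 0 ≤ M ∧ ∀ x ∈ ball (0 : Fin m → ℂ) R, ∀ l, ‖dbar l (fun x => (χ x : ℂ)) x‖ ≤ M := by
    have : ∀ l : Fin m, ∃ M, ∀ x ∈ closedBall (0 : Fin m → ℂ) R, ‖dbar l (fun x => (χ x : ℂ)) x‖ ≤ M := fun l =>
      (isCompact_closedBall _ _).exists_bound_of_continuousOn (contDiff_dbar (k := 1) (n := 2) χs' (by norm_num)).continuous.continuousOn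
    choose M hM using this
    refine ⟨∑ l, |M l|, Finset.sum_nonneg fun l _ => abs_nonneg _, fun x hx l => ?_⟩
    exact ((hM l x (ball_subset_closedBall hx)).trans (le_abs_self _)).trans (Finset.single_le_sum (f := fun l => |M l|) (fun l _ => abs_nonneg _) (Finset.mem_univ l))
  obtain ⟨M, hM0, hM⟩ := hM
  refine ⟨χ, χb, fun x hx => (χ0 x hx).self_of_nhds, fun x hx => (χ1 x hx).self_of_nhds, C * M, by positivity, ?_⟩
  intro F hF b hb hFb η hη
  set f : (Fin m → ℂ) → ℂ := fun x => χ x * (θ x * F x) with hf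
  have hF1 : ∀ x ∈ O, ContDiffAt ℝ 1 F x := fun x hx =>
    ((holo_contDiff hO hF).contDiffAt (hO.mem_nhds hx)).restrict_scalars ℝ
  have hfs : ContDiff ℝ 1 f := by
    rw [contDiff_iff_contDiffAt]
    intro x
    by_cases hx : x ∈ O ∩ ball 0 R
    · exact ((χs'.of_le one_le_two).contDiffAt).mul (((θs'.of_le one_le_two).contDiffAt).mul (hF1 x hx.1))
    · refine (contDiffAt_const (c := (0:ℂ))).congr_of_eventuallyEq ?_
      filter_upwards [θ0 x hx] with y hy
      simp [f, hy]
  have hfc : HasCompactSupport f := by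
    refine HasCompactSupport.of_support_subset_isCompact (isCompact_closedBall (0 : Fin m → ℂ) R) fun x hx => ?_
    by_contra hx'
    have := (θ0 x (fun h => hx' (ball_subset_closedBall h.2))).self_of_nhds
    exact hx (by simp [f, this])
  obtain ⟨p, hp⟩ := hOW f hfs hfc (M * b) (by positivity) (by
    rintro ζ ⟨hζR, hζ⟩ l
    rcases hζ with hζ | ⟨⟨hζ, hζO⟩, hζ'⟩
    · have : f =ᶠ[nhds ζ] fun _ => 0 := by
        filter_upwards [mem_interior_iff_mem_nhds.1 hζ] with y hy
        have hy : χ y = 0 := hy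
        simp [f, hy]
      rw [dbar_congr this, dbar_const]; simp; positivity
    · have h1 : f =ᶠ[nhds ζ] fun x => (χ x : ℂ) * F x := by
        filter_upwards [mem_interior_iff_mem_nhds.1 hζ] with y hy
        have hy : θ y = 1 := hy
        simp [f, hy]
      have hFd := hF.differentiableAt (hO.mem_nhds hζO)
      rcases hζ' with hζ' | hζ'
      · have h2 : f =ᶠ[nhds ζ] F := by
          filter_upwards [h1, mem_interior_iff_mem_nhds.1 hζ'] with y hy hy'
          have hy' : χ y = 1 := hy'
          simp [hy, hy']
        rw [dbar_congr h2, dbar_holo hFd]; simp; positivity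
      · rw [dbar_congr h1, dbar_mul (f := fun x => (χ x : ℂ)) (g := F) (χs'.differentiable (by norm_num) ζ) (hFd.restrictScalars ℝ), dbar_holo hFd]
        simp only [mul_zero, zero_add, add_zero]
        rw [norm_mul]
        exact mul_le_mul (hM ζ hζR l) (hFb ζ ⟨hζ', hζO⟩) (norm_nonneg _) hM0) η hη
  refine ⟨p, fun z hz => ?_⟩
  have := hp z hz
  have hfz : f z = χ z * F z := by
    by_cases h : z ∈ interior {x | χ x = 0}
    · have : χ z = 0 := by have := interior_subset h; exact this
      simp [f, this]
    · have := (θ1 z ⟨hz, h⟩).self_of_nhds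
      simp [f, this]
  rw [hfz] at this
  rw [mul_assoc]; exact this

lemma mem_hull_iff {m : ℕ} {K : Set (Fin m → ℂ)} (hK : IsCompact K) (hne : K.Nonempty) (z : Fin m → ℂ) :
    z ∈ polyHull K ↔ ∀ (p : MvPolynomial (Fin m) ℂ) (c : ℝ), (∀ w ∈ K, ‖MvPolynomial.eval w p‖ ≤ c) → ‖MvPolynomial.eval z p‖ ≤ c := by
  constructor
  · intro hz p c hc
    refine (hz p).trans (csSup_le (hne.image _) ?_)
    rintro _ ⟨w, hw, rfl⟩; exact hc w hw
  · intro h p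
    refine h p _ fun w hw => le_csSup ?_ ⟨w, hw, rfl⟩
    exact (hK.image (continuous_eval' p).norm).bddAbove

lemma subset_hull {m : ℕ} {K : Set (Fin m → ℂ)} (hK : IsCompact K) (hne : K.Nonempty) : K ⊆ polyHull K :=
  fun z hz => (mem_hull_iff hK hne z).2 fun _ _ h => h z hz

lemma hull_compact {m : ℕ} {K : Set (Fin m → ℂ)} (hK : IsCompact K) (hne : K.Nonempty) : IsCompact (polyHull K) := by
  refine Metric.isCompact_of_isClosed_isBounded ?_ ?_
  · have : polyHull K = ⋂ p : MvPolynomial (Fin m) ℂ, {z | ‖MvPolynomial.eval z p‖ ≤ sSup ((fun w => ‖MvPolynomial.eval w p‖) '' K)} := by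
      ext z; simp [polyHull]
    rw [this]
    exact isClosed_iInter fun p => isClosed_le (continuous_eval' p).norm continuous_const
  · obtain ⟨R, hR⟩ := hK.isBounded.subset_closedBall (0 : Fin m → ℂ)
    refine (isBounded_closedBall (x := (0 : Fin m → ℂ)) (r := max R 0)).subset fun z hz => ?_
    rw [mem_closedBall_zero_iff, pi_norm_le_iff_of_nonneg (le_max_right _ _)]
    intro i
    have := (mem_hull_iff hK hne z).1 hz (MvPolynomial.X i) (max R 0) (fun w hw => by
      have := mem_closedBall_zero_iff.1 (hR hw)
      simpa using Or.inl ((norm_le_pi_norm w i).trans this))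
    simpa using this

lemma hull_hull {m : ℕ} {K : Set (Fin m → ℂ)} (hK : IsCompact K) (hne : K.Nonempty) : polyHull (polyHull K) = polyHull K := by
  refine Set.Subset.antisymm (fun z hz => ?_) (subset_hull (hull_compact hK hne) (hne.mono (subset_hull hK hne)))
  rw [mem_hull_iff (hull_compact hK hne) (hne.mono (subset_hull hK hne))] at hz
  rw [mem_hull_iff hK hne]
  intro p c hc
  exact hz p c fun w hw => (mem_hull_iff hK hne w).1 hw p c hc

lemma LMP {m : ℕ} (hm : 1 ≤ m) {S : Set (Fin m → ℂ)} (hS : IsCompact S) (hne : S.Nonempty) {x₀ : Fin m → ℂ} (hx₀ : x₀ ∈ polyHull S) (hx₀S : x₀ ∉ S)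
    {r : ℝ} (hr : 0 < r) {H : (Fin m → ℂ) → ℂ} (hH : DifferentiableOn ℂ H (ball x₀ r)) (hH0 : H x₀ = 0) {δ : ℝ} (hδ : 0 < δ)
    (hle : ∀ ξ ∈ polyHull S, ξ ∈ ball x₀ r → (H ξ).re ≤ - δ * ‖ξ - x₀‖^2) : False := by
  obtain ⟨r₀, hr₀, hr₀S⟩ := Metric.isOpen_iff.1 hS.isClosed.isOpen_compl x₀ hx₀S
  set r₁ := min r r₀ / 4 with hr₁
  have h1 : 0 < r₁ := by have := lt_min hr hr₀; positivity
  have h2 : 2 * r₁ < r := by have := min_le_left r r₀; have := lt_min hr hr₀; linarith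
  have h3 : 2 * r₁ < r₀ := by have := min_le_right r r₀; have := lt_min hr hr₀; linarith
  set c := δ * r₁^2 / 2 with hc
  have hc0 : 0 < c := by positivity
  have hTne := hne.mono (subset_hull hS hne)
  obtain ⟨χ, χb, χ0, χ1, C, hC, hO⟩ := OWL hm (hull_compact hS hne) hTne (hull_hull hS hne)
    (O := ball x₀ r) (K₀ := (ball x₀ (2*r₁))ᶜ) (K₁ := closedBall x₀ r₁) (D := ball x₀ r ∩ H ⁻¹' {w | w.re < -c})
    isOpen_ball isOpen_ball.isClosed_compl isClosed_closedBall
    (Set.disjoint_left.2 fun x hx hx' => hx (closedBall_subset_ball (by linarith) hx'))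
    (hH.continuousOn.isOpen_inter_preimage isOpen_ball (isOpen_lt Complex.continuous_re continuous_const))
    (fun x hx => ball_subset_ball h2.le (not_not.1 hx.2))
    (by
      intro x hx
      by_cases h4 : x ∈ ball x₀ (2*r₁)
      · by_cases h5 : x ∈ closedBall x₀ r₁
        · exact Or.inl (Or.inr h5)
        · have h6 := ball_subset_ball h2.le h4
          refine Or.inr ⟨h6, ?_⟩
          have := hle x hx h6
          rw [mem_closedBall, dist_eq_norm, not_le] at h5
          have h7 : r₁^2 ≤ ‖x - x₀‖^2 := by gcongr
          show (H x).re < -c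
          have : δ * r₁^2 ≤ δ * ‖x - x₀‖^2 := by gcongr
          nlinarith
      · exact Or.inl (Or.inl h4))
  have hlim : Filter.Tendsto (fun k : ℝ => C * Real.exp (-(k * c))) Filter.atTop (nhds (C * 0)) := by
    refine Filter.Tendsto.const_mul C ?_
    exact Real.tendsto_exp_neg_atTop_nhds_zero.comp (Filter.tendsto_id.atTop_mul_const hc0)
  rw [mul_zero] at hlim
  obtain ⟨k, hk, hk0⟩ := ((hlim.eventually (gt_mem_nhds (show (0:ℝ) < 1/8 by norm_num))).and (Filter.eventually_ge_atTop 0)).exists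
  obtain ⟨p, hp⟩ := hO (fun ξ => Complex.exp (k * H ξ)) ((hH.const_mul _).cexp) (Real.exp (-(k*c))) (Real.exp_pos _).le
    (fun z hz => by
      rw [Complex.norm_exp]
      have : (H z).re < -c := hz.1.2
      simp only [Complex.re_ofReal_mul]
      refine Real.exp_le_exp.2 ?_
      nlinarith) (1/8) (by norm_num)
  have e1 : ‖MvPolynomial.eval x₀ p‖ ≤ 1/4 := by
    refine (mem_hull_iff hS hne x₀).1 hx₀ p _ fun w hw => ?_
    have := hp w (subset_hull hS hne hw)
    rw [χ0 w (fun h => hr₀S (ball_subset_ball h3.le h) hw)] at this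
    simp only [Complex.ofReal_zero, zero_mul, zero_sub, norm_neg] at this
    linarith
  have e2 := hp x₀ hx₀
  rw [χ1 x₀ (mem_closedBall_self h1.le), hH0] at e2
  simp only [Complex.ofReal_one, mul_zero, Complex.exp_zero, mul_one] at e2
  have := norm_sub_norm_le (1:ℂ) (MvPolynomial.eval x₀ p)
  rw [norm_one] at this
  linarith

lemma push_in {n : ℕ} {Ω : Set (Fin n → ℂ)} (hop : IsOpen Ω) (hC1 : C1Boundary Ω) {z₀ : Fin n → ℂ} (hz₀ : z₀ ∈ closure Ω) :
    ∃ (ν : Fin n → ℂ) (r t₀ : ℝ), 0 < r ∧ 0 < t₀ ∧ ∀ z ∈ closure Ω, z ∈ ball z₀ r → ∀ t : ℝ, 0 < t → t < t₀ → z + t • ν ∈ Ω := by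
  by_cases h : z₀ ∈ Ω
  · obtain ⟨r, hr, hb⟩ := Metric.isOpen_iff.1 hop z₀ h
    exact ⟨0, r, 1, hr, one_pos, fun z _ hz t _ _ => by simpa using hb hz⟩
  have hfr : frontier Ω = closure Ω \ Ω := hop.frontier_eq
  obtain ⟨W, hW, hzW, ρ, hρ, hne, hin, hbd⟩ := hC1 z₀ (by rw [hfr]; exact ⟨hz₀, h⟩)
  obtain ⟨v, hv⟩ : ∃ v, fderiv ℝ ρ z₀ v ≠ 0 := by
    by_contra hcon; push Not at hcon
    exact hne z₀ hzW (ContinuousLinearMap.ext fun v => by simpa using hcon v)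
  obtain ⟨ν, hν⟩ : ∃ v, fderiv ℝ ρ z₀ v < 0 := by
    rcases lt_or_gt_of_ne hv with h | h
    · exact ⟨v, h⟩
    · exact ⟨-v, by simpa using h⟩
  have hc : ContinuousOn (fun x => fderiv ℝ ρ x ν) W :=
    (hρ.continuousOn_fderiv_of_isOpen hW le_rfl).clm_apply continuousOn_const
  have hopen := hc.isOpen_inter_preimage hW (isOpen_Iio (a := (0:ℝ)))
  obtain ⟨r, hr, hb⟩ := Metric.isOpen_iff.1 hopen z₀ ⟨hzW, hν⟩
  refine ⟨ν, r/2, r/2/(‖ν‖+1), by positivity, by positivity, fun z hz hzb t ht0 ht => ?_⟩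
  have hmem : ∀ s ∈ Set.Icc (0:ℝ) t, z + s • ν ∈ ball z₀ r := by
    intro s hs
    rw [mem_ball, dist_eq_norm] at hzb ⊢
    have e : z + s • ν - z₀ = (z - z₀) + s • ν := by abel
    rw [e]
    refine (norm_add_le _ _).trans_lt ?_
    rw [norm_smul, Real.norm_of_nonneg hs.1]
    rw [lt_div_iff₀ (by positivity)] at ht
    nlinarith [norm_nonneg ν, hs.1, hs.2]
  have hderiv : ∀ s ∈ Set.Icc (0:ℝ) t, HasDerivAt (fun s : ℝ => ρ (z + s • ν)) (fderiv ℝ ρ (z + s • ν) ν) s := by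
    intro s hs
    have h1 := ((hρ.differentiableOn one_ne_zero).differentiableAt (hW.mem_nhds (hb (hmem s hs)).1)).hasFDerivAt
    have h2 : HasDerivAt (fun s : ℝ => z + s • ν) ν s := by
      simpa using ((hasDerivAt_id s).smul_const ν).const_add z
    exact h1.comp_hasDerivAt s h2
  have hanti := strictAntiOn_of_deriv_neg (convex_Icc (0:ℝ) t) (f := fun s : ℝ => ρ (z + s • ν))
    (fun s hs => (hderiv s hs).continuousAt.continuousWithinAt)
    (fun s hs => by
      have hs' := interior_subset hs
      rw [(hderiv s hs').deriv]; exact (hb (hmem s hs')).2)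
  have hlt := hanti (Set.left_mem_Icc.2 ht0.le) (Set.right_mem_Icc.2 ht0.le) ht0
  simp only [zero_smul, add_zero] at hlt
  have hzW' : z ∈ W := by have := (hb (hmem 0 (Set.left_mem_Icc.2 ht0.le))).1; simpa using this
  have hz0 : ρ z ≤ 0 := by
    by_cases hzΩ : z ∈ Ω
    · have : z ∈ Ω ∩ W := ⟨hzΩ, hzW'⟩
      rw [hin] at this; exact this.2.le
    · have : z ∈ frontier Ω ∩ W := ⟨by rw [hfr]; exact ⟨hz, hzΩ⟩, hzW'⟩
      rw [hbd] at this; exact this.2.le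
  have : z + t • ν ∈ {w ∈ W | ρ w < 0} := ⟨(hb (hmem t (Set.right_mem_Icc.2 ht0.le))).1, hlt.trans_le hz0⟩
  rw [← hin] at this; exact this.1

noncomputable def zp (n N : ℕ) : (Fin (n+N) → ℂ) →L[ℂ] (Fin n → ℂ) :=
  ContinuousLinearMap.pi fun i => ContinuousLinearMap.proj (Fin.castAdd N i)

@[simp] lemma zp_apply {n N : ℕ} (ξ : Fin (n+N) → ℂ) (i : Fin n) : zp n N ξ i = ξ (Fin.castAdd N i) := rfl

lemma zp_append {n N : ℕ} (z : Fin n → ℂ) (w : Fin N → ℂ) : zp n N (Fin.append z w) = z := by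
  ext i; simp

lemma zp_norm {n N : ℕ} (ξ : Fin (n+N) → ℂ) : ‖zp n N ξ‖ ≤ ‖ξ‖ :=
  (pi_norm_le_iff_of_nonneg (norm_nonneg _)).2 fun i => norm_le_pi_norm ξ _

lemma graph_cont {n N : ℕ} {X : Set (Fin n → ℂ)} {h : Fin N → (Fin n → ℂ) → ℂ} (hcont : ∀ j, ContinuousOn (h j) X) :
    ContinuousOn (fun z => Fin.append z (fun j => h j z)) X := by
  refine continuousOn_pi.2 fun i => ?_
  refine Fin.addCases (fun i => ?_) (fun j => ?_) i
  · simpa using (continuous_apply i).continuousOn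
  · simpa using hcont j

lemma graph_compact {n N : ℕ} {X : Set (Fin n → ℂ)} (hX : IsCompact X) {h : Fin N → (Fin n → ℂ) → ℂ} (hcont : ∀ j, ContinuousOn (h j) X) :
    IsCompact (graphSet h X) := hX.image_of_continuousOn (graph_cont hcont)

lemma hull_proj {n N : ℕ} {X : Set (Fin n → ℂ)} (hX : IsCompact X) (hne : X.Nonempty) (hpc : polyHull X = X) {h : Fin N → (Fin n → ℂ) → ℂ} (hcont : ∀ j, ContinuousOn (h j) X)
    {ξ : Fin (n+N) → ℂ} (hξ : ξ ∈ polyHull (graphSet h X)) : zp n N ξ ∈ X := by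
  rw [← hpc, mem_hull_iff hX hne]
  intro p c hc
  have := (mem_hull_iff (graph_compact hX hcont) (hne.image _) ξ).1 hξ (MvPolynomial.rename (Fin.castAdd N) p) c (by
    rintro _ ⟨z, hz, rfl⟩
    rw [MvPolynomial.eval_rename]
    have e : (Fin.append z fun j => h j z) ∘ Fin.castAdd N = z := by funext i; simp
    simp only [e]
    exact hc z hz)
  rw [MvPolynomial.eval_rename] at this
  exact this

noncomputable def Qf {m : ℕ} (x : Fin m → ℂ) : ℝ := ∑ i, ‖x i‖^2

lemma Qf_cont {m : ℕ} : Continuous (Qf : (Fin m → ℂ) → ℝ) := by unfold Qf; fun_prop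

lemma Qf_nonneg {m : ℕ} (x : Fin m → ℂ) : 0 ≤ Qf x := Finset.sum_nonneg fun i _ => by positivity

lemma Qf_ge {m : ℕ} (x : Fin m → ℂ) : ‖x‖^2 ≤ Qf x := by
  have h0 := Qf_nonneg x
  have : ‖x‖ ≤ Real.sqrt (Qf x) := by
    refine (pi_norm_le_iff_of_nonneg (Real.sqrt_nonneg _)).2 fun i => Real.le_sqrt_of_sq_le ?_
    exact Finset.single_le_sum (f := fun i => ‖x i‖^2) (fun i _ => by positivity) (Finset.mem_univ i)
  calc ‖x‖^2 ≤ Real.sqrt (Qf x) ^ 2 := by gcongr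
    _ = _ := Real.sq_sqrt h0

lemma Qf_id {m : ℕ} (x a : Fin m → ℂ) : Qf x = Qf a + 2 * (∑ i, starRingEnd ℂ (a i) * (x i - a i)).re + Qf (x - a) := by
  unfold Qf
  rw [Complex.re_sum, Finset.mul_sum, ← Finset.sum_add_distrib, ← Finset.sum_add_distrib]
  refine Finset.sum_congr rfl fun i _ => ?_
  simp only [Pi.sub_apply, Complex.sq_norm, Complex.normSq_apply, Complex.mul_re, Complex.conj_re, Complex.conj_im, Complex.sub_re, Complex.sub_im]
  ring

lemma graph_key {n N : ℕ} {Ω : Set (Fin n → ℂ)} (hne : Ω.Nonempty) (hn : 1 ≤ n) 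
    (hbd : Bornology.IsBounded Ω) (hop : IsOpen Ω)
    (hC1 : C1Boundary Ω) (hpc : polyHull (closure Ω) = closure Ω)
    (h : Fin N → (Fin n → ℂ) → ℂ)
    (hcont : ∀ j, ContinuousOn (h j) (closure Ω))
    (hph : ∀ j, Pluriharmonic (h j) Ω) (j : Fin N) (c : ℂ) (ξ₁ : Fin (n+N) → ℂ) (hξ₁ : ξ₁ ∈ polyHull (graphSet h (closure Ω))) :
    (c * (ξ₁ (Fin.natAdd n j) - h j (zp n N ξ₁))).re ≤ 0 := by
  set X := closure Ω with hXd
  have hX : IsCompact X := hbd.isCompact_closure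
  have hXne : X.Nonempty := hne.closure
  set S := graphSet h X with hSd
  have hS : IsCompact S := graph_compact hX hcont
  have hSne : S.Nonempty := hXne.image _
  set T := polyHull S with hTd
  have hT : IsCompact T := hull_compact hS hSne
  have hzX : ∀ ξ ∈ T, zp n N ξ ∈ X := fun ξ hξ => hull_proj hX hXne hpc hcont hξ
  by_contra hcon
  push Not at hcon
  set u : (Fin (n+N) → ℂ) → ℝ := fun ξ => (c * (ξ (Fin.natAdd n j) - h j (zp n N ξ))).re with hu
  set a := u ξ₁ with ha
  have huc : ContinuousOn u T := by
    refine Complex.continuous_re.comp_continuousOn (continuousOn_const.mul ((continuous_apply _).continuousOn.sub ?_))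
    exact (hcont j).comp (zp n N).continuous.continuousOn hzX
  obtain ⟨M, hM⟩ := hT.exists_bound_of_continuousOn (Qf_cont.continuousOn (s := T))
  have hM0 : 0 ≤ M := (norm_nonneg _).trans (hM ξ₁ hξ₁)
  set ε := a / (2 * (M+1)) with hε
  have hε0 : 0 < ε := by positivity
  have hεM : ε * M < a := by
    rw [hε, div_mul_eq_mul_div, div_lt_iff₀ (by positivity)]; nlinarith
  obtain ⟨x₀, hx₀, hmax⟩ := hT.exists_isMaxOn ⟨ξ₁, hξ₁⟩ (huc.add (continuousOn_const.mul Qf_cont.continuousOn) : ContinuousOn (fun ξ => u ξ + ε * Qf ξ) T)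
  have hmax : ∀ ξ ∈ T, u ξ + ε * Qf ξ ≤ u x₀ + ε * Qf x₀ := fun ξ hξ => hmax hξ
  have hux₀ : 0 < u x₀ := by
    have h1 := hmax ξ₁ hξ₁
    have h2 := (le_abs_self _).trans (hM x₀ hx₀)
    have h3 := Qf_nonneg ξ₁
    have : ε * Qf x₀ ≤ ε * M := by gcongr
    have : 0 ≤ ε * Qf ξ₁ := by positivity
    linarith
  have hx₀S : x₀ ∉ S := by
    rintro ⟨z, hz, rfl⟩
    simp [u, zp_append] at hux₀
  obtain ⟨ν, r, t₀, hr, ht₀, hpush⟩ := push_in hop hC1 (hzX x₀ hx₀)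
  obtain ⟨r', hr', hr'S⟩ := Metric.isOpen_iff.1 hS.isClosed.isOpen_compl x₀ hx₀S
  set r₁ := min r r' / 2 with hr₁
  have h1 : 0 < r₁ := by have := lt_min hr hr'; positivity
  have h2 : r₁ < r := by have := min_le_left r r'; have := lt_min hr hr'; linarith
  have h3 : r₁ < r' := by have := min_le_right r r'; have := lt_min hr hr'; linarith
  have hKc : IsCompact (T ∩ closedBall x₀ r₁) := hT.inter_right isClosed_closedBall
  set κ := ε / 2 * r₁^2 / 4 with hκ
  have hκ0 : 0 < κ := by positivity
  obtain ⟨δ, hδ, hδu⟩ := Metric.uniformContinuousOn_iff.1 (hX.uniformContinuousOn_of_continuous (hcont j)) (κ / (‖c‖+1)) (by positivity)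
  obtain ⟨t, ht0, htt, htδ⟩ : ∃ t : ℝ, 0 < t ∧ t < t₀ ∧ t * ‖ν‖ < δ := by
    refine ⟨min (t₀/2) (δ / (‖ν‖+1)), by positivity, (min_le_left _ _).trans_lt (by linarith), ?_⟩
    have : min (t₀/2) (δ / (‖ν‖+1)) * (‖ν‖ + 1) ≤ δ := by
      calc _ ≤ δ / (‖ν‖+1) * (‖ν‖ + 1) := by gcongr; exact min_le_right _ _
        _ = δ := by field_simp
    have : 0 < min (t₀/2) (δ / (‖ν‖+1)) := by positivity
    nlinarith
  have hΩ : ∀ ξ ∈ T ∩ closedBall x₀ r₁, zp n N ξ + t • ν ∈ Ω := by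
    intro ξ hξ
    refine hpush _ (hzX ξ hξ.1) ?_ t ht0 htt
    rw [mem_ball, dist_eq_norm, ← map_sub]
    refine (zp_norm _).trans_lt ?_
    rw [← dist_eq_norm]; exact lt_of_le_of_lt hξ.2 h2
  set ut : (Fin (n+N) → ℂ) → ℝ := fun ξ => (c * (ξ (Fin.natAdd n j) - h j (zp n N ξ + t • ν))).re with hut
  have hutc : ContinuousOn ut (T ∩ closedBall x₀ r₁) := by
    refine Complex.continuous_re.comp_continuousOn (continuousOn_const.mul ((continuous_apply _).continuousOn.sub ?_))
    exact (hcont j).comp (((zp n N).continuous.add continuous_const).continuousOn) (fun ξ hξ => subset_closure (hΩ ξ hξ))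
  have hclose : ∀ ξ ∈ T ∩ closedBall x₀ r₁, |ut ξ - u ξ| ≤ κ := by
    intro ξ hξ
    have e : ut ξ - u ξ = (c * (h j (zp n N ξ) - h j (zp n N ξ + t • ν))).re := by
      simp only [hut, hu, ← Complex.sub_re]; congr 1; ring
    rw [e]
    refine (Complex.abs_re_le_norm _).trans ?_
    rw [norm_mul, ← dist_eq_norm]
    have := hδu _ (hzX ξ hξ.1) _ (subset_closure (hΩ ξ hξ)) (by
      rw [dist_self_add_right, norm_smul, Real.norm_of_nonneg ht0.le]; exact htδ)
    rw [lt_div_iff₀ (by positivity)] at this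
    nlinarith [dist_nonneg (x := h j (zp n N ξ)) (y := h j (zp n N ξ + t • ν))]
  obtain ⟨x, hx, hxmax⟩ := hKc.exists_isMaxOn ⟨x₀, hx₀, mem_closedBall_self h1.le⟩
    ((hutc.add (continuousOn_const.mul Qf_cont.continuousOn)).sub (continuousOn_const.mul (Qf_cont.comp (continuous_id.sub continuous_const)).continuousOn) :
      ContinuousOn (fun ξ => ut ξ + ε * Qf ξ - ε/2 * Qf (ξ - x₀)) (T ∩ closedBall x₀ r₁))
  have hxmax : ∀ ξ ∈ T ∩ closedBall x₀ r₁, ut ξ + ε * Qf ξ - ε/2 * Qf (ξ - x₀) ≤ ut x + ε * Qf x - ε/2 * Qf (x - x₀) := fun ξ hξ => hxmax hξ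
  have hxlt : ‖x - x₀‖ < r₁ := by
    have e1 := hxmax x₀ ⟨hx₀, mem_closedBall_self h1.le⟩
    have e2 := abs_le.1 (hclose x₀ ⟨hx₀, mem_closedBall_self h1.le⟩)
    have e3 := abs_le.1 (hclose x hx)
    have e4 := hmax x hx.1
    have e5 : Qf (x₀ - x₀) = 0 := by simp [Qf]
    rw [e5] at e1
    have e6 : ε/2 * Qf (x - x₀) ≤ 2 * κ := by linarith [e2.1, e3.2]
    have e7 : ε/2 * ‖x - x₀‖^2 ≤ ε/2 * (r₁^2/2) := by
      calc _ ≤ ε/2 * Qf (x - x₀) := by gcongr; exact Qf_ge _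
        _ ≤ 2 * κ := e6
        _ = _ := by rw [hκ]; ring
    have e8 := le_of_mul_le_mul_left e7 (by positivity)
    by_contra hge
    push Not at hge
    have : r₁^2 ≤ ‖x - x₀‖^2 := by gcongr
    nlinarith
  obtain ⟨U, hU, hyU, hUΩ, F, G, hF, hG, hFG⟩ := hph j _ (hΩ x hx)
  have hpre : IsOpen ({ξ | zp n N ξ + t • ν ∈ U} ∩ ball x₀ r₁) :=
    (hU.preimage ((zp n N).continuous.add continuous_const)).inter isOpen_ball
  obtain ⟨r₂, hr₂, hb₂⟩ := Metric.isOpen_iff.1 hpre x ⟨hyU, by rwa [mem_ball, dist_eq_norm]⟩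
  set P : (Fin (n+N) → ℂ) → ℂ := fun ξ => c * ξ (Fin.natAdd n j) - c * F (zp n N ξ + t • ν) - starRingEnd ℂ c * G (zp n N ξ + t • ν) with hP
  have hPre : ∀ ξ, zp n N ξ + t • ν ∈ U → ut ξ = (P ξ).re := by
    intro ξ hξ
    simp only [hut, hP, hFG _ hξ, Complex.sub_re, Complex.mul_re, Complex.add_re, Complex.conj_re, Complex.conj_im, Complex.sub_im, Complex.add_im]
    ring
  have hPd : DifferentiableOn ℂ P (ball x r₂) := by
    have hm : Set.MapsTo (fun ξ => zp n N ξ + t • ν) (ball x r₂) U := fun ξ hξ => (hb₂ hξ).1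
    have hd : DifferentiableOn ℂ (fun ξ => zp n N ξ + t • ν) (ball x r₂) := (((zp n N).differentiable).add_const _).differentiableOn
    refine DifferentiableOn.sub (DifferentiableOn.sub ?_ ((hF.comp hd hm).const_mul c)) ((hG.comp hd hm).const_mul _)
    fun_prop
  refine LMP (by omega) hS hSne hx.1 (fun h => hr'S (closedBall_subset_ball h3 hx.2) h) hr₂
    (H := fun ξ => P ξ - P x + 2 * ε * (∑ i, starRingEnd ℂ (x i) * (ξ i - x i)) - ε * ∑ i, starRingEnd ℂ (x i - x₀ i) * (ξ i - x i))
    (by refine DifferentiableOn.sub (DifferentiableOn.add (hPd.sub_const _) ?_) ?_ <;> fun_prop) (by simp) (δ := ε/2) (by positivity) ?_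
  intro ξ hξ hξb
  have hξK : ξ ∈ T ∩ closedBall x₀ r₁ := ⟨hξ, ball_subset_closedBall (hb₂ hξb).2⟩
  have f1 := hxmax ξ hξK
  rw [hPre ξ (hb₂ hξb).1, hPre x hyU, Qf_id ξ x, Qf_id (ξ - x₀) (x - x₀)] at f1
  have f2 : ξ - x₀ - (x - x₀) = ξ - x := by abel
  have f3 := Qf_ge (ξ - x)
  have f4 : (∑ i, starRingEnd ℂ ((x - x₀) i) * ((ξ - x₀) i - (x - x₀) i)) = ∑ i, starRingEnd ℂ (x i - x₀ i) * (ξ i - x i) := by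
    refine Finset.sum_congr rfl fun i _ => ?_
    simp only [Pi.sub_apply]; congr 1; ring
  rw [f2, f4] at f1
  have f5 : (2 * (ε:ℂ) * (∑ i, starRingEnd ℂ (x i) * (ξ i - x i))).re = 2 * ε * (∑ i, starRingEnd ℂ (x i) * (ξ i - x i)).re := by
    rw [show (2:ℂ) * (ε:ℂ) = ((2 * ε : ℝ) : ℂ) by push_cast; rfl, Complex.re_ofReal_mul]
  simp only [Complex.sub_re, Complex.add_re, Complex.re_ofReal_mul, f5]
  nlinarith

lemma graph_polyconvex {n N : ℕ} {Ω : Set (Fin n → ℂ)} (hne : Ω.Nonempty) (hn : 1 ≤ n) 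
    (hbd : Bornology.IsBounded Ω) (hop : IsOpen Ω)
    (hC1 : C1Boundary Ω) (hpc : polyHull (closure Ω) = closure Ω)
    (h : Fin N → (Fin n → ℂ) → ℂ)
    (hcont : ∀ j, ContinuousOn (h j) (closure Ω))
    (hph : ∀ j, Pluriharmonic (h j) Ω) : polyHull (graphSet h (closure Ω)) = graphSet h (closure Ω) := by
  have hX : IsCompact (closure Ω) := hbd.isCompact_closure
  refine Set.Subset.antisymm (fun ξ hξ => ?_) (subset_hull (graph_compact hX hcont) (hne.closure.image _))
  refine ⟨zp n N ξ, hull_proj hX hne.closure hpc hcont hξ, ?_⟩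
  ext i
  refine Fin.addCases (fun i => ?_) (fun j => ?_) i
  · simp
  · have := graph_key hne hn hbd hop hC1 hpc h hcont hph j (starRingEnd ℂ (ξ (Fin.natAdd n j) - h j (zp n N ξ))) ξ hξ
    rw [← Complex.normSq_eq_conj_mul_self, Complex.ofReal_re] at this
    have := Complex.normSq_eq_zero.1 (le_antisymm this (Complex.normSq_nonneg _))
    simp only [Fin.append_right]
    exact (sub_eq_zero.1 this).symm

noncomputable def ev {n N : ℕ} (h : Fin N → (Fin n → ℂ) → ℂ) (p : MvPolynomial (Fin (n+N)) ℂ) (z : Fin n → ℂ) : ℂ :=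
  MvPolynomial.eval (Fin.append z (fun j => h j z)) p

lemma ev_cont {n N : ℕ} {X : Set (Fin n → ℂ)} {h : Fin N → (Fin n → ℂ) → ℂ} (hcont : ∀ j, ContinuousOn (h j) X)
    (p : MvPolynomial (Fin (n+N)) ℂ) : ContinuousOn (ev h p) X :=
  (continuous_eval' p).comp_continuousOn (graph_cont hcont)

lemma adjoin_poly {n N : ℕ} {M : Set (Fin n → ℂ)} {h : Fin N → (Fin n → ℂ) → ℂ} (a : C(M, ℂ)) (ha : a ∈ Algebra.adjoin ℂ (zhGens M h)) :
    ∃ p : MvPolynomial (Fin (n+N)) ℂ, ∀ z : M, a z = ev h p z := by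
  induction ha using Algebra.adjoin_induction with
  | mem x hx =>
    rcases hx with ⟨i, hi⟩ | ⟨j, hj⟩
    · exact ⟨MvPolynomial.X (Fin.castAdd N i), fun z => by simp [ev, hi]⟩
    · exact ⟨MvPolynomial.X (Fin.natAdd n j), fun z => by simp [ev, hj]⟩
  | algebraMap r => exact ⟨MvPolynomial.C r, fun z => by simp [ev]⟩
  | add x y _ _ hx hy =>
    obtain ⟨p, hp⟩ := hx
    obtain ⟨q, hq⟩ := hy
    exact ⟨p + q, fun z => by simp [ev, hp, hq]⟩
  | mul x y _ _ hx hy =>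
    obtain ⟨p, hp⟩ := hx
    obtain ⟨q, hq⟩ := hy
    exact ⟨p * q, fun z => by simp [ev, hp, hq]⟩

lemma poly_adjoin {n N : ℕ} {M : Set (Fin n → ℂ)} {h : Fin N → (Fin n → ℂ) → ℂ} (hcont : ∀ j, ContinuousOn (h j) M)
    (p : MvPolynomial (Fin (n+N)) ℂ) : ∃ a ∈ Algebra.adjoin ℂ (zhGens M h), ∀ z : M, a z = ev h p z := by
  induction p using MvPolynomial.induction_on with
  | C r => exact ⟨algebraMap ℂ C(M, ℂ) r, Subalgebra.algebraMap_mem _ _, fun z => by simp [ev]⟩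
  | add p q hp hq =>
    obtain ⟨a, ha, ha'⟩ := hp
    obtain ⟨b, hb, hb'⟩ := hq
    exact ⟨a + b, add_mem ha hb, fun z => by simp [ev, ha', hb']⟩
  | mul_X p i hp =>
    obtain ⟨a, ha, ha'⟩ := hp
    refine Fin.addCases (fun i => ?_) (fun j => ?_) i
    · refine ⟨a * coordC M i, mul_mem ha (Algebra.subset_adjoin (Or.inl ⟨i, fun z => rfl⟩)), fun z => ?_⟩
      simp [ev, ha', coordC]
    · refine ⟨a * ⟨M.domRestrict (h j), (hcont j).domRestrict⟩, mul_mem ha (Algebra.subset_adjoin (Or.inr ⟨j, fun z => rfl⟩)), fun z => ?_⟩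
      simp [ev, ha']

lemma bdry_approx {n N : ℕ} {M : Set (Fin n → ℂ)} (hM : IsCompact M) {h : Fin N → (Fin n → ℂ) → ℂ} (hg : genAlg (zhGens M h) = Set.univ)
    {f : (Fin n → ℂ) → ℂ} (hf : ContinuousOn f M) {ε : ℝ} (hε : 0 < ε) : ∃ p, ∀ z ∈ M, ‖f z - ev h p z‖ < ε := by
  have := isCompact_iff_compactSpace.1 hM
  have h1 : (⟨M.domRestrict f, hf.domRestrict⟩ : C(M, ℂ)) ∈ genAlg (zhGens M h) := by rw [hg]; trivial
  obtain ⟨a, ha, hd⟩ := Metric.mem_closure_iff.1 h1 ε hε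
  obtain ⟨p, hp⟩ := adjoin_poly a ha
  refine ⟨p, fun z hz => ?_⟩
  have := (ContinuousMap.dist_lt_iff hε).1 hd ⟨z, hz⟩
  rw [dist_eq_norm, hp] at this
  exact this

lemma gen_of_approx {n N : ℕ} {M : Set (Fin n → ℂ)} (hM : IsCompact M) {h : Fin N → (Fin n → ℂ) → ℂ} (hcont : ∀ j, ContinuousOn (h j) M)
    (H : ∀ f : (Fin n → ℂ) → ℂ, ContinuousOn f M → ∀ ε > 0, ∃ p, ∀ z ∈ M, ‖f z - ev h p z‖ < ε) : genAlg (zhGens M h) = Set.univ := by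
  have := isCompact_iff_compactSpace.1 hM
  refine Set.eq_univ_of_forall fun g => Metric.mem_closure_iff.2 fun ε hε => ?_
  classical
  obtain ⟨p, hp⟩ := H (fun z => if hz : z ∈ M then g ⟨z, hz⟩ else 0) (by
    rw [continuousOn_iff_continuous_domRestrict]
    convert g.continuous using 1
    ext z; simp) ε hε
  obtain ⟨a, ha, ha'⟩ := poly_adjoin hcont p
  refine ⟨a, ha, (ContinuousMap.dist_lt_iff hε).2 fun z => ?_⟩
  have := hp z z.2
  rw [dist_eq_norm, ha']
  simpa using this

/-- local representation -/
def IsRep {n N : ℕ} (h : Fin N → (Fin n → ℂ) → ℂ) (U : Set (Fin n → ℂ)) (F G : Fin N → (Fin n → ℂ) → ℂ) : Prop :=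
  IsOpen U ∧ (∀ j, DifferentiableOn ℂ (F j) U) ∧ (∀ j, DifferentiableOn ℂ (G j) U) ∧
    ∀ j, ∀ w ∈ U, h j w = F j w + starRingEnd ℂ (G j w)

lemma norm_one_sub_exp {y : ℂ} (hy : ‖y‖ ≤ 1) : ‖1 - Complex.exp (-y)‖ ≤ 2 * ‖y‖ := by
  have := Complex.norm_exp_sub_one_le (x := -y) (by simpa using hy)
  rw [norm_neg] at this
  rwa [norm_sub_rev]

lemma peak_step {n N : ℕ} (hn : 1 ≤ n) {X : Set (Fin n → ℂ)} (hX : IsCompact X) {h : Fin N → (Fin n → ℂ) → ℂ} (hcont : ∀ j, ContinuousOn (h j) X)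
    (hull : polyHull (graphSet h X) = graphSet h X) {U : Set (Fin n → ℂ)} {F G : Fin N → (Fin n → ℂ) → ℂ} (hrep : IsRep h U F G)
    {q : Fin n → ℂ} (hqX : q ∈ X) {r : ℝ} (hr : 0 < r) (hrU : closedBall q r ⊆ U) (hsp : ∀ z ∈ sphere q r, ∃ j, G j z ≠ G j q) :
    ∃ V', IsOpen V' ∧ q ∈ V' ∧ V' ⊆ closedBall q r ∧ ∀ η > 0, ∃ p, (∀ z ∈ X, z ∈ V' → ‖1 - ev h p z‖ ≤ η) ∧
      (∀ z ∈ X, z ∉ closedBall q r → ‖ev h p z‖ ≤ η) ∧ (∀ z ∈ X, ‖ev h p z‖ + ‖1 - ev h p z‖ ≤ 1 + η) := by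
  obtain ⟨hU, hF, hG, hFG⟩ := hrep
  set g : (Fin n → ℂ) → ℝ := fun z => ∑ j, ‖G j z - G j q‖^2 with hg
  have hgc : ContinuousOn g U := continuousOn_finsetSum _ fun j _ => (((hG j).continuousOn.sub continuousOn_const).norm.pow 2)
  have hg0 : ∀ z, 0 ≤ g z := fun z => Finset.sum_nonneg fun j _ => by positivity
  have hgpos : ∀ z ∈ sphere q r, 0 < g z := by
    intro z hz
    obtain ⟨j, hj⟩ := hsp z hz
    refine Finset.sum_pos' (fun j _ => by positivity) ⟨j, Finset.mem_univ _, ?_⟩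
    have := norm_pos_iff.2 (sub_ne_zero.2 hj)
    positivity
  obtain ⟨δ, hδ, hδg⟩ : ∃ δ > 0, ∀ z ∈ sphere q r, δ < g z := by
    rcases (sphere q r).eq_empty_or_nonempty with he | hne
    · exact ⟨1, one_pos, fun z hz => by simp [he] at hz⟩
    · obtain ⟨z₁, hz₁, hmin⟩ := (isCompact_sphere q r).exists_isMinOn hne (hgc.mono (sphere_subset_closedBall.trans hrU))
      refine ⟨g z₁ / 2, by have := hgpos z₁ hz₁; positivity, fun z hz => ?_⟩
      have := hgpos z₁ hz₁
      have h2 : g z₁ ≤ g z := hmin hz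
      linarith
  set Dz : Set (Fin n → ℂ) := U ∩ g ⁻¹' Set.Ioi δ with hDz
  have hDzo : IsOpen Dz := hgc.isOpen_inter_preimage hU isOpen_Ioi
  set Q : (Fin (n+N) → ℂ) → ℂ := fun ξ => ∑ j, (G j (zp n N ξ) - G j q) * (ξ (Fin.natAdd n j) - F j (zp n N ξ) - starRingEnd ℂ (G j q)) with hQ
  set O : Set (Fin (n+N) → ℂ) := zp n N ⁻¹' U with hOd
  have hO : IsOpen O := hU.preimage (zp n N).continuous
  have hQd : DifferentiableOn ℂ Q O := by
    refine DifferentiableOn.fun_sum fun j _ => ?_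
    have hd : DifferentiableOn ℂ (fun ξ => zp n N ξ) O := (zp n N).differentiable.differentiableOn
    have hm : Set.MapsTo (fun ξ => zp n N ξ) O U := fun ξ hξ => hξ
    refine (((hG j).comp hd hm).sub_const _).mul ((DifferentiableOn.sub ?_ ((hF j).comp hd hm)).sub_const _)
    fun_prop
  have hQg : ∀ z ∈ U, Q (Fin.append z (fun j => h j z)) = g z := by
    intro z hz
    simp only [hQ, hg, zp_append, Fin.append_right]
    push_cast
    refine Finset.sum_congr rfl fun j _ => ?_
    rw [hFG j z hz, ← Complex.mul_conj']
    simp only [map_sub]; ring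
  have hballs : closedBall q r \ Dz ⊆ ball q r := by
    intro z hz
    rcases (mem_closedBall.1 hz.1).lt_or_eq with h1 | h1
    · exact h1
    · exact absurd ⟨hrU hz.1, hδg z h1⟩ hz.2
  obtain ⟨χ, χb, χ0, χ1, C, hC, hOW⟩ := OWL (show 1 ≤ n + N by omega) (graph_compact hX hcont) ⟨_, q, hqX, rfl⟩ hull
    (O := O) (K₀ := zp n N ⁻¹' (ball q r ∪ Dz)ᶜ) (K₁ := zp n N ⁻¹' (closedBall q r \ Dz)) (D := O ∩ Q ⁻¹' {w | δ < w.re})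
    hO ((isOpen_ball.union hDzo).isClosed_compl.preimage (zp n N).continuous) ((isClosed_closedBall.sdiff hDzo).preimage (zp n N).continuous)
    (Set.disjoint_left.2 fun x hx hx' => hx (Or.inl (hballs hx')))
    (hQd.continuousOn.isOpen_inter_preimage hO (isOpen_lt continuous_const Complex.continuous_re))
    (fun ξ hξ => by
      have : zp n N ξ ∈ ball q r ∪ Dz := not_not.1 hξ.2
      rcases this with h1 | h1
      · exact hrU (ball_subset_closedBall h1)
      · exact h1.1)
    (by
      rintro _ ⟨z, hz, rfl⟩
      by_cases h1 : z ∈ Dz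
      · refine Or.inr ⟨by simpa [hOd, zp_append] using h1.1, ?_⟩
        show δ < (Q _).re
        rw [hQg z h1.1]; exact h1.2
      · refine Or.inl ?_
        by_cases h2 : z ∈ closedBall q r
        · exact Or.inr (by simpa [zp_append] using ⟨h2, h1⟩)
        · refine Or.inl ?_
          show zp n N (Fin.append z fun j => h j z) ∈ (ball q r ∪ Dz)ᶜ
          rw [zp_append]
          rintro (h3 | h3)
          · exact h2 (ball_subset_closedBall h3)
          · exact h1 h3)
  refine ⟨ball q r ∩ (U ∩ g ⁻¹' Set.Iio (δ/4)), isOpen_ball.inter (hgc.isOpen_inter_preimage hU isOpen_Iio),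
    ⟨mem_ball_self hr, hrU (mem_closedBall_self hr.le), by simp [hg]; positivity⟩, fun z hz => ball_subset_closedBall hz.1, fun η hη => ?_⟩
  have hlim : Filter.Tendsto (fun k : ℝ => (2 * C + 3) * Real.exp (-(k * (δ/4)))) Filter.atTop (nhds ((2*C+3) * 0)) := by
    refine Filter.Tendsto.const_mul _ ?_
    exact Real.tendsto_exp_neg_atTop_nhds_zero.comp (Filter.tendsto_id.atTop_mul_const (by positivity))
  rw [mul_zero] at hlim
  obtain ⟨τ, hτ, hτ0⟩ := ((hlim.eventually (gt_mem_nhds (show (0:ℝ) < η/4 by positivity))).and (Filter.eventually_ge_atTop 0)).exists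
  set y := Real.exp (-(τ * (δ/4))) with hy
  have hy0 : 0 < y := Real.exp_pos _
  have hCy : 0 ≤ C * y := by positivity
  set E : ℂ → ℂ := fun w => 1 - Complex.exp (-Complex.exp (τ * (δ/2 - w))) with hE
  have hEb : ∀ w : ℂ, δ ≤ w.re → ‖E w‖ ≤ 2 * y := by
    intro w hw
    have e1 : ‖Complex.exp (τ * (δ/2 - w))‖ ≤ y := by
      rw [Complex.norm_exp, hy]
      refine Real.exp_le_exp.2 ?_
      rw [Complex.re_ofReal_mul, Complex.sub_re, show ((δ:ℂ)/2).re = δ/2 by simp]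
      nlinarith
    have e2 : y ≤ 1 := Real.exp_le_one_iff.2 (by have : 0 ≤ τ * (δ/4) := by positivity
                                                 linarith)
    exact (norm_one_sub_exp (e1.trans e2)).trans (by gcongr)
  have hEr : ∀ t : ℝ, E t = ((1 - Real.exp (-Real.exp (τ * (δ/2 - t))) : ℝ) : ℂ) := by
    intro t; simp only [hE]; push_cast; rfl
  obtain ⟨p, hp⟩ := hOW (fun ξ => E (Q ξ)) (by
      have : DifferentiableOn ℂ (fun ξ => (τ:ℂ) * (δ/2 - Q ξ)) O := (hQd.const_sub _).const_mul _
      exact (this.cexp.neg.cexp).const_sub _) (2 * y) (by positivity)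
    (fun ξ hξ => hEb _ (le_of_lt hξ.1.2)) (η/8) (by positivity)
  have hkey : ∀ z ∈ X, ∃ e : ℝ, 0 ≤ e ∧ e ≤ 1 ∧ ‖(e:ℂ) - ev h p z‖ ≤ η/2 - 2 * y ∧
      (z ∉ closedBall q r → e ≤ 2 * y) ∧ (z ∈ ball q r ∩ (U ∩ g ⁻¹' Set.Iio (δ/4)) → 1 - e ≤ y) := by
    intro z hz
    have hpz := hp _ ⟨z, hz, rfl⟩
    have hbound : C * (2*y) + η/8 ≤ η/2 - 2*y := by nlinarith
    by_cases hzU : z ∈ ball q r ∪ Dz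
    · have hzU' : z ∈ U := by
        rcases hzU with h1 | h1
        · exact hrU (ball_subset_closedBall h1)
        · exact h1.1
      simp only [hQg z hzU', hEr] at hpz
      set e₀ := 1 - Real.exp (-Real.exp (τ * (δ/2 - g z))) with he₀
      have e0 : 0 ≤ e₀ := by
        have : Real.exp (-Real.exp (τ * (δ/2 - g z))) ≤ 1 := Real.exp_le_one_iff.2 (by have := Real.exp_pos (τ * (δ/2 - g z)); linarith)
        linarith
      have e1 : e₀ ≤ 1 := by have := Real.exp_pos (-Real.exp (τ * (δ/2 - g z))); linarith
      set x := χ (Fin.append z fun j => h j z)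
      have hx := χb (Fin.append z fun j => h j z)
      refine ⟨x * e₀, mul_nonneg hx.1 e0, mul_le_one₀ hx.2 e0 e1, ?_, ?_, ?_⟩
      · push_cast; exact hpz.trans hbound
      · intro hzb
        rcases hzU with h1 | h1
        · exact absurd (ball_subset_closedBall h1) hzb
        · have := hEb (g z) (le_of_lt h1.2)
          rw [hEr, Complex.norm_real, Real.norm_of_nonneg e0] at this
          exact (mul_le_of_le_one_left e0 hx.2).trans this
      · rintro ⟨h1, h2, h3⟩
        have h3 : g z < δ/4 := h3
        have hx1 : x = 1 := χ1 _ (by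
          show zp n N (Fin.append z fun j => h j z) ∈ closedBall q r \ Dz
          rw [zp_append]
          refine ⟨ball_subset_closedBall h1, fun h4 => ?_⟩
          have : δ < g z := h4.2
          linarith)
        rw [hx1, one_mul, he₀, sub_sub_cancel, hy]
        refine Real.exp_le_exp.2 (neg_le_neg ?_)
        have : τ * (δ/4) ≤ τ * (δ/2 - g z) := by gcongr; linarith
        exact this.trans (by have := Real.add_one_le_exp (τ * (δ/2 - g z)); linarith)
    · rw [χ0 _ (by show zp n N (Fin.append z fun j => h j z) ∈ (ball q r ∪ Dz)ᶜ; rw [zp_append]; exact hzU)] at hpz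
      refine ⟨0, le_rfl, zero_le_one, ?_, fun _ => by positivity, fun h1 => absurd (Or.inl h1.1) hzU⟩
      simp only [Complex.ofReal_zero, zero_mul] at hpz ⊢
      exact hpz.trans hbound
  have htri : ∀ (e : ℝ) (w : ℂ), 0 ≤ e → e ≤ 1 → ‖w‖ ≤ e + ‖(e:ℂ) - w‖ ∧ ‖1 - w‖ ≤ (1 - e) + ‖(e:ℂ) - w‖ := by
    intro e w h0 h1
    constructor
    · have := norm_sub_le (e:ℂ) ((e:ℂ) - w)
      rwa [sub_sub_cancel, Complex.norm_real, Real.norm_of_nonneg h0] at this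
    · have := norm_add_le ((1 - e : ℝ) : ℂ) ((e:ℂ) - w)
      rw [Complex.norm_real, Real.norm_of_nonneg (by linarith)] at this
      have e : ((1 - e : ℝ) : ℂ) + ((e:ℂ) - w) = 1 - w := by push_cast; ring
      rwa [e] at this
  refine ⟨p, fun z hz hzV => ?_, fun z hz hzV => ?_, fun z hz => ?_⟩
  · obtain ⟨e, he0, he1, he2, he3, he4⟩ := hkey z hz
    have := (htri e (ev h p z) he0 he1).2
    have := he4 hzV
    linarith
  · obtain ⟨e, he0, he1, he2, he3, he4⟩ := hkey z hz
    have := (htri e (ev h p z) he0 he1).1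
    have := he3 hzV
    linarith
  · obtain ⟨e, he0, he1, he2, he3, he4⟩ := hkey z hz
    have := htri e (ev h p z) he0 he1
    linarith [this.1, this.2]

lemma glue {n N : ℕ} {X Y : Set (Fin n → ℂ)} (hX : IsCompact X) {h : Fin N → (Fin n → ℂ) → ℂ} (hcont : ∀ j, ContinuousOn (h j) X)
    (hY : ∀ f : (Fin n → ℂ) → ℂ, ContinuousOn f X → ∀ ε > 0, ∃ p, ∀ z ∈ Y, ‖f z - ev h p z‖ < ε)
    (hpk : ∀ q ∈ X, q ∉ Y → ∀ V ∈ nhds q, ∃ V' ∈ nhds q, V' ⊆ V ∧ ∀ η > 0, ∃ p, (∀ z ∈ X, z ∈ V' → ‖1 - ev h p z‖ ≤ η) ∧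
      (∀ z ∈ X, z ∉ V → ‖ev h p z‖ ≤ η) ∧ (∀ z ∈ X, ‖ev h p z‖ + ‖1 - ev h p z‖ ≤ 1 + η))
    (f : (Fin n → ℂ) → ℂ) (hf : ContinuousOn f X) (ε : ℝ) (hε : 0 < ε) : ∃ p, ∀ z ∈ X, ‖f z - ev h p z‖ < ε := by
  classical
  obtain ⟨p₀, hp₀⟩ := hY f hf (ε/2) (by positivity)
  have hev := ev_cont hcont
  have hVq : ∀ q ∈ X, ∃ V ∈ nhds q, ∀ z ∈ X, z ∈ V → ‖f z - f q‖ ≤ ε/2 := by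
    intro q hq
    obtain ⟨δ, hδ, hd⟩ := Metric.continuousOn_iff.1 hf q hq (ε/2) (by positivity)
    exact ⟨ball q δ, ball_mem_nhds q hδ, fun z hz hzV => by rw [← dist_eq_norm]; exact (hd z hz hzV).le⟩
  set K := X ∩ {z | ε/2 ≤ ‖f z - ev h p₀ z‖} with hK
  have hKc : IsCompact K := by
    have : IsClosed K := ((hf.sub (hev p₀)).norm).preimage_isClosed_of_isClosed hX.isClosed isClosed_Ici
    exact hX.of_isClosed_subset this Set.inter_subset_left
  have hKY : ∀ q ∈ K, q ∉ Y := fun q hq hqY => absurd (hp₀ q hqY) (not_lt.2 hq.2)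
  have hch : ∀ q : K, ∃ V ∈ nhds q.1, (∀ z ∈ X, z ∈ V → ‖f z - f q‖ ≤ ε/2) ∧ ∃ V' ∈ nhds q.1, V' ⊆ V ∧ ∀ η > 0, ∃ p, (∀ z ∈ X, z ∈ V' → ‖1 - ev h p z‖ ≤ η) ∧
      (∀ z ∈ X, z ∉ V → ‖ev h p z‖ ≤ η) ∧ (∀ z ∈ X, ‖ev h p z‖ + ‖1 - ev h p z‖ ≤ 1 + η) := by
    intro q
    obtain ⟨V, hV, hVf⟩ := hVq q q.2.1
    exact ⟨V, hV, hVf, hpk q q.2.1 (hKY q q.2) V hV⟩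
  choose V hV hVf V' hV' hVV hp using hch
  obtain ⟨t, ht⟩ := hKc.elim_nhds_subcover' (fun q hq => V' ⟨q, hq⟩) (fun q hq => hV' ⟨q, hq⟩)
  have hind : ∀ t : Finset K, ∃ p, ∃ ε', ε/2 ≤ ε' ∧ ε' < ε ∧ ∀ z ∈ X, (z ∉ K ∨ ∃ q ∈ t, z ∈ V' q) → ‖f z - ev h p z‖ ≤ ε' := by
    intro t
    induction t using Finset.induction_on with
    | empty =>
      refine ⟨p₀, ε/2, le_rfl, by linarith, fun z hz hzK => ?_⟩
      rcases hzK with hzK | ⟨q, hq, _⟩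
      · by_contra hcon
        push Not at hcon
        exact hzK ⟨hz, hcon.le⟩
      · simp at hq
    | insert q t _ ih =>
      obtain ⟨p, ε', h1, h2, hpε⟩ := ih
      obtain ⟨M₁, hM₁⟩ := hX.exists_bound_of_continuousOn (hf.sub (hev p))
      obtain ⟨M₂, hM₂⟩ := hX.exists_bound_of_continuousOn (hf.sub (continuousOn_const (c := f q)))
      have hM₁0 : 0 ≤ M₁ := (norm_nonneg _).trans (hM₁ q q.2.1)
      have hM₂0 : 0 ≤ M₂ := (norm_nonneg _).trans (hM₂ q q.2.1)
      have hε' : 0 < ε' := by linarith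
      set η := (ε - ε') / (2 * (ε' + M₁ + M₂ + 1)) with hη
      have hη0 : 0 < η := div_pos (by linarith) (by positivity)
      have hηe : ε' * η + M₁ * η + M₂ * η + η = (ε - ε')/2 := by rw [hη]; field_simp
      obtain ⟨k, hk1, hk2, hk3⟩ := hp q η hη0
      refine ⟨p * (1 - k) + MvPolynomial.C (f q) * k, ε' * (1 + η) + M₁ * η + M₂ * η, by nlinarith, by nlinarith, fun z hz hzK => ?_⟩
      have e : f z - ev h (p * (1 - k) + MvPolynomial.C (f q) * k) z = (f z - ev h p z) * (1 - ev h k z) + (f z - f q) * ev h k z := by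
        simp only [ev, map_add, map_mul, map_sub, map_one, MvPolynomial.eval_C]; ring
      rw [e]
      refine (norm_add_le _ _).trans ?_
      rw [norm_mul, norm_mul]
      have a1 : ‖f z - ev h p z‖ ≤ M₁ := hM₁ z hz
      have a2 : ‖f z - f q‖ ≤ M₂ := hM₂ z hz
      have a3 := hk3 z hz
      have b1 := norm_nonneg (f z - ev h p z)
      have b2 := norm_nonneg (f z - f q)
      have b3 := norm_nonneg (ev h k z)
      have b4 := norm_nonneg (1 - ev h k z)
      have c1 : 0 ≤ M₁ * η := by positivity
      have c2 : 0 ≤ M₂ * η := by positivity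
      by_cases hzq : z ∈ V' q
      · have d1 := hk1 z hz hzq
        have d2 := hVf q z hz (hVV q hzq)
        have d3 : ‖f z - ev h p z‖ * ‖1 - ev h k z‖ ≤ M₁ * η := by gcongr
        have d4 : ‖f z - f q‖ * ‖ev h k z‖ ≤ ε' * (1 + η) := mul_le_mul (d2.trans h1) (by linarith) b3 hε'.le
        linarith
      · have hgood : z ∉ K ∨ ∃ q ∈ t, z ∈ V' q := by
          rcases hzK with h3 | ⟨q', hq', hzq'⟩
          · exact Or.inl h3
          · rcases Finset.mem_insert.1 hq' with rfl | h3
            · exact absurd hzq' hzq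
            · exact Or.inr ⟨q', h3, hzq'⟩
        have d0 := hpε z hz hgood
        by_cases hzV : z ∈ V q
        · have d2 := (hVf q z hz hzV).trans h1
          have d3 : ‖f z - ev h p z‖ * ‖1 - ev h k z‖ ≤ ε' * ‖1 - ev h k z‖ := by gcongr
          have d4 : ‖f z - f q‖ * ‖ev h k z‖ ≤ ε' * ‖ev h k z‖ := by gcongr
          nlinarith
        · have d1 := hk2 z hz hzV
          have d3 : ‖f z - ev h p z‖ * ‖1 - ev h k z‖ ≤ ε' * (1 + η) := mul_le_mul d0 (by linarith) b4 hε'.le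
          have d4 : ‖f z - f q‖ * ‖ev h k z‖ ≤ M₂ * η := by gcongr
          linarith
  obtain ⟨p, ε', _, h2, hpε⟩ := hind t
  refine ⟨p, fun z hz => (hpε z hz ?_).trans_lt h2⟩
  by_cases hzK : z ∈ K
  · have := ht hzK
    rw [Set.mem_iUnion₂] at this
    obtain ⟨q, hq, hzq⟩ := this
    exact Or.inr ⟨q, hq, hzq⟩
  · exact Or.inl hzK

section
lemma caseA {E : Type*} [NormedAddCommGroup E] [NormedSpace ℂ E] [FiniteDimensional ℂ E] {Γ O : Set E} (hO : IsOpen O)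
    (hA : ∀ φ : E → ℂ, DifferentiableOn ℂ φ O → (∀ x ∈ Γ, φ x = 0) → ∀ x ∈ Γ, fderiv ℂ φ x = 0)
    {x : E} (hx : x ∈ Γ) {ρ : ℝ} (hρ : ball x ρ ⊆ O) (hxO : x ∈ O) {φ : E → ℂ} (hφ : DifferentiableOn ℂ φ O) (hφ0 : ∀ x ∈ Γ, φ x = 0) :
    ∀ v ∈ ball (0 : E) ρ, φ (x + v) = 0 := by
  intro v hv
  rw [mem_ball_zero_iff] at hv
  have hU : IsOpen {l : ℂ | x + l • v ∈ O} := hO.preimage (by fun_prop)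
  have hit : ∀ k : ℕ, ∀ φ : E → ℂ, DifferentiableOn ℂ φ O → (∀ x ∈ Γ, φ x = 0) → iteratedDeriv k (fun l : ℂ => φ (x + l • v)) 0 = 0 := by
    intro k
    induction k with
    | zero => intro φ _ h0; simpa using h0 x hx
    | succ k ih =>
      intro φ hφ h0
      rw [iteratedDeriv_succ']
      have : deriv (fun l : ℂ => φ (x + l • v)) =ᶠ[nhds 0] fun l => (fun y => fderiv ℂ φ y v) (x + l • v) := by
        filter_upwards [hU.mem_nhds (show (0:ℂ) ∈ {l : ℂ | x + l • v ∈ O} by simpa using hxO)] with l hl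
        exact (holo_line hO hφ x v l hl).deriv
      rw [this.iteratedDeriv_eq]
      exact ih _ (holo_fderiv hO hφ v) (fun y hy => by rw [hA φ hφ h0 y hy]; rfl)
  obtain ⟨R, hR1, hRv⟩ : ∃ R : ℝ, 1 < R ∧ R * ‖v‖ < ρ := by
    have h0 : 0 < ρ := (norm_nonneg v).trans_lt hv
    rcases (norm_nonneg v).eq_or_lt with h | h
    · exact ⟨2, by norm_num, by rw [← h]; simpa using h0⟩
    · obtain ⟨R, h1, h2⟩ := exists_between ((one_lt_div h).2 hv)
      exact ⟨R, h1, (lt_div_iff₀ h).1 h2⟩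
  have hmem : ∀ l ∈ ball (0:ℂ) R, x + l • v ∈ O := by
    intro l hl
    refine hρ ?_
    rw [mem_ball, dist_self_add_left, norm_smul]
    rw [mem_ball_zero_iff] at hl
    exact (mul_le_mul_of_nonneg_right hl.le (norm_nonneg v)).trans_lt hRv
  have hsum := Complex.hasSum_taylorSeries_on_ball (f := fun l : ℂ => φ (x + l • v)) (c := 0) (r := R)
    (fun l hl => (holo_line hO hφ x v l (hmem l hl)).differentiableAt.differentiableWithinAt)
    (z := 1) (by simpa using hR1)
  simp only [hit _ φ hφ hφ0, smul_zero, one_smul] at hsum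
  exact (hsum.unique hasSum_zero)

universe u

theorem lemR (d : ℕ) : ∀ (E : Type u) [NormedAddCommGroup E] [NormedSpace ℂ E] [FiniteDimensional ℂ E], Module.finrank ℂ E = d →
    ∀ (Γ O : Set E), IsOpen O → Γ ⊆ O → Γ.Nonempty → (∀ x ∈ Γ, ∀ U ∈ nhds x, ∃ y ∈ Γ, y ∈ U ∧ y ≠ x) →
    ∃ x' ∈ Γ, ∃ (E' : Type u) (_ : NormedAddCommGroup E') (_ : NormedSpace ℂ E') (_ : FiniteDimensional ℂ E') (ψ : E' → E) (ρ : ℝ), 0 < ρ ∧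
      DifferentiableOn ℂ ψ (ball 0 ρ) ∧ Set.InjOn ψ (ball 0 ρ) ∧ (∀ t ∈ ball 0 ρ, ψ t ∈ O) ∧
      (∃ U ∈ nhds x', Γ ∩ U ⊆ ψ '' ball 0 ρ) ∧
      ∀ φ : E → ℂ, DifferentiableOn ℂ φ O → (∀ x ∈ Γ, φ x = 0) → ∀ t ∈ ball 0 ρ, φ (ψ t) = 0 := by
  induction d using Nat.strong_induction_on with
  | _ d ih =>
  intro E _ _ _ hd Γ O hO hΓO hne hiso
  by_cases hA : ∀ φ : E → ℂ, DifferentiableOn ℂ φ O → (∀ x ∈ Γ, φ x = 0) → ∀ x ∈ Γ, fderiv ℂ φ x = 0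
  · obtain ⟨x, hx⟩ := hne
    obtain ⟨ρ, hρ, hb⟩ := Metric.isOpen_iff.1 hO x (hΓO hx)
    refine ⟨x, hx, E, inferInstance, inferInstance, inferInstance, fun t => x + t, ρ, hρ, ?_, ?_, ?_, ?_, ?_⟩
    · fun_prop
    · intro a _ b _ hab; simpa using hab
    · intro t ht; exact hb (by simpa [mem_ball, dist_eq_norm] using ht)
    · refine ⟨ball x ρ, ball_mem_nhds x hρ, fun y hy => ⟨y - x, ?_, by simp⟩⟩
      rw [mem_ball_zero_iff, ← dist_eq_norm]; exact hy.2
    · intro φ hφ h0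
      exact caseA hO hA hx hb (hΓO hx) hφ h0
  · push Not at hA
    obtain ⟨φ, hφ, hφ0, x, hx, hL⟩ := hA
    set L := fderiv ℂ φ x with hLd
    have hcomp : CompleteSpace E := FiniteDimensional.complete ℂ E
    obtain ⟨e, he⟩ : ∃ e, L e = 1 := by
      obtain ⟨v, hv⟩ : ∃ v, L v ≠ 0 := by
        by_contra hcon; push Not at hcon
        exact hL (ContinuousLinearMap.ext fun v => by simpa using hcon v)
      exact ⟨(L v)⁻¹ • v, by simp [hv]⟩
    set Φ : E → E := fun z => (z - x) + (φ z - L (z - x)) • e with hΦ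
    have hLΦ : ∀ z, L (Φ z) = φ z := by intro z; simp [hΦ, he]
    have hΦx : Φ x = 0 := by simp [hΦ, hφ0 x hx]
    have hφs : ContDiffAt ℂ 1 φ x := (holo_contDiff hO hφ).contDiffAt (hO.mem_nhds (hΓO hx))
    have hΦs : ContDiffAt ℂ 1 Φ x := by
      refine (contDiffAt_id.sub contDiffAt_const).add ((hφs.sub ?_).smul contDiffAt_const)
      exact L.contDiff.contDiffAt.comp x (contDiffAt_id.sub contDiffAt_const)
    have hΦd : HasFDerivAt Φ ((ContinuousLinearEquiv.refl ℂ E : E ≃L[ℂ] E) : E →L[ℂ] E) x := by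
      have h1 : HasFDerivAt (fun z => z - x) (ContinuousLinearMap.id ℂ E) x := (hasFDerivAt_id x).sub_const x
      have h2 : HasFDerivAt φ L x := (hφs.differentiableAt one_ne_zero).hasFDerivAt
      have h3 := h1.add ((h2.sub (L.hasFDerivAt.comp x h1)).smul_const e)
      refine h3.congr_fderiv ?_
      ext v; simp
    set P := hΦs.toOpenPartialHomeomorph Φ hΦd one_ne_zero with hP
    have hPc : ∀ z, P z = Φ z := fun z => rfl
    have hxs : x ∈ P.source := hΦs.mem_toOpenPartialHomeomorph_source hΦd one_ne_zero
    have h0t : (0:E) ∈ P.target := by rw [← hΦx, ← hPc]; exact P.map_source hxs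
    have hP0 : P.symm 0 = x := by rw [← hΦx, ← hPc]; exact P.left_inv hxs
    have hsm : ContDiffAt ℂ 1 P.symm 0 := by
      have := hΦs.to_localInverse hΦd one_ne_zero
      rw [hΦx] at this; exact this
    have hdiff : ∀ᶠ y in nhds (0:E), DifferentiableAt ℂ P.symm y := by
      filter_upwards [hsm.eventually (by simp)] with y hy
      exact hy.differentiableAt one_ne_zero
    have hinO : ∀ᶠ y in nhds (0:E), P.symm y ∈ O :=
      hsm.continuousAt.eventually (by rw [hP0]; exact hO.mem_nhds (hΓO hx))
    obtain ⟨σ, hσ, hball⟩ := Metric.eventually_nhds_iff_ball.1 ((hdiff.and hinO).and (P.open_target.eventually_mem h0t))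
    let K := LinearMap.ker (L : E →ₗ[ℂ] ℂ)
    have hKlt : Module.finrank ℂ K < d := by
      rw [← hd]
      refine Submodule.finrank_lt fun h => ?_
      have : e ∈ K := by rw [h]; trivial
      have : L e = 0 := this
      rw [he] at this; exact one_ne_zero this
    set Γ₁ : Set K := {t | (t:E) ∈ ball (0:E) σ ∧ P.symm t ∈ Γ} with hΓ₁
    have hcoe : Continuous (fun t : K => (t : E)) := continuous_subtype_val
    have hKd : DifferentiableOn ℂ (fun t : K => P.symm (t:E)) {t : K | (t:E) ∈ ball (0:E) σ} := by
      intro t ht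
      exact ((hball t ht).1.1.comp t (K.subtypeL.differentiableAt)).differentiableWithinAt
    -- key lifting fact
    have hlift : ∀ t ∈ Γ₁, ∀ W ∈ nhds t, ∃ U ∈ nhds (P.symm (t:E)), ∀ y ∈ Γ, y ∈ U → y ∈ P.source ∧ ∃ s ∈ Γ₁, s ∈ W ∧ P.symm (s:E) = y := by
      intro t ht W hW
      obtain ⟨W', hW', hWW⟩ := mem_nhds_subtype _ t W |>.1 hW
      have htt := (hball t ht.1).2
      have hys : P.symm (t:E) ∈ P.source := P.map_target htt
      have hc : ContinuousAt P (P.symm (t:E)) := P.continuousAt hys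
      have hev : ∀ᶠ y in nhds (P.symm (t:E)), P y ∈ W' ∩ ball (0:E) σ := by
        refine hc.eventually ?_
        rw [P.right_inv htt]
        exact Filter.inter_mem hW' (isOpen_ball.mem_nhds ht.1)
      refine ⟨_, hev.and (P.open_source.eventually_mem hys), fun y hy hyU => ⟨hyU.2, ?_⟩⟩
      have hk : P y ∈ K := by
        show L (P y) = 0
        rw [hPc, hLΦ]; exact hφ0 y hy
      have hinv : P.symm (P y) = y := P.left_inv hyU.2
      exact ⟨⟨P y, hk⟩, ⟨hyU.1.2, by show P.symm (P y) ∈ Γ; rw [hinv]; exact hy⟩, hWW hyU.1.1, hinv⟩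
    obtain ⟨t', ht', E', i1, i2, i3, ψ, ρ, hρ, hψd, hψi, hψO, ⟨W, hW, hΓW⟩, hψφ⟩ := ih _ hKlt K rfl Γ₁ {t : K | (t:E) ∈ ball (0:E) σ}
      (isOpen_ball.preimage hcoe) (fun t ht => ht.1) ⟨0, by simpa using hσ, by simpa [hP0] using hx⟩ (by
        intro t ht W hW
        obtain ⟨U, hU, hUW⟩ := hlift t ht W hW
        obtain ⟨y, hy, hyU, hyne⟩ := hiso _ ht.2 U hU
        obtain ⟨_, s, hs, hsW, hsy⟩ := hUW y hy hyU
        exact ⟨s, hs, hsW, fun h => hyne (by rw [← hsy, h])⟩)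
    refine ⟨P.symm t', ht'.2, E', i1, i2, i3, fun s => P.symm (ψ s : E), ρ, hρ, ?_, ?_, ?_, ?_, ?_⟩
    · exact hKd.comp hψd hψO
    · intro a ha b hb hab
      refine hψi ha hb (Subtype.ext ?_)
      exact P.symm.injOn (hball _ (hψO a ha)).2 (hball _ (hψO b hb)).2 hab
    · intro t ht; exact (hball _ (hψO t ht)).1.2
    · obtain ⟨U, hU, hUW⟩ := hlift t' ht' W hW
      refine ⟨U, hU, fun y hy => ?_⟩
      obtain ⟨_, s, hs, hsW, hsy⟩ := hUW y hy.1 hy.2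
      obtain ⟨a, ha, has⟩ := hΓW ⟨hs, hsW⟩
      exact ⟨a, ha, by rw [← hsy, ← has]⟩
    · intro φ' hφ' h0 t ht
      exact hψφ (fun s : K => φ' (P.symm (s:E))) (hφ'.comp hKd (fun s hs => (hball _ hs).1.2)) (fun s hs => h0 _ hs.2) t ht
end

def condP {E : Type*} [TopologicalSpace E] (Z B : Set E) : Set E := {z ∈ B | ∀ U ∈ nhds z, ¬ (Z ∩ U).Countable}

lemma condP_closed {E : Type*} [TopologicalSpace E] {Z B : Set E} (hB : IsClosed B) : IsClosed (condP Z B) := by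
  have : condP Z B = B ∩ {z | ∃ U ∈ nhds z, (Z ∩ U).Countable}ᶜ := by
    ext z; simp [condP]
  rw [this]
  refine hB.inter (IsOpen.isClosed_compl ?_)
  rw [isOpen_iff_mem_nhds]
  rintro z ⟨U, hU, hc⟩
  filter_upwards [eventually_mem_nhds_iff.2 hU] with y hy
  exact ⟨U, hy, hc⟩

lemma noncond_countable {E : Type*} [TopologicalSpace E] [SecondCountableTopology E] (Z : Set E) : {z ∈ Z | ∃ U ∈ nhds z, (Z ∩ U).Countable}.Countable := by
  have hB := TopologicalSpace.isBasis_countableBasis E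
  refine Set.Countable.mono (s₂ := ⋃ b ∈ {b ∈ TopologicalSpace.countableBasis E | (Z ∩ b).Countable}, Z ∩ b) ?_ ?_
  · rintro z ⟨hz, U, hU, hc⟩
    obtain ⟨b, hb, hzb, hbU⟩ := hB.mem_nhds_iff.1 hU
    rw [Set.mem_iUnion₂]
    exact ⟨b, ⟨hb, hc.mono (Set.inter_subset_inter_right _ hbU)⟩, hz, hzb⟩
  · exact Set.Countable.biUnion ((TopologicalSpace.countable_countableBasis E).mono fun b hb => hb.1) fun b hb => hb.2

lemma condP_exists {E : Type*} [TopologicalSpace E] [SecondCountableTopology E] {Z U : Set E} (h : ¬ (Z ∩ U).Countable) (x : E) :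
    ∃ y ∈ Z ∩ U, y ≠ x ∧ ∀ V ∈ nhds y, ¬ (Z ∩ V).Countable := by
  by_contra hcon
  push Not at hcon
  refine h (Set.Countable.mono (fun y hy => ?_) ((noncond_countable Z).union (Set.countable_singleton x)))
  by_cases hyx : y = x
  · exact Or.inr hyx
  · obtain ⟨V, hV, hc⟩ := hcon y hy hyx
    exact Or.inl ⟨hy.1, V, hV, hc⟩

theorem MAXP {n : ℕ} {O Z : Set (Fin n → ℂ)} {ι : Type*} {g : ι → (Fin n → ℂ) → ℂ} (hg : ∀ i, DifferentiableOn ℂ (g i) O)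
    (hZ : Z = {z ∈ O | ∀ i, g i z = 0}) {a : Fin n → ℂ} {r : ℝ} (hb : closedBall a r ⊆ O) (f : (Fin n → ℂ) → ℂ) (hf : DifferentiableOn ℂ f O)
    {x : Fin n → ℂ} (hx : x ∈ condP Z (closedBall a r)) : ∃ y ∈ condP Z (closedBall a r), y ∈ sphere a r ∧ ‖f x‖ ≤ ‖f y‖ := by
  set P := condP Z (closedBall a r) with hP
  have hPc : IsCompact P := (isCompact_closedBall a r).of_isClosed_subset (condP_closed isClosed_closedBall) fun z hz => hz.1
  have hPO : P ⊆ O := fun z hz => hb hz.1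
  have hPZ : ∀ z ∈ P, ∀ i, g i z = 0 := by
    intro z hz i
    by_contra hne
    have hcon : ContinuousWithinAt (g i) O z := (hg i).continuousOn z (hPO hz)
    have h1 : ∀ᶠ y in nhdsWithin z O, g i y ≠ 0 := hcon.eventually_ne hne
    rw [eventually_nhdsWithin_iff] at h1
    refine hz.2 _ h1 ?_
    convert Set.countable_empty (α := Fin n → ℂ)
    ext y
    simp only [Set.mem_inter_iff, Set.mem_empty_iff_false, iff_false, not_and]
    intro hy hy'
    rw [hZ] at hy
    exact hy' hy.1 (hy.2 i)
  have hPiso : ∀ z ∈ P, z ∈ ball a r → ∀ U ∈ nhds z, ∃ y ∈ P, y ∈ U ∧ y ≠ z := by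
    intro z hz hzb U hU
    obtain ⟨y, hy, hyz, hyc⟩ := condP_exists (hz.2 _ (Filter.inter_mem hU (isOpen_ball.mem_nhds hzb))) z
    exact ⟨y, ⟨ball_subset_closedBall hy.2.2, hyc⟩, hy.2.1, hyz⟩
  let 𝒞 : Set (Set (Fin n → ℂ)) := {Γ | IsClosed Γ ∧ P ∩ sphere a r ⊆ Γ ∧ Γ ⊆ P ∧
    ∀ f : (Fin n → ℂ) → ℂ, DifferentiableOn ℂ f O → ∀ x ∈ P, ∃ y ∈ Γ, ‖f x‖ ≤ ‖f y‖}
  have hP𝒞 : P ∈ 𝒞 := ⟨hPc.isClosed, Set.inter_subset_left, subset_rfl, fun f _ x hx => ⟨x, hx, le_rfl⟩⟩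
  obtain ⟨Γ, hΓm⟩ : ∃ Γ, Minimal (· ∈ 𝒞) Γ := by
    refine zorn_superset 𝒞 fun c hc hch => ?_
    rcases c.eq_empty_or_nonempty with rfl | hcne
    · exact ⟨P, hP𝒞, fun s hs => absurd hs (Set.notMem_empty s)⟩
    refine ⟨⋂₀ c, ⟨isClosed_sInter fun s hs => (hc hs).1, Set.subset_sInter fun s hs => (hc hs).2.1, ?_, ?_⟩, fun s hs => Set.sInter_subset_of_mem hs⟩
    · obtain ⟨s, hs⟩ := hcne
      exact (Set.sInter_subset_of_mem hs).trans (hc hs).2.2.1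
    · intro f hf x hx
      have : Nonempty c := hcne.to_subtype
      have hcl : ∀ s : c, IsClosed (s.1 ∩ {y | ‖f x‖ ≤ ‖f y‖}) := by
        intro s
        have := (hf.continuousOn.mono ((hc s.2).2.2.1.trans hPO)).norm.preimage_isClosed_of_isClosed (hc s.2).1 (isClosed_Ici (a := ‖f x‖))
        exact this
      obtain ⟨y, hy⟩ := IsCompact.nonempty_iInter_of_directed_nonempty_isCompact_isClosed (fun s : c => s.1 ∩ {y | ‖f x‖ ≤ ‖f y‖})
        (by
          intro s t
          rcases hch.total s.2 t.2 with h | h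
          · exact ⟨s, subset_rfl, Set.inter_subset_inter_left _ h⟩
          · exact ⟨t, Set.inter_subset_inter_left _ h, subset_rfl⟩)
        (fun s => (hc s.2).2.2.2 f hf x hx) (fun s => hPc.of_isClosed_subset (hcl s) (Set.inter_subset_left.trans (hc s.2).2.2.1)) hcl
      rw [Set.mem_iInter] at hy
      exact ⟨y, Set.mem_sInter.2 fun s hs => (hy ⟨s, hs⟩).1, (hy (Classical.arbitrary c)).2⟩
  obtain ⟨hΓcl, hΓs, hΓP, hΓf⟩ := hΓm.1
  have hΓc : IsCompact Γ := hPc.of_isClosed_subset hΓcl hΓP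
  by_cases hemp : ∀ y ∈ Γ, y ∉ ball a r
  · obtain ⟨y, hy, hxy⟩ := hΓf f hf x hx
    refine ⟨y, hΓP hy, ?_, hxy⟩
    exact ((mem_closedBall.1 (hΓP hy).1).lt_or_eq).resolve_left (hemp y hy)
  exfalso
  push Not at hemp
  have hpeak : ∀ W : Set (Fin n → ℂ), IsOpen W → W ⊆ ball a r → (Γ ∩ W).Nonempty → ∃ f : (Fin n → ℂ) → ℂ, DifferentiableOn ℂ f O ∧
      ∃ w ∈ Γ ∩ W, (∀ x ∈ P, ‖f x‖ ≤ ‖f w‖) ∧ ∀ y ∈ Γ, y ∉ W → ‖f y‖ < ‖f w‖ := by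
    intro W hW hWb hne
    have hnot : Γ \ W ∉ 𝒞 := by
      intro hmem
      obtain ⟨w, hw⟩ := hne
      exact (hΓm.2 hmem Set.diff_subset hw.1).2 hw.2
    have : ∃ f : (Fin n → ℂ) → ℂ, DifferentiableOn ℂ f O ∧ ∃ x ∈ P, ∀ y ∈ Γ \ W, ‖f y‖ < ‖f x‖ := by
      by_contra hcon
      push Not at hcon
      refine hnot ⟨hΓcl.sdiff hW, fun y hy => ⟨hΓs hy, fun hyW => ?_⟩, Set.diff_subset.trans hΓP, hcon⟩
      have h1 := mem_ball.1 (hWb hyW)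
      have h2 := mem_sphere.1 hy.2
      linarith
    obtain ⟨f, hf, x, hx, hfx⟩ := this
    obtain ⟨w, hw, hmax⟩ := hΓc.exists_isMaxOn (hne.mono Set.inter_subset_left) (hf.continuousOn.mono (hΓP.trans hPO)).norm
    have hwP : ∀ x ∈ P, ‖f x‖ ≤ ‖f w‖ := by
      intro x hx
      obtain ⟨y, hy, hxy⟩ := hΓf f hf x hx
      exact hxy.trans (hmax hy)
    refine ⟨f, hf, w, ⟨hw, ?_⟩, hwP, fun y hy hyW => (hfx y ⟨hy, hyW⟩).trans_le (hwP x hx)⟩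
    by_contra hwW
    exact absurd (hfx w ⟨hw, hwW⟩) (not_lt.2 (hwP x hx))
  have hiso : ∀ w₀ ∈ Γ ∩ ball a r, ∀ U ∈ nhds w₀, ∃ y ∈ Γ ∩ ball a r, y ∈ U ∧ y ≠ w₀ := by
    intro w₀ hw₀ U hU
    by_contra hcon
    push Not at hcon
    set W := interior U ∩ ball a r with hWd
    have hWo : IsOpen W := isOpen_interior.inter isOpen_ball
    have hw₀W : w₀ ∈ W := ⟨mem_interior_iff_mem_nhds.2 hU, hw₀.2⟩
    have hΓW : ∀ y ∈ Γ, y ∈ W → y = w₀ := fun y hy hyW => hcon y ⟨hy, hyW.2⟩ (interior_subset hyW.1)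
    obtain ⟨f, hf, w, hw, -, hfw⟩ := hpeak W hWo Set.inter_subset_right ⟨w₀, hw₀.1, hw₀W⟩
    obtain rfl := hΓW w hw.1 hw.2
    obtain ⟨c, hc0, hc1, hc⟩ : ∃ c : ℝ, 0 ≤ c ∧ (c < ‖f w‖ ∨ Γ \ W = ∅) ∧ ∀ y ∈ Γ \ W, ‖f y‖ ≤ c := by
      rcases (Γ \ W).eq_empty_or_nonempty with he | hne
      · exact ⟨0, le_rfl, Or.inr he, by simp [he]⟩
      · obtain ⟨y₁, hy₁, hmax⟩ := (hΓc.diff hWo).exists_isMaxOn hne (hf.continuousOn.mono (Set.diff_subset.trans (hΓP.trans hPO))).norm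
        exact ⟨‖f y₁‖, norm_nonneg _, Or.inl (hfw y₁ hy₁.1 hy₁.2), fun y hy => hmax hy⟩
    have hyex : ∃ y ∈ P, y ≠ w ∧ (c < ‖f y‖ ∨ Γ \ W = ∅) := by
      rcases hc1 with hc1 | hc1
      · have hcont : ContinuousWithinAt (fun y => ‖f y‖) O w := (hf.continuousOn w (hPO (hΓP hw.1))).norm
        have hev := hcont.eventually (lt_mem_nhds hc1)
        rw [eventually_nhdsWithin_iff] at hev
        obtain ⟨y, hy, hyU, hyw⟩ := hPiso w (hΓP hw.1) hw₀.2 _ hev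
        exact ⟨y, hy, hyw, Or.inl (hyU (hPO hy))⟩
      · obtain ⟨y, hy, _, hyw⟩ := hPiso w (hΓP hw.1) hw₀.2 _ Filter.univ_mem
        exact ⟨y, hy, hyw, Or.inr hc1⟩
    obtain ⟨y, hyP, hyw, hyc⟩ := hyex
    obtain ⟨i, hi⟩ := Function.ne_iff.1 hyw
    have hℓ : DifferentiableOn ℂ (fun z : Fin n → ℂ => z i - w i) O := by fun_prop
    have hℓy : 0 < ‖y i - w i‖ := norm_pos_iff.2 (sub_ne_zero.2 hi)
    obtain ⟨M, hM⟩ := hΓc.exists_bound_of_continuousOn (hℓ.continuousOn.mono (hΓP.trans hPO))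
    rcases hyc with hyc | hyc
    · have hfy : 0 < ‖f y‖ := hc0.trans_lt hyc
      have hk : ∀ k : ℕ, ‖y i - w i‖ ≤ (c / ‖f y‖)^k * M := by
        intro k
        obtain ⟨y', hy', hle⟩ := hΓf (fun z => f z ^ k * (z i - w i)) ((hf.pow k).mul hℓ) y hyP
        simp only [norm_mul, norm_pow] at hle
        have hpos : 0 < ‖f y‖^k * ‖y i - w i‖ := by positivity
        by_cases hy'W : y' ∈ W
        · rw [hΓW y' hy' hy'W, sub_self, norm_zero, mul_zero] at hle
          linarith
        · have h1 := hc y' ⟨hy', hy'W⟩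
          have h2 := hM y' hy'
          have h3 : ‖f y'‖^k * ‖y' i - w i‖ ≤ c^k * M := mul_le_mul (by gcongr) h2 (norm_nonneg _) (by positivity)
          rw [div_pow, div_mul_eq_mul_div, le_div_iff₀ (by positivity)]
          linarith
      have hlim : Filter.Tendsto (fun k : ℕ => (c / ‖f y‖)^k * M) Filter.atTop (nhds (0 * M)) :=
        (tendsto_pow_atTop_nhds_zero_of_lt_one (by positivity) ((div_lt_one hfy).2 hyc)).mul_const M
      have := ge_of_tendsto' hlim hk
      linarith
    · obtain ⟨y', hy', hle⟩ := hΓf _ hℓ y hyP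
      have : y' = w := hΓW y' hy' (by
        by_contra h
        have : y' ∈ Γ \ W := ⟨hy', h⟩
        rw [hyc] at this; exact this)
      simp only [this, sub_self, norm_zero] at hle
      linarith
  obtain ⟨x₁, hx₁, hx₁b⟩ := hemp
  obtain ⟨x', hx', E', i1, i2, i3, ψ, ρ, hρ, hψd, hψi, hψO, ⟨U, hU, hΓU⟩, hψφ⟩ := lemR _ (Fin n → ℂ) rfl (Γ ∩ ball a r) (ball a r) isOpen_ball
    Set.inter_subset_right ⟨x₁, hx₁, hx₁b⟩ hiso
  obtain ⟨y, hy, hyU, hyx⟩ := hiso x' hx' U hU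
  obtain ⟨ty, hty, htyy⟩ := hΓU ⟨hy, hyU⟩
  obtain ⟨tx, htx, htxx⟩ := hΓU ⟨hx', mem_of_mem_nhds hU⟩
  have hnt : Nontrivial E' := ⟨ty, tx, fun h => hyx (by rw [← htyy, ← htxx, h])⟩
  have hMP : ∀ s ∈ ball (0 : E') ρ, ψ s ∈ P := by
    intro s hs
    refine ⟨ball_subset_closedBall (hψO s hs), fun V hV hcount => ?_⟩
    have hpre : ball (0 : E') ρ ∩ ψ ⁻¹' V ∈ nhds s :=
      Filter.inter_mem (isOpen_ball.mem_nhds hs) ((hψd.continuousOn.continuousAt (isOpen_ball.mem_nhds hs)).preimage_mem_nhds hV)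
    have hmaps : Set.MapsTo ψ (ball (0 : E') ρ ∩ ψ ⁻¹' V) (Z ∩ V) := by
      rintro t ⟨ht, htV⟩
      refine ⟨?_, htV⟩
      rw [hZ]
      refine ⟨hb (ball_subset_closedBall (hψO t ht)), fun i => ?_⟩
      exact hψφ (g i) ((hg i).mono (ball_subset_closedBall.trans hb)) (fun x hx => hPZ x (hΓP hx.1) i) t ht
    have hc2 : (ball (0 : E') ρ ∩ ψ ⁻¹' V).Countable := hmaps.countable_of_injOn (hψi.mono Set.inter_subset_left) hcount
    have hdense := hc2.dense_compl ℂ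
    obtain ⟨t, ht, ht'⟩ := hdense.inter_nhds_nonempty hpre
    exact ht ht'
  obtain ⟨f, hf, w, hw, hwP, hfw⟩ := hpeak (interior U ∩ ball a r ∩ {y}ᶜ) ((isOpen_interior.inter isOpen_ball).inter isOpen_compl_singleton)
    (fun z hz => hz.1.2) ⟨x', hx'.1, ⟨mem_interior_iff_mem_nhds.2 hU, hx'.2⟩, fun h => hyx h.symm⟩
  obtain ⟨tw, htw, htww⟩ := hΓU ⟨⟨hw.1, hw.2.1.2⟩, interior_subset hw.2.1.1⟩
  have hfψ : DifferentiableOn ℂ (fun s => f (ψ s)) (ball 0 ρ) := hf.comp hψd fun s hs => hPO (hMP s hs)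
  have heq := Complex.norm_eqOn_of_isPreconnected_of_isMaxOn (convex_ball (0:E') ρ).isPreconnected isOpen_ball hfψ htw (by
    intro s hs
    show ‖f (ψ s)‖ ≤ ‖f (ψ tw)‖
    rw [htww]; exact hwP _ (hMP s hs)) hty
  have heq : ‖f (ψ ty)‖ = ‖f (ψ tw)‖ := heq
  rw [htww, htyy] at heq
  have := hfw y hy.1 (fun h => h.2 rfl)
  linarith

lemma const_of_conj {n : ℕ} {u v : (Fin n → ℂ) → ℂ} {O : Set (Fin n → ℂ)} (hO : IsOpen O) (hc : IsPreconnected O)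
    (hu : DifferentiableOn ℂ u O) (hv : DifferentiableOn ℂ v O) (huv : ∀ z ∈ O, u z = starRingEnd ℂ (v z)) :
    ∀ z ∈ O, ∀ w ∈ O, u z = u w := by
  have hd : ∀ z ∈ O, fderiv ℂ u z = 0 := by
    intro z hz
    have h1 := ((hu.differentiableAt (hO.mem_nhds hz)).hasFDerivAt).restrictScalars ℝ
    have h2 := ((hv.differentiableAt (hO.mem_nhds hz)).hasFDerivAt).restrictScalars ℝ
    have h3 : HasFDerivAt (fun z => starRingEnd ℂ (v z)) ((Complex.conjCLE : ℂ →L[ℝ] ℂ).comp ((fderiv ℂ v z).restrictScalars ℝ)) z :=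
      ((Complex.conjCLE : ℂ →L[ℝ] ℂ).hasFDerivAt).comp z h2
    have h4 : HasFDerivAt u ((Complex.conjCLE : ℂ →L[ℝ] ℂ).comp ((fderiv ℂ v z).restrictScalars ℝ)) z := by
      refine h3.congr_of_eventuallyEq ?_
      filter_upwards [hO.mem_nhds hz] with w hw using huv w hw
    have h5 := h1.unique h4
    have h6 : ∀ w, fderiv ℂ u z w = starRingEnd ℂ (fderiv ℂ v z w) := fun w => by
      have := congrArg (fun L => L w) h5
      simpa using this
    ext1 w
    have h7 := h6 (Complex.I • w)
    rw [map_smul, map_smul, smul_eq_mul, smul_eq_mul, map_mul, Complex.conj_I, ← h6] at h7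
    have h8 : 2 * Complex.I * fderiv ℂ u z w = 0 := by linear_combination h7
    simpa using h8
  intro z hz w hw
  exact hO.is_const_of_fderiv_eq_zero hc hu (fun x hx => hd x hx) hz hw

lemma fiber_loc {n N : ℕ} {h : Fin N → (Fin n → ℂ) → ℂ} {U U' : Set (Fin n → ℂ)} {F G F' G' : Fin N → (Fin n → ℂ) → ℂ}
    (hr : IsRep h U F G) (hr' : IsRep h U' F' G') {q : Fin n → ℂ} (hq : q ∈ U) (hq' : q ∈ U') :
    ∃ O ∈ nhds q, O ⊆ U ∩ U' ∧ ∀ z ∈ O, ∀ w ∈ O, ∀ j, G j z - G' j z = G j w - G' j w := by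
  obtain ⟨r, hr0, hb⟩ := Metric.isOpen_iff.1 (hr.1.inter hr'.1) q ⟨hq, hq'⟩
  refine ⟨ball q r, ball_mem_nhds q hr0, hb, fun z hz w hw j => ?_⟩
  have hs : ball q r ⊆ U := fun z hz => (hb hz).1
  have hs' : ball q r ⊆ U' := fun z hz => (hb hz).2
  refine const_of_conj (u := fun z => G j z - G' j z) (v := fun z => F' j z - F j z) isOpen_ball (convex_ball q r).isPreconnected
    (((hr.2.2.1 j).mono hs).sub ((hr'.2.2.1 j).mono hs')) (((hr'.2.1 j).mono hs').sub ((hr.2.1 j).mono hs)) ?_ z hz w hw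
  intro z hz
  have e1 := hr.2.2.2 j z (hs hz)
  have e2 := hr'.2.2.2 j z (hs' hz)
  have e3 : F' j z - F j z = starRingEnd ℂ (G j z - G' j z) := by
    rw [map_sub]; linear_combination e1 - e2
  show G j z - G' j z = _
  rw [e3, Complex.conj_conj]

def fib {n N : ℕ} (U : Set (Fin n → ℂ)) (G : Fin N → (Fin n → ℂ) → ℂ) (c : Fin N → ℂ) : Set (Fin n → ℂ) :=
  {z ∈ U | ∀ j, G j z - c j = 0}

def badS {n N : ℕ} (h : Fin N → (Fin n → ℂ) → ℂ) (Ω : Set (Fin n → ℂ)) : Set (Fin n → ℂ) :=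
  {q | q ∈ Ω ∧ ∀ U F G, IsRep h U F G → q ∈ U → ∀ O ∈ nhds q, ¬ (fib U G (fun j => G j q) ∩ O).Countable}

lemma bad_of_one {n N : ℕ} {h : Fin N → (Fin n → ℂ) → ℂ} {Ω U : Set (Fin n → ℂ)} {F G : Fin N → (Fin n → ℂ) → ℂ}
    (hr : IsRep h U F G) {q : Fin n → ℂ} (hq : q ∈ U) (hΩ : q ∈ Ω)
    (H : ∀ O ∈ nhds q, ¬ (fib U G (fun j => G j q) ∩ O).Countable) : q ∈ badS h Ω := by
  refine ⟨hΩ, fun U' F' G' hr' hq' O' hO' hc => ?_⟩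
  obtain ⟨O, hO, hOs, hOe⟩ := fiber_loc hr hr' hq hq'
  refine H (O ∩ O') (Filter.inter_mem hO hO') (hc.mono ?_)
  rintro z ⟨⟨hzU, hz⟩, hzO, hzO'⟩
  refine ⟨⟨(hOs hzO).2, fun j => ?_⟩, hzO'⟩
  have := hOe z hzO q (mem_of_mem_nhds hO) j
  have h2 := hz j
  show G' j z - G' j q = 0
  linear_combination h2 - this

lemma condP_fib {n N : ℕ} {h : Fin N → (Fin n → ℂ) → ℂ} {Ω U B : Set (Fin n → ℂ)} {F G : Fin N → (Fin n → ℂ) → ℂ}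
    (hr : IsRep h U F G) (hB : B ⊆ U) (hUΩ : B ⊆ Ω) {c : Fin N → ℂ} {z : Fin n → ℂ} (hz : z ∈ condP (fib U G c) B) :
    (∀ j, G j z = c j) ∧ z ∈ badS h Ω := by
  have hzU := hB hz.1
  have h1 : ∀ j, G j z = c j := by
    intro j
    by_contra hne
    have hcon : ContinuousAt (G j) z := ((hr.2.2.1 j).continuousOn).continuousAt (hr.1.mem_nhds hzU)
    have h1 : ∀ᶠ y in nhds z, G j y ≠ c j := hcon.eventually_ne hne
    refine hz.2 _ h1 ?_
    have : fib U G c ∩ {y | G j y ≠ c j} = ∅ := by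
      ext y
      simp only [Set.mem_inter_iff, Set.mem_empty_iff_false, iff_false]
      rintro ⟨hy, hy2⟩
      exact hy2 (sub_eq_zero.1 (hy.2 j))
    rw [this]; exact Set.countable_empty
  refine ⟨h1, bad_of_one hr hzU (hUΩ hz.1) ?_⟩
  have : (fun j => G j z) = c := funext h1
  rw [this]; exact hz.2

lemma good_sphere {n N : ℕ} {h : Fin N → (Fin n → ℂ) → ℂ} {Ω : Set (Fin n → ℂ)} {q : Fin n → ℂ} (hq : q ∈ Ω) (hqE : q ∉ badS h Ω)
    {V : Set (Fin n → ℂ)} (hV : V ∈ nhds q) :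
    ∃ U F G r, IsRep h U F G ∧ 0 < r ∧ closedBall q r ⊆ U ∩ V ∧ ∀ z ∈ sphere q r, ∃ j, G j z ≠ G j q := by
  have : ∃ U F G, IsRep h U F G ∧ q ∈ U ∧ ∃ O ∈ nhds q, (fib U G (fun j => G j q) ∩ O).Countable := by
    by_contra hcon
    push Not at hcon
    exact hqE ⟨hq, hcon⟩
  obtain ⟨U, F, G, hr, hqU, O, hO, hc⟩ := this
  obtain ⟨R, hR, hb⟩ := Metric.mem_nhds_iff.1 (Filter.inter_mem (Filter.inter_mem (hr.1.mem_nhds hqU) hV) hO)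
  have hcr : ((fun z => dist z q) '' (fib U G (fun j => G j q) ∩ O)).Countable := hc.image _
  have hun : ¬ (Set.Ioo 0 R).Countable := by
    intro hcc
    have := hcc.measure_zero MeasureTheory.volume
    rw [Real.volume_Ioo] at this
    simp at this; linarith
  obtain ⟨r, hrI, hrn⟩ : ∃ r ∈ Set.Ioo 0 R, r ∉ ((fun z => dist z q) '' (fib U G (fun j => G j q) ∩ O)) := by
    by_contra hcon
    push Not at hcon
    exact hun (hcr.mono hcon)
  have hcb : closedBall q r ⊆ ball q R := closedBall_subset_ball hrI.2
  refine ⟨U, F, G, r, hr, hrI.1, fun z hz => (hb (hcb hz)).1, fun z hz => ?_⟩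
  by_contra hcon
  push Not at hcon
  have hzc := hb (hcb (sphere_subset_closedBall hz))
  exact hrn ⟨z, ⟨⟨hzc.1.1, fun j => sub_eq_zero.2 (hcon j)⟩, hzc.2⟩, hz⟩

lemma bad_open {n N : ℕ} {h : Fin N → (Fin n → ℂ) → ℂ} {Ω : Set (Fin n → ℂ)} (hop : IsOpen Ω) {q : Fin n → ℂ} (hq : q ∈ Ω) (hqE : q ∉ badS h Ω) :
    ∀ᶠ q' in nhds q, q' ∉ badS h Ω := by
  obtain ⟨U, F, G, r, hr, hr0, hcb, hsp⟩ := good_sphere hq hqE (hop.mem_nhds hq)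
  have hcU : closedBall q r ⊆ U := fun z hz => (hcb hz).1
  have hcΩ : closedBall q r ⊆ Ω := fun z hz => (hcb hz).2
  have hGc : ContinuousOn (fun z j => G j z) U := continuousOn_pi.2 fun j => (hr.2.2.1 j).continuousOn
  have hSc : IsCompact ((fun z j => G j z) '' sphere q r) := (isCompact_sphere q r).image_of_continuousOn (hGc.mono fun z hz => hcU (sphere_subset_closedBall hz))
  have hqn : (fun j => G j q) ∉ (fun z j => G j z) '' sphere q r := by
    rintro ⟨z, hz, he⟩
    obtain ⟨j, hj⟩ := hsp z hz
    exact hj (congrFun he j)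
  have hca : ContinuousAt (fun z j => G j z) q := hGc.continuousAt (hr.1.mem_nhds (hcU (mem_closedBall_self hr0.le)))
  have hev : ∀ᶠ q' in nhds q, (fun j => G j q') ∈ ((fun z j => G j z) '' sphere q r)ᶜ :=
    hca.eventually (hSc.isClosed.isOpen_compl.mem_nhds hqn)
  filter_upwards [hev, ball_mem_nhds q hr0] with q' h1 h2 hbad
  have hq'U := hcU (ball_subset_closedBall h2)
  have hx : q' ∈ condP (fib U G fun j => G j q') (closedBall q r) := ⟨ball_subset_closedBall h2, hbad.2 U F G hr hq'U⟩
  obtain ⟨y, hyP, hyS, -⟩ := MAXP (g := fun j z => G j z - G j q') (fun j => (hr.2.2.1 j).sub (differentiableOn_const _)) rfl hcU (fun _ => 1) (differentiableOn_const _) hx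
  exact h1 ⟨y, hyS, funext (condP_fib hr hcU hcΩ hyP).1⟩

lemma rep_exists {n N : ℕ} {h : Fin N → (Fin n → ℂ) → ℂ} {Ω : Set (Fin n → ℂ)} (hop : IsOpen Ω) (hph : ∀ j, Pluriharmonic (h j) Ω) {q : Fin n → ℂ} (hq : q ∈ Ω) :
    ∃ U F G, IsRep h U F G ∧ q ∈ U ∧ U ⊆ Ω := by
  choose U hU hqU hUs F G hF hG hh using fun j => hph j q hq
  refine ⟨Ω ∩ ⋂ j, U j, F, G, ⟨hop.inter (isOpen_iInter_of_finite hU), fun j => (hF j).mono ?_, fun j => (hG j).mono ?_, fun j w hw => hh j w ?_⟩, ⟨hq, Set.mem_iInter.2 hqU⟩, Set.inter_subset_left⟩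
  · exact fun z hz => Set.mem_iInter.1 hz.2 j
  · exact fun z hz => Set.mem_iInter.1 hz.2 j
  · exact Set.mem_iInter.1 hw.2 j

lemma eval_hol {m n : ℕ} {U : Set (Fin n → ℂ)} {φ : (Fin n → ℂ) → Fin m → ℂ} (hφ : ∀ i, DifferentiableOn ℂ (fun z => φ z i) U) (p : MvPolynomial (Fin m) ℂ) :
    DifferentiableOn ℂ (fun z => MvPolynomial.eval (φ z) p) U := by
  induction p using MvPolynomial.induction_on with
  | C a => simpa using differentiableOn_const a
  | add p q hp hq => simp only [map_add]; exact hp.fun_add hq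
  | mul_X p i hp => simp only [map_mul, MvPolynomial.eval_X]; exact hp.fun_mul (hφ i)

lemma sep_polyB {n N : ℕ} {Ω : Set (Fin n → ℂ)} (hbd : Bornology.IsBounded Ω) (hop : IsOpen Ω) {h : Fin N → (Fin n → ℂ) → ℂ}
    (hbdry : genAlg (zhGens (frontier Ω) h) = Set.univ) {q : Fin n → ℂ} (hq : q ∈ Ω) :
    ∃ p : MvPolynomial (Fin (n+N)) ℂ, ev h p q = 1 ∧ ∀ z ∈ frontier Ω, ‖ev h p z‖ < 1/2 := by
  have hcl : IsCompact (closure Ω) := hbd.isCompact_closure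
  have hfr : IsCompact (frontier Ω) := hcl.of_isClosed_subset isClosed_frontier frontier_subset_closure
  have hQ : ∀ z ∈ frontier Ω, Qf (z - q) ≠ 0 := by
    intro z hz h0
    have h1 := Qf_ge (z - q)
    rw [h0] at h1
    have h2 : ‖z - q‖ = 0 := by nlinarith [norm_nonneg (z - q)]
    have h3 : z = q := sub_eq_zero.1 (norm_eq_zero.1 h2)
    rw [hop.frontier_eq] at hz
    exact hz.2 (h3 ▸ hq)
  obtain ⟨C, hC⟩ := hfr.exists_bound_of_continuousOn (f := fun z => z - q) (by fun_prop)
  set C' := max C 1 with hC'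
  have hC'1 : 1 ≤ C' := le_max_right _ _
  set δ : ℝ := 1 / (2 * ((n + 1) * C')) with hδ
  have hδ0 : 0 < δ := by positivity
  have hf : ∀ i : Fin n, ContinuousOn (fun z : Fin n → ℂ => starRingEnd ℂ (z i - q i) / (Qf (z - q) : ℂ)) (frontier Ω) := by
    intro i
    refine ContinuousOn.div (by fun_prop) ?_ ?_
    · exact (Complex.continuous_ofReal.comp (Qf_cont.comp (continuous_id.sub continuous_const))).continuousOn
    · intro z hz; exact_mod_cast hQ z hz
  choose a ha using fun i => bdry_approx hfr hbdry (hf i) hδ0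
  refine ⟨1 - ∑ i, a i * (MvPolynomial.X (Fin.castAdd N i) - MvPolynomial.C (q i)), ?_, ?_⟩
  · simp [ev]
  · intro z hz
    have e1 : ev h (1 - ∑ i, a i * (MvPolynomial.X (Fin.castAdd N i) - MvPolynomial.C (q i))) z = 1 - ∑ i, ev h (a i) z * (z i - q i) := by
      simp [ev]
    have hQc : (Qf (z - q) : ℂ) ≠ 0 := by exact_mod_cast hQ z hz
    have e2 : ∑ i, (starRingEnd ℂ (z i - q i) / (Qf (z - q) : ℂ)) * (z i - q i) = 1 := by
      have : ∀ i, (starRingEnd ℂ (z i - q i) / (Qf (z - q) : ℂ)) * (z i - q i) = ((‖(z - q) i‖^2 : ℝ) : ℂ) / (Qf (z - q) : ℂ) := by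
        intro i
        rw [div_mul_eq_mul_div, mul_comm, Complex.mul_conj, Complex.normSq_eq_norm_sq]; rfl
      rw [Finset.sum_congr rfl fun i _ => this i, ← Finset.sum_div, ← Complex.ofReal_sum]
      exact div_self hQc
    rw [e1, ← e2, ← Finset.sum_sub_distrib]
    calc _ ≤ ∑ i : Fin n, δ * C' := by
          refine norm_sum_le_of_le _ fun i _ => ?_
          rw [← sub_mul, norm_mul]
          gcongr
          · exact (ha i z hz).le
          · exact ((norm_le_pi_norm (z - q) i).trans (hC z hz)).trans (le_max_left _ _)
      _ = n * (δ * C') := by simp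
      _ < (n + 1) * (δ * C') := by
          have : 0 < δ * C' := by positivity
          nlinarith
      _ = 1/2 := by rw [hδ]; field_simp

lemma bad_empty {n N : ℕ} {Ω : Set (Fin n → ℂ)} (hbd : Bornology.IsBounded Ω) (hop : IsOpen Ω) {h : Fin N → (Fin n → ℂ) → ℂ}
    (hcont : ∀ j, ContinuousOn (h j) (closure Ω)) (hph : ∀ j, Pluriharmonic (h j) Ω)
    (hbdry : genAlg (zhGens (frontier Ω) h) = Set.univ) (q : Fin n → ℂ) : q ∉ badS h Ω := by
  intro hqE
  have hcl : IsCompact (closure Ω) := hbd.isCompact_closure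
  obtain ⟨p, hpq, hpf⟩ := sep_polyB hbd hop hbdry hqE.1
  set K := closure Ω \ {z | z ∈ Ω ∧ z ∉ badS h Ω} with hK
  have hKc : IsCompact K := by
    refine hcl.diff ?_
    rw [isOpen_iff_mem_nhds]
    rintro z ⟨hz, hzE⟩
    exact (hop.eventually_mem hz).and (bad_open hop hz hzE)
  obtain ⟨C, hC⟩ := hcl.exists_bound_of_continuousOn (f := (Qf : (Fin n → ℂ) → ℝ)) Qf_cont.continuousOn
  set C' := max C 1 with hC'
  have hC'1 : 1 ≤ C' := le_max_right _ _
  set ε : ℝ := Real.log (3/2) / C' with hε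
  have hlog : 0 < Real.log (3/2) := Real.log_pos (by norm_num)
  have hε0 : 0 < ε := by positivity
  have hexp : ∀ z ∈ closure Ω, Real.exp (ε * Qf z) ≤ 3/2 := by
    intro z hz
    rw [← Real.exp_log (show (0:ℝ) < 3/2 by norm_num)]
    apply Real.exp_le_exp.2
    have h1 : Qf z ≤ C' := ((le_abs_self _).trans (hC z hz)).trans (le_max_left _ _)
    calc ε * Qf z ≤ ε * C' := by gcongr
      _ = _ := by rw [hε]; field_simp
  have hΦ : ContinuousOn (fun z => ‖ev h p z‖ * Real.exp (ε * Qf z)) K := by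
    refine ContinuousOn.mul ((ev_cont hcont p).mono fun z hz => hz.1).norm ?_
    exact (Real.continuous_exp.comp (continuous_const.mul Qf_cont)).continuousOn
  have hqK : q ∈ K := ⟨subset_closure hqE.1, fun hh => hh.2 hqE⟩
  obtain ⟨x, hxK, hmax⟩ := hKc.exists_isMaxOn ⟨q, hqK⟩ hΦ
  have hmax : ∀ z ∈ K, ‖ev h p z‖ * Real.exp (ε * Qf z) ≤ ‖ev h p x‖ * Real.exp (ε * Qf x) := fun z hz => hmax hz
  have hx1 : 1 ≤ ‖ev h p x‖ * Real.exp (ε * Qf x) := by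
    refine le_trans ?_ (hmax q hqK)
    rw [hpq, norm_one, one_mul]
    exact Real.one_le_exp (mul_nonneg hε0.le (Qf_nonneg q))
  have hxΩ : x ∈ Ω := by
    by_contra hxn
    have h1 := hpf x (by rw [hop.frontier_eq]; exact ⟨hxK.1, hxn⟩)
    have h2 := hexp x hxK.1
    have h3 := Real.exp_pos (ε * Qf x)
    nlinarith [norm_nonneg (ev h p x)]
  have hxE : x ∈ badS h Ω := by
    by_contra hh
    exact hxK.2 ⟨hxΩ, hh⟩
  obtain ⟨U, F, G, hr, hxU, hUΩ⟩ := rep_exists hop hph hxΩ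
  obtain ⟨r, hr0, hcb⟩ := Metric.nhds_basis_closedBall.mem_iff.1 (hr.1.mem_nhds hxU)
  set f : (Fin n → ℂ) → ℂ := fun z => MvPolynomial.eval (Fin.append z (fun j => F j z + starRingEnd ℂ (G j x))) p *
    Complex.exp (2 * ε * ∑ i, starRingEnd ℂ (x i) * (z i - x i)) with hfdef
  have hf : DifferentiableOn ℂ f U := by
    refine DifferentiableOn.fun_mul (eval_hol (fun i => ?_) p) ?_
    · refine Fin.addCases (fun i => ?_) (fun j => ?_) i
      · simp only [Fin.append_left]; fun_prop
      · simp only [Fin.append_right]; exact (hr.2.1 j).add_const _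
    · fun_prop
  have hfib : ∀ z ∈ U, (∀ j, G j z = G j x) → ‖f z‖ * Real.exp (ε * Qf x) * Real.exp (ε * Qf (z - x)) = ‖ev h p z‖ * Real.exp (ε * Qf z) := by
    intro z hz hG
    have e1 : MvPolynomial.eval (Fin.append z (fun j => F j z + starRingEnd ℂ (G j x))) p = ev h p z := by
      unfold ev
      have : (fun j => F j z + starRingEnd ℂ (G j x)) = fun j => h j z := by
        ext j
        rw [hr.2.2.2 j z hz, hG]
      rw [this]
    rw [hfdef]
    simp only
    rw [e1, norm_mul, Complex.norm_exp, mul_assoc, mul_assoc, ← Real.exp_add, ← Real.exp_add, Qf_id z x]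
    congr 2
    have : (2 * (ε:ℂ) * ∑ i, starRingEnd ℂ (x i) * (z i - x i)).re = 2 * ε * (∑ i, starRingEnd ℂ (x i) * (z i - x i)).re := by
      rw [show (2 * (ε:ℂ)) = ((2 * ε : ℝ) : ℂ) by push_cast; ring, Complex.re_ofReal_mul]
    rw [this]; ring
  have hxP : x ∈ condP (fib U G fun j => G j x) (closedBall x r) := ⟨mem_closedBall_self hr0.le, hxE.2 U F G hr hxU⟩
  obtain ⟨y, hyP, hyS, hxy⟩ := MAXP (g := fun j z => G j z - G j x) (fun j => (hr.2.2.1 j).sub (differentiableOn_const _)) rfl hcb f hf hxP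
  obtain ⟨hyG, hyE⟩ := condP_fib (Ω := Ω) hr hcb (fun z hz => hUΩ (hcb hz)) hyP
  have hyU := hcb hyP.1
  have h1 := hfib x hxU fun _ => rfl
  have h2 := hfib y hyU hyG
  have h3 := hmax y ⟨subset_closure hyE.1, fun hh => hh.2 hyE⟩
  have h4 : Qf (x - x) = 0 := by simp [Qf]
  rw [h4, mul_zero, Real.exp_zero, mul_one] at h1
  rw [← h1, ← h2] at h3
  rw [← h1] at hx1
  have h5 : 0 < Qf (y - x) := by
    refine lt_of_lt_of_le ?_ (Qf_ge _)
    have : ‖y - x‖ = r := by rw [← dist_eq_norm]; exact hyS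
    rw [this]; positivity
  have h6 : 1 < Real.exp (ε * Qf (y - x)) := Real.one_lt_exp_iff.2 (by positivity)
  have h7 := Real.exp_pos (ε * Qf x)
  have h8 : ‖f x‖ * Real.exp (ε * Qf x) ≤ ‖f y‖ * Real.exp (ε * Qf x) := by gcongr
  nlinarith

theorem stmt1 {n N : ℕ} (Ω : Set (Fin n → ℂ)) (hne : Ω.Nonempty)
    (hbd : Bornology.IsBounded Ω) (hconn : IsConnected Ω) (hop : IsOpen Ω)
    (hC1 : C1Boundary Ω) (hpc : polyHull (closure Ω) = closure Ω)
    (h : Fin N → (Fin n → ℂ) → ℂ)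
    (hcont : ∀ j, ContinuousOn (h j) (closure Ω))
    (hph : ∀ j, Pluriharmonic (h j) Ω)
    (hbdry : genAlg (zhGens (frontier Ω) h) = Set.univ) :
    genAlg (zhGens (closure Ω) h) = Set.univ := by
  have hcl : IsCompact (closure Ω) := hbd.isCompact_closure
  have hfr : IsCompact (frontier Ω) := hcl.of_isClosed_subset isClosed_frontier frontier_subset_closure
  refine gen_of_approx hcl hcont fun f hf ε hε => ?_
  rcases Nat.eq_zero_or_pos n with rfl | hn
  · refine ⟨MvPolynomial.C (f 0), fun z _ => ?_⟩
    rw [Subsingleton.elim z 0]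
    simpa [ev] using hε
  · refine glue (Y := frontier Ω) hcl hcont (fun f hf ε hε => bdry_approx hfr hbdry (hf.mono frontier_subset_closure) hε) ?_ f hf ε hε
    intro q hq hqf V hV
    have hqΩ : q ∈ Ω := by
      by_contra hh
      exact hqf (by rw [hop.frontier_eq]; exact ⟨hq, hh⟩)
    obtain ⟨U, F, G, r, hr, hr0, hcb, hsp⟩ := good_sphere hqΩ (bad_empty hbd hop hcont hph hbdry q) hV
    obtain ⟨V', hV'o, hqV', hV's, H⟩ := peak_step hn hcl hcont (graph_polyconvex hne hn hbd hop hC1 hpc h hcont hph) hr hq hr0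
      (fun z hz => (hcb hz).1) hsp
    refine ⟨V', hV'o.mem_nhds hqV', fun z hz => (hcb (hV's hz)).2, fun η hη => ?_⟩
    obtain ⟨p, hp1, hp2, hp3⟩ := H η hη
    exact ⟨p, hp1, fun z hz hzV => hp2 z hz fun hh => hzV (hcb hh).2, hp3⟩
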